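/- Let G be an Artin group of large type (m_{ij} ≥ 3 for all i ≠ j) whose defining Coxeter matrix satisfies the (3,3,m)-hypothesis, i.e. there are no pairwise distinct indices i, j, k with m_{ij} = m_{ik} = 3 and m_{jk} < ∞. Then G has the rapid decay property with respect to the word length ℓ on the standard generators. -/

import Mathlib

namespace ArtinRD

/-- The alternating product `xyxy...` with `m` factors, starting with `x`. -/
def altProd {G : Type*} [Monoid G] : ℕ → G → G → G
  | 0, _, _ => 1
  | n + 1, x, y => x * altProd n y x

/-- The Artin relators determined by a Coxeter-type matrix `M` (`⊤` meaning `∞`). -/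
def artinRels (n : ℕ) (M : Fin n → Fin n → ℕ∞) : Set (FreeGroup (Fin n)) :=
  {r | ∃ i j : Fin n, i ≠ j ∧ ∃ m : ℕ, M i j = (m : ℕ∞) ∧
    r = altProd m (FreeGroup.of i) (FreeGroup.of j) *
        (altProd m (FreeGroup.of j) (FreeGroup.of i))⁻¹}

/-- The Artin group associated to the matrix `M`. -/
abbrev ArtinGroup (n : ℕ) (M : Fin n → Fin n → ℕ∞) : Type := PresentedGroup (artinRels n M)

/-- The standard generator `x_i` of the Artin group. -/
def gen (n : ℕ) (M : Fin n → Fin n → ℕ∞) (i : Fin n) : ArtinGroup n M := PresentedGroup.of i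

/-- The set `A = {x_1^{±1}, ..., x_n^{±1}}` of standard letters. -/
def genSet (n : ℕ) (M : Fin n → Fin n → ℕ∞) : Set (ArtinGroup n M) :=
  {g | ∃ i : Fin n, g = gen n M i ∨ g = (gen n M i)⁻¹}

/-- Word length of `g` with respect to a set `S`: the least `N` such that `g` is a
product of `N` elements of `S`. -/
noncomputable def wordLength {G : Type*} [Group G] (S : Set G) (g : G) : ℕ :=
  sInf {N : ℕ | ∃ w : List G, (∀ a ∈ w, a ∈ S) ∧ w.length = N ∧ w.prod = g}

/-- The word length on an Artin group with respect to the standard letters. -/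
noncomputable def ℓA (n : ℕ) (M : Fin n → Fin n → ℕ∞) : ArtinGroup n M → ℕ :=
  wordLength (genSet n M)

/-- Convolution of finitely supported functions on a group. -/
noncomputable def conv {G : Type*} [Group G] (φ ψ : G →₀ ℂ) : G → ℂ :=
  fun g => φ.sum fun h c => c * ψ (h⁻¹ * g)

/-- The `ℓ²` norm of a function on `G`. -/
noncomputable def l2Norm {G : Type*} (f : G → ℂ) : ℝ := Real.sqrt (∑' g : G, ‖f g‖ ^ 2)

/-- The Sobolev norm of order `r` with respect to the length function `ℓ`. -/
noncomputable def sobolevNorm {G : Type*} (ℓ : G → ℕ) (r : ℝ) (f : G → ℂ) : ℝ :=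
  Real.sqrt (∑' g : G, ‖f g‖ ^ 2 * (1 + (ℓ g : ℝ)) ^ (2 * r))

/-- The rapid decay property of `G` with respect to the length function `ℓ`. -/
def RapidDecay {G : Type*} [Group G] (ℓ : G → ℕ) : Prop :=
  ∃ C : ℝ, 0 < C ∧ ∃ r : ℝ, 0 ≤ r ∧
    ∀ φ ψ : G →₀ ℂ,
      l2Norm (conv φ ψ) ≤ C * sobolevNorm ℓ r (fun g => φ g) * l2Norm (fun g => ψ g)

end ArtinRD


set_option linter.all false

namespace ArtinRD

section Analysis
open MonoidAlgebra
variable {G : Type*} [Group G]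

noncomputable def ip (f g : MonoidAlgebra ℝ G) : ℝ := f.coeff.sum fun h c => c * g.coeff h

lemma ip_eq_sum (f g : MonoidAlgebra ℝ G) (T : Finset G) (hT : f.coeff.support ⊆ T) :
    ip f g = ∑ h ∈ T, f.coeff h * g.coeff h := by
  unfold ip
  rw [Finsupp.sum_of_support_subset _ hT]
  intro i _; simp

lemma ip_comm (f g : MonoidAlgebra ℝ G) : ip f g = ip g f := by
  classical
  rw [ip_eq_sum f g (f.coeff.support ∪ g.coeff.support) Finset.subset_union_left,
    ip_eq_sum g f (f.coeff.support ∪ g.coeff.support) Finset.subset_union_right]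
  exact Finset.sum_congr rfl fun x _ => mul_comm _ _

lemma ip_add_left (f f' g : MonoidAlgebra ℝ G) : ip (f + f') g = ip f g + ip f' g := by
  unfold ip
  rw [MonoidAlgebra.coeff_add, Finsupp.sum_add_index']
  · intro; simp
  · intro a b c; ring

lemma ip_add_right (f g g' : MonoidAlgebra ℝ G) : ip f (g + g') = ip f g + ip f g' := by
  rw [ip_comm, ip_add_left, ip_comm g, ip_comm g']

lemma ip_self_nonneg (f : MonoidAlgebra ℝ G) : 0 ≤ ip f f := by
  rw [ip_eq_sum f f _ subset_rfl]
  exact Finset.sum_nonneg fun x _ => mul_self_nonneg _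

noncomputable def nrm (f : MonoidAlgebra ℝ G) : ℝ := Real.sqrt (ip f f)

lemma nrm_nonneg (f : MonoidAlgebra ℝ G) : 0 ≤ nrm f := Real.sqrt_nonneg _

lemma nrm_sq (f : MonoidAlgebra ℝ G) : nrm f ^ 2 = ip f f := Real.sq_sqrt (ip_self_nonneg f)

lemma nrm_sq_sum (f : MonoidAlgebra ℝ G) : nrm f ^ 2 = ∑ h ∈ f.coeff.support, f.coeff h ^ 2 := by
  rw [nrm_sq, ip_eq_sum f f _ subset_rfl]
  exact Finset.sum_congr rfl fun x _ => by ring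

lemma ip_le (f g : MonoidAlgebra ℝ G) : ip f g ≤ nrm f * nrm g := by
  classical
  have hf := ip_eq_sum f f (f.coeff.support ∪ g.coeff.support) Finset.subset_union_left
  have hg := ip_eq_sum g g (f.coeff.support ∪ g.coeff.support) Finset.subset_union_right
  have h := Finset.sum_mul_sq_le_sq_mul_sq (f.coeff.support ∪ g.coeff.support)
    (fun x => f.coeff x) (fun x => g.coeff x)
  rw [← ip_eq_sum f g _ Finset.subset_union_left] at h
  simp only [pow_two] at h
  rw [← hf, ← hg] at h
  have h2 : (ip f g) ^ 2 ≤ (nrm f * nrm g) ^ 2 := by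
    rw [mul_pow, nrm_sq, nrm_sq, pow_two]; exact h
  exact le_of_sq_le_sq₀ h2 (mul_nonneg (nrm_nonneg _) (nrm_nonneg _))
where
  le_of_sq_le_sq₀ {a b : ℝ} (h : a ^ 2 ≤ b ^ 2) (hb : 0 ≤ b) : a ≤ b := by
    nlinarith [abs_nonneg a, le_abs_self a, sq_abs a, abs_le_of_sq_le_sq h hb]

lemma nrm_add_le (f g : MonoidAlgebra ℝ G) : nrm (f + g) ≤ nrm f + nrm g := by
  have h : nrm (f + g) ^ 2 ≤ (nrm f + nrm g) ^ 2 := by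
    rw [nrm_sq, ip_add_left, ip_add_right, ip_add_right, ip_comm g f]
    nlinarith [nrm_sq f, nrm_sq g, ip_le f g]
  exact le_of_sq_le_sq h (add_nonneg (nrm_nonneg _) (nrm_nonneg _))
where
  le_of_sq_le_sq {a b : ℝ} (h : a ^ 2 ≤ b ^ 2) (hb : 0 ≤ b) : a ≤ b := by
    nlinarith [abs_nonneg a, le_abs_self a, sq_abs a, abs_le_of_sq_le_sq h hb]

lemma nrm_zero : nrm (0 : MonoidAlgebra ℝ G) = 0 := by
  simp [nrm, ip]

lemma nrm_sum_le {ι : Type*} (s : Finset ι) (f : ι → MonoidAlgebra ℝ G) :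
    nrm (∑ i ∈ s, f i) ≤ ∑ i ∈ s, nrm (f i) := by
  classical
  induction s using Finset.induction_on with
  | empty => simp [nrm_zero]
  | insert a s ha ih =>
    rw [Finset.sum_insert ha, Finset.sum_insert ha]
    exact (nrm_add_le _ _).trans (by gcongr)

noncomputable def adj (f : MonoidAlgebra ℝ G) : MonoidAlgebra ℝ G :=
  MonoidAlgebra.ofCoeff (f.coeff.equivMapDomain (Equiv.inv G))

lemma adj_coeff (f : MonoidAlgebra ℝ G) (g : G) : (adj f).coeff g = f.coeff g⁻¹ := by
  simp [adj, MonoidAlgebra.coeff_ofCoeff, Finsupp.equivMapDomain_apply]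

lemma adj_add (f g : MonoidAlgebra ℝ G) : adj (f + g) = adj f + adj g := by
  ext x; simp [adj_coeff, MonoidAlgebra.coeff_add]

lemma adj_single (h : G) (c : ℝ) : adj (single h c) = single h⁻¹ c := by
  classical
  ext x
  rw [adj_coeff, MonoidAlgebra.coeff_single, MonoidAlgebra.coeff_single, Finsupp.single_apply,
    Finsupp.single_apply]
  simp only [inv_eq_iff_eq_inv]

lemma ip_mul (φ f g : MonoidAlgebra ℝ G) : ip (φ * f) g = ip f (adj φ * g) := by
  classical
  induction φ using MonoidAlgebra.induction_linear with
  | zero =>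
    have : adj (0 : MonoidAlgebra ℝ G) = 0 := by ext x; simp [adj_coeff]
    rw [zero_mul, this, zero_mul, ip_comm f]; simp [ip]
  | add a b ha hb => rw [add_mul, ip_add_left, ha, hb, adj_add, add_mul, ip_add_right]
  | single h c =>
    rw [adj_single]
    rw [ip_eq_sum _ _ (f.coeff.support.image (fun x => h * x)), ip_eq_sum f _ _ subset_rfl,
      Finset.sum_image]
    · refine Finset.sum_congr rfl fun x _ => ?_
      rw [coeff_single_mul_apply, coeff_single_mul_apply]
      simp; ring
    · intro a _ b _ hab; simpa using hab
    · intro x hx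
      rw [Finsupp.mem_support_iff, coeff_single_mul_apply] at hx
      rw [Finset.mem_image]
      exact ⟨h⁻¹ * x, by rw [Finsupp.mem_support_iff]; exact right_ne_zero_of_mul hx, by simp⟩

lemma nrm_adj (f : MonoidAlgebra ℝ G) : nrm (adj f) = nrm f := by
  classical
  unfold nrm
  congr 1
  rw [ip_eq_sum f f _ subset_rfl, ip_eq_sum _ _ (f.coeff.support.image (fun x => x⁻¹)),
      Finset.sum_image]
  · refine Finset.sum_congr rfl fun x _ => ?_
    simp [adj_coeff]
  · intro a _ b _ hab; simpa using hab
  · intro x hx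
    rw [Finsupp.mem_support_iff, adj_coeff] at hx
    rw [Finset.mem_image]
    exact ⟨x⁻¹, by rw [Finsupp.mem_support_iff]; exact hx, by simp⟩

lemma adj_adj (f : MonoidAlgebra ℝ G) : adj (adj f) = f := by
  ext x; simp [adj_coeff]

lemma nrm_mul_single (f : MonoidAlgebra ℝ G) (h : G) (c : ℝ) :
    nrm (f * single h c) = |c| * nrm f := by
  classical
  have : ip (f * single h c) (f * single h c) = c ^ 2 * ip f f := by
    rw [ip_eq_sum _ _ (f.coeff.support.image (fun x => x * h)), ip_eq_sum f _ _ subset_rfl,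
      Finset.sum_image, Finset.mul_sum]
    · refine Finset.sum_congr rfl fun x _ => ?_
      rw [coeff_mul_single_apply]
      simp; ring
    · intro a _ b _ hab; simpa using hab
    · intro x hx
      rw [Finsupp.mem_support_iff, coeff_mul_single_apply] at hx
      rw [Finset.mem_image]
      exact ⟨x * h⁻¹, by rw [Finsupp.mem_support_iff]; exact left_ne_zero_of_mul hx, by simp⟩
  unfold nrm
  rw [this, Real.sqrt_mul (sq_nonneg c), Real.sqrt_sq_eq_abs]

lemma nrm_mul_le_l1 (f ψ : MonoidAlgebra ℝ G) :
    nrm (f * ψ) ≤ nrm f * ∑ h ∈ ψ.coeff.support, |ψ.coeff h| := by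
  have h : f * ψ = ∑ h ∈ ψ.coeff.support, f * single h (ψ.coeff h) := by
    conv_lhs => rw [← MonoidAlgebra.sum_coeff_single ψ]
    rw [Finsupp.sum, Finset.mul_sum]
  rw [h, Finset.mul_sum]
  refine (nrm_sum_le _ _).trans (Finset.sum_le_sum fun x _ => ?_)
  rw [nrm_mul_single, mul_comm]

/-- Step A. -/
lemma stepA (ℓ : G → ℕ) (R : ℕ) (P : ℕ) (C : G → Finset G) (hP : ∀ u, (C u).card ≤ P)
    (hC : ∀ h u, ℓ h ≤ R → ℓ u ≤ R → ∃ c ∈ C h, h⁻¹ * c ∈ C u ∧ c ∈ C (h * u))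
    (f f' : MonoidAlgebra ℝ G) (hf : ∀ h ∈ f.coeff.support, ℓ h ≤ R)
    (hf' : ∀ h ∈ f'.coeff.support, ℓ h ≤ R) :
    nrm (f * f') ^ 2 ≤ (P : ℝ) ^ 3 * nrm f ^ 2 * nrm f' ^ 2 := by
  classical
  set T := (f * f').coeff.support with hTdef
  set S := f.coeff.support with hS
  set S' := f'.coeff.support with hS'
  set a : G → ℝ := fun h => f.coeff h with ha
  set b : G → ℝ := fun h => f'.coeff h with hb
  -- weights
  set A : G → ℝ := fun c => ∑ h ∈ S, if c ∈ C h then a h ^ 2 else 0 with hA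
  set B : G → G → ℝ := fun c g => ∑ h ∈ S, if h⁻¹ * c ∈ C (h⁻¹ * g) then b (h⁻¹ * g) ^ 2 else 0
    with hB
  have hA0 : ∀ c, 0 ≤ A c := fun c => Finset.sum_nonneg fun h _ => by split_ifs <;> positivity
  have hB0 : ∀ c g, 0 ≤ B c g := fun c g =>
    Finset.sum_nonneg fun h _ => by split_ifs <;> positivity
  have key : ∀ g, ((f * f').coeff g) ^ 2 ≤ P * ∑ c ∈ C g, A c * B c g := by
    intro g
    have h1 : |(f * f').coeff g| ≤ ∑ h ∈ S, |a h| * |b (h⁻¹ * g)| := by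
      rw [coeff_mul_apply_left, Finsupp.sum]
      refine (Finset.abs_sum_le_sum_abs _ _).trans (le_of_eq ?_)
      exact Finset.sum_congr rfl fun x _ => abs_mul _ _
    have h2 : ∑ h ∈ S, |a h| * |b (h⁻¹ * g)| ≤ ∑ c ∈ C g, ∑ h ∈ S,
        (if c ∈ C h then |a h| else 0) * (if h⁻¹ * c ∈ C (h⁻¹ * g) then |b (h⁻¹ * g)| else 0) := by
      rw [Finset.sum_comm]
      refine Finset.sum_le_sum fun h hh => ?_
      by_cases hz : b (h⁻¹ * g) = 0
      · rw [hz]; simp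
      · obtain ⟨c, hc1, hc2, hc3⟩ := hC h (h⁻¹ * g) (hf h hh)
          (hf' _ (by rw [Finsupp.mem_support_iff]; exact hz))
        rw [mul_inv_cancel_left] at hc3
        refine le_trans ?_ (Finset.single_le_sum (f := fun c => (if c ∈ C h then |a h| else 0) *
          (if h⁻¹ * c ∈ C (h⁻¹ * g) then |b (h⁻¹ * g)| else 0)) (fun i _ => ?_) hc3)
        · simp [hc1, hc2]
        · split_ifs <;> positivity
    have h3 : ∀ c, (∑ h ∈ S, (if c ∈ C h then |a h| else 0) *
        (if h⁻¹ * c ∈ C (h⁻¹ * g) then |b (h⁻¹ * g)| else 0)) ^ 2 ≤ A c * B c g := by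
      intro c
      refine (Finset.sum_mul_sq_le_sq_mul_sq _ _ _).trans (le_of_eq ?_)
      simp only [hA, hB]
      congr 1 <;> refine Finset.sum_congr rfl fun h _ => ?_ <;> split_ifs <;> simp
    have h4 := h1.trans h2
    calc ((f * f').coeff g) ^ 2 = |(f * f').coeff g| ^ 2 := (sq_abs _).symm
      _ ≤ (∑ c ∈ C g, ∑ h ∈ S, (if c ∈ C h then |a h| else 0) *
          (if h⁻¹ * c ∈ C (h⁻¹ * g) then |b (h⁻¹ * g)| else 0)) ^ 2 := by gcongr
      _ ≤ (C g).card * ∑ c ∈ C g, (∑ h ∈ S, (if c ∈ C h then |a h| else 0) *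
          (if h⁻¹ * c ∈ C (h⁻¹ * g) then |b (h⁻¹ * g)| else 0)) ^ 2 := sq_sum_le_card_mul_sum_sq
      _ ≤ (C g).card * ∑ c ∈ C g, A c * B c g := by gcongr with c; exact h3 c
      _ ≤ P * ∑ c ∈ C g, A c * B c g := by
          have := hP g
          gcongr
  set U := T.biUnion C with hU
  have hBsum : ∀ c, ∑ g ∈ T, B c g ≤ P * nrm f' ^ 2 := by
    intro c
    rw [nrm_sq_sum, Finset.mul_sum]
    have : ∑ g ∈ T, B c g = ∑ p ∈ (T ×ˢ S).filter
        (fun p => p.2⁻¹ * c ∈ C (p.2⁻¹ * p.1) ∧ p.2⁻¹ * p.1 ∈ S'), b (p.2⁻¹ * p.1) ^ 2 := by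
      simp only [hB]
      rw [← Finset.sum_product', Finset.sum_filter]
      refine Finset.sum_congr rfl fun p _ => ?_
      by_cases hz : p.2⁻¹ * p.1 ∈ S'
      · simp [hz]
      · have : b (p.2⁻¹ * p.1) = 0 := by simpa [hS'] using hz
        simp [this]
    rw [this]
    have h2 : ∑ p ∈ (T ×ˢ S).filter
        (fun p => p.2⁻¹ * c ∈ C (p.2⁻¹ * p.1) ∧ p.2⁻¹ * p.1 ∈ S'), b (p.2⁻¹ * p.1) ^ 2 ≤
        ∑ q ∈ S'.sigma (fun u => C u), b q.1 ^ 2 := by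
      rw [← Finset.sum_image (f := fun q : (_ : G) × G => b q.1 ^ 2)
        (g := fun p : G × G => (⟨p.2⁻¹ * p.1, p.2⁻¹ * c⟩ : (_ : G) × G))]
      · refine Finset.sum_le_sum_of_subset_of_nonneg ?_ (fun _ _ _ => by positivity)
        intro q hq
        obtain ⟨p, hp, rfl⟩ := Finset.mem_image.1 hq
        simp only [Finset.mem_filter] at hp
        simp [hp.2.1, hp.2.2]
      · intro p hp q hq hpq
        simp only [Sigma.mk.injEq, heq_eq_eq] at hpq
        have h1 : p.2 = q.2 := by simpa using hpq.2
        have h2 : p.1 = q.1 := by have := hpq.1; rw [h1] at this; simpa using this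
        exact Prod.ext h2 h1
    refine h2.trans ?_
    rw [Finset.sum_sigma]
    refine Finset.sum_le_sum fun u _ => ?_
    simp only [Finset.sum_const, nsmul_eq_mul]
    have := hP u
    gcongr
  have hAsum : ∑ c ∈ U, A c ≤ P * nrm f ^ 2 := by
    rw [nrm_sq_sum, Finset.mul_sum]
    simp only [hA]
    rw [Finset.sum_comm]
    refine Finset.sum_le_sum fun h _ => ?_
    rw [← Finset.sum_filter, Finset.sum_const, nsmul_eq_mul]
    have : (U.filter (fun c => c ∈ C h)).card ≤ P :=
      (Finset.card_le_card fun x hx => (Finset.mem_filter.1 hx).2).trans (hP h)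
    gcongr
  rw [nrm_sq_sum]
  calc ∑ g ∈ T, ((f * f').coeff g) ^ 2 ≤ ∑ g ∈ T, P * ∑ c ∈ C g, A c * B c g :=
        Finset.sum_le_sum fun g _ => key g
    _ ≤ ∑ g ∈ T, P * ∑ c ∈ U, A c * B c g := by
        refine Finset.sum_le_sum fun g hg => ?_
        refine mul_le_mul_of_nonneg_left (Finset.sum_le_sum_of_subset_of_nonneg
          (Finset.subset_biUnion_of_mem C hg) fun i _ _ => mul_nonneg (hA0 _) (hB0 _ _)) (by positivity)
    _ = P * ∑ c ∈ U, A c * ∑ g ∈ T, B c g := by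
        rw [← Finset.mul_sum, Finset.sum_comm]
        simp only [Finset.mul_sum]
    _ ≤ P * ∑ c ∈ U, A c * (P * nrm f' ^ 2) := by
        gcongr with c hc
        exact hBsum c
    _ = P * ((∑ c ∈ U, A c) * (P * nrm f' ^ 2)) := by rw [Finset.sum_mul]
    _ ≤ P * ((P * nrm f ^ 2) * (P * nrm f' ^ 2)) := by gcongr
    _ = (P : ℝ) ^ 3 * nrm f ^ 2 * nrm f' ^ 2 := by ring

end Analysis
end ArtinRD


set_option linter.all false

namespace ArtinRD

section Analysis2
open MonoidAlgebra
variable {G : Type*} [Group G]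

lemma real_le_of_pow_le (y m B : ℝ) (hm : 0 ≤ m) (h : ∀ k : ℕ, y ^ (2 ^ k) ≤ B * m ^ (2 ^ k)) : y ≤ m := by
  by_contra hlt
  push Not at hlt
  have hy : 0 < y := lt_of_le_of_lt hm hlt
  have hr : m / y < 1 := (div_lt_one hy).2 hlt
  have hr0 : 0 ≤ m / y := by positivity
  have h1 : Filter.Tendsto (fun k : ℕ => B * (m / y) ^ (2 ^ k)) Filter.atTop (nhds (B * 0)) := by
    refine Filter.Tendsto.const_mul B ?_
    exact (tendsto_pow_atTop_nhds_zero_of_lt_one hr0 hr).comp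
      (tendsto_pow_atTop_atTop_of_one_lt (by norm_num : 1 < 2))
  rw [mul_zero] at h1
  have h2 : ∀ k : ℕ, (1 : ℝ) ≤ B * (m / y) ^ (2 ^ k) := by
    intro k
    have := h k
    rw [div_pow, ← mul_div_assoc, le_div_iff₀ (by positivity)]
    linarith
  have := ge_of_tendsto' h1 h2
  linarith

lemma adj_mul (f g : MonoidAlgebra ℝ G) : adj (f * g) = adj g * adj f := by
  classical
  induction f using MonoidAlgebra.induction_linear with
  | zero =>
    have : adj (0 : MonoidAlgebra ℝ G) = 0 := by ext x; simp [adj_coeff]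
    rw [zero_mul, this, mul_zero]
  | add a b ha hb => rw [add_mul, adj_add, ha, hb, adj_add, mul_add]
  | single h c =>
    ext x
    rw [adj_coeff, coeff_single_mul_apply, adj_single, coeff_mul_single_apply, adj_coeff]
    simp [mul_comm]

/-- Balls are closed under products. -/
lemma supp_mul (ℓ : G → ℕ) (hmul : ∀ g h, ℓ (g * h) ≤ ℓ g + ℓ h) (R R' : ℕ)
    (f f' : MonoidAlgebra ℝ G) (hf : ∀ h ∈ f.coeff.support, ℓ h ≤ R)
    (hf' : ∀ h ∈ f'.coeff.support, ℓ h ≤ R') : ∀ h ∈ (f * f').coeff.support, ℓ h ≤ R + R' := by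
  intro g hg
  rw [Finsupp.mem_support_iff, coeff_mul_apply_left] at hg
  obtain ⟨h, hh, hne⟩ := Finset.exists_ne_zero_of_sum_ne_zero hg
  have h1 := hf h hh
  have h2 := hf' (h⁻¹ * g) (by rw [Finsupp.mem_support_iff]; exact right_ne_zero_of_mul hne)
  have := hmul h (h⁻¹ * g)
  rw [mul_inv_cancel_left] at this
  omega

lemma stepB (ℓ : G → ℕ) (hmul : ∀ g h, ℓ (g * h) ≤ ℓ g + ℓ h) (hinv : ∀ g, ℓ g⁻¹ = ℓ g)
    (K : ℝ) (hK : 1 ≤ K) (D : ℕ)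
    (hA : ∀ (R : ℕ) (f f' : MonoidAlgebra ℝ G), (∀ h ∈ f.coeff.support, ℓ h ≤ R) →
      (∀ h ∈ f'.coeff.support, ℓ h ≤ R) → nrm (f * f') ≤ K * ((R : ℝ) + 1) ^ D * nrm f * nrm f')
    (R : ℕ) (φ ψ : MonoidAlgebra ℝ G) (hφ : ∀ h ∈ φ.coeff.support, ℓ h ≤ R) :
    nrm (φ * ψ) ≤ K * 2 ^ D * ((R : ℝ) + 1) ^ D * nrm φ * nrm ψ := by
  set a := adj φ * φ with ha
  have hsa : adj a = a := by rw [ha, adj_mul, adj_adj]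
  have hadjφ : ∀ h ∈ (adj φ).coeff.support, ℓ h ≤ R := by
    intro h hh
    rw [Finsupp.mem_support_iff, adj_coeff] at hh
    rw [← hinv]; exact hφ _ (by rwa [Finsupp.mem_support_iff])
  have hsupa : ∀ k : ℕ, ∀ h ∈ (a ^ (2 ^ k)).coeff.support, ℓ h ≤ 2 * R * 2 ^ k := by
    intro k
    induction k with
    | zero =>
      simp only [pow_zero, pow_one, mul_one]
      have := supp_mul ℓ hmul R R (adj φ) φ hadjφ hφ
      intro h hh; have := this h hh; omega
    | succ k ih =>
      have := supp_mul ℓ hmul _ _ _ _ ih ih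
      rw [← pow_add, ← two_mul, ← pow_succ'] at this
      intro h hh; have := this h hh; rw [pow_succ, ← mul_assoc]; omega
  have hsak : ∀ k : ℕ, adj (a ^ k) = a ^ k := by
    intro k
    induction k with
    | zero =>
      rw [pow_zero, MonoidAlgebra.one_def, adj_single, inv_one]
    | succ k ih => rw [pow_succ, adj_mul, ih, hsa, ← pow_succ, ← pow_succ']
  set p : ℝ := K * ((2 * R : ℕ) + 1 : ℝ) ^ D with hp
  have hp1 : 1 ≤ p := by
    have : (1 : ℝ) ≤ ((2 * R : ℕ) + 1 : ℝ) ^ D := one_le_pow₀ (by push_cast; linarith [(Nat.cast_nonneg R : (0:ℝ) ≤ R)])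
    nlinarith
  set θ : ℝ := 2 ^ D with hθ
  have hθ1 : 1 ≤ θ := one_le_pow₀ (by norm_num)
  have hrec : ∀ k : ℕ, nrm (a ^ (2 ^ (k + 1))) ≤ p * θ ^ k * nrm (a ^ (2 ^ k)) ^ 2 := by
    intro k
    have h1 := hA (2 * R * 2 ^ k) _ _ (hsupa k) (hsupa k)
    rw [← pow_add, ← two_mul, ← pow_succ'] at h1
    refine h1.trans ?_
    have h2 : (((2 * R * 2 ^ k : ℕ) : ℝ) + 1) ^ D ≤ (((2 * R : ℕ) : ℝ) + 1) ^ D * θ ^ k := by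
      rw [hθ, ← pow_mul, mul_comm D k, pow_mul, ← mul_pow]
      gcongr
      push_cast
      have : (1:ℝ) ≤ 2 ^ k := one_le_pow₀ (by norm_num)
      nlinarith
    calc _ ≤ K * ((((2 * R : ℕ) : ℝ) + 1) ^ D * θ ^ k) * nrm (a ^ 2 ^ k) * nrm (a ^ 2 ^ k) := by
          have := nrm_nonneg (a ^ 2 ^ k)
          gcongr
      _ = _ := by rw [hp]; ring
  set m0 : ℝ := nrm a * p * θ with hm0
  have hm0n : 0 ≤ m0 := by have := nrm_nonneg a; positivity
  have hmk : ∀ k : ℕ, nrm (a ^ (2 ^ k)) * p * θ ^ (k + 1) ≤ m0 ^ (2 ^ k) := by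
    intro k
    induction k with
    | zero => simp [hm0]
    | succ k ih =>
      have h0 := nrm_nonneg (a ^ 2 ^ k)
      calc nrm (a ^ (2 ^ (k + 1))) * p * θ ^ (k + 1 + 1)
          ≤ (p * θ ^ k * nrm (a ^ (2 ^ k)) ^ 2) * p * θ ^ (k + 1 + 1) := by gcongr; exact hrec k
        _ = (nrm (a ^ (2 ^ k)) * p * θ ^ (k + 1)) ^ 2 := by ring
        _ ≤ (m0 ^ (2 ^ k)) ^ 2 := by gcongr
        _ = m0 ^ (2 ^ (k + 1)) := by rw [← pow_mul, ← pow_succ]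
  have hmain : nrm (a * ψ) ≤ nrm ψ * m0 := by
    by_cases hψ : nrm ψ = 0
    · have : nrm (a * ψ) ^ 2 ≤ 0 := by
        rw [nrm_sq, ip_mul]
        refine (ip_le _ _).trans ?_
        rw [hψ]; simp
      rw [hψ, zero_mul]
      nlinarith [nrm_nonneg (a * ψ)]
    have hψ0 : 0 < nrm ψ := lt_of_le_of_ne (nrm_nonneg _) (Ne.symm hψ)
    have hpow : ∀ k : ℕ, nrm (a * ψ) ^ (2 ^ k) * nrm ψ ≤ nrm ψ ^ (2 ^ k) * nrm (a ^ (2 ^ k) * ψ) := by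
      intro k
      induction k with
      | zero => simp [mul_comm]
      | succ k ih =>
        have h1 : nrm (a ^ (2 ^ k) * ψ) ^ 2 ≤ nrm ψ * nrm (a ^ (2 ^ (k + 1)) * ψ) := by
          rw [nrm_sq, ip_mul, hsak, ← mul_assoc, ← pow_add, ← two_mul, ← pow_succ']
          exact ip_le _ _
        have h2 : (nrm (a * ψ) ^ (2 ^ k) * nrm ψ) ^ 2 ≤ (nrm ψ ^ (2 ^ k) * nrm (a ^ (2 ^ k) * ψ)) ^ 2 := by
          have := nrm_nonneg (a * ψ)
          gcongr
        rw [mul_pow, mul_pow, ← pow_mul, ← pow_mul, ← pow_succ] at h2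
        have h3 : nrm (a * ψ) ^ 2 ^ (k + 1) * nrm ψ ^ 2 ≤
          nrm ψ ^ 2 ^ (k + 1) * (nrm ψ * nrm (a ^ (2 ^ (k + 1)) * ψ)) := h2.trans (by gcongr)
        have h4 : nrm ψ * (nrm (a * ψ) ^ 2 ^ (k + 1) * nrm ψ) ≤
            nrm ψ * (nrm ψ ^ 2 ^ (k + 1) * nrm (a ^ 2 ^ (k + 1) * ψ)) := by linarith
        exact le_of_mul_le_mul_left h4 hψ0
    set L := ∑ h ∈ ψ.coeff.support, |ψ.coeff h| with hL
    have hL0 : 0 ≤ L := Finset.sum_nonneg fun _ _ => abs_nonneg _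
    refine real_le_of_pow_le _ _ (L / nrm ψ) (by positivity) fun k => ?_
    have h1 := hpow k
    have h2 := nrm_mul_le_l1 (a ^ (2 ^ k)) ψ
    have h3 := hmk k
    have h4 : nrm (a ^ 2 ^ k) ≤ m0 ^ 2 ^ k := by
      refine le_trans ?_ h3
      have h5 : 1 ≤ θ ^ (k + 1) := one_le_pow₀ hθ1
      have h6 := nrm_nonneg (a ^ 2 ^ k)
      have h7 : 1 ≤ p * θ ^ (k + 1) := by nlinarith
      nlinarith
    have h5 : nrm (a * ψ) ^ 2 ^ k * nrm ψ ≤ nrm ψ ^ 2 ^ k * (m0 ^ 2 ^ k * L) := by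
      refine h1.trans ?_
      gcongr
      refine h2.trans ?_
      gcongr
    rw [div_mul_eq_mul_div, le_div_iff₀ hψ0, mul_pow]
    linarith
  have hn0 : nrm a ≤ K * ((R : ℝ) + 1) ^ D * nrm φ ^ 2 := by
    have := hA R _ _ hadjφ hφ
    rw [nrm_adj] at this
    rw [ha, pow_two]; linarith
  have hsq : nrm (φ * ψ) ^ 2 ≤ nrm ψ * nrm (a * ψ) := by
    rw [nrm_sq, ip_mul, ← mul_assoc]; exact ip_le _ _
  have hp2 : p ≤ K * (2 ^ D * ((R : ℝ) + 1) ^ D) := by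
    rw [hp, ← mul_pow]
    gcongr
    push_cast; linarith
  have hfin : nrm (φ * ψ) ^ 2 ≤ (K * 2 ^ D * ((R : ℝ) + 1) ^ D * nrm φ * nrm ψ) ^ 2 := by
    have hψ0 := nrm_nonneg ψ
    have ha0 := nrm_nonneg a
    calc nrm (φ * ψ) ^ 2 ≤ nrm ψ * (nrm ψ * m0) := hsq.trans (by gcongr)
      _ ≤ nrm ψ * (nrm ψ * ((K * ((R : ℝ) + 1) ^ D * nrm φ ^ 2) * (K * (2 ^ D * ((R : ℝ) + 1) ^ D)) * 2 ^ D)) := by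
          rw [hm0]; gcongr
      _ = _ := by ring
  have hnn : 0 ≤ K * 2 ^ D * ((R : ℝ) + 1) ^ D * nrm φ * nrm ψ := by
    have := nrm_nonneg φ; have := nrm_nonneg ψ; positivity
  exact abs_le_of_sq_le_sq' hfin hnn |>.2

lemma stepC (ℓ : G → ℕ) (K : ℝ) (hK : 0 < K) (D : ℕ)
    (hB : ∀ (R : ℕ) (φ ψ : MonoidAlgebra ℝ G), (∀ h ∈ φ.coeff.support, ℓ h ≤ R) →
      nrm (φ * ψ) ≤ K * ((R : ℝ) + 1) ^ D * nrm φ * nrm ψ)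
    (φ ψ : MonoidAlgebra ℝ G) :
    nrm (φ * ψ) ≤ 2 * K *
      Real.sqrt (∑ g ∈ φ.coeff.support, φ.coeff g ^ 2 * (1 + (ℓ g : ℝ)) ^ (2 * (D + 1))) * nrm ψ := by
  classical
  obtain ⟨n, hn⟩ : ∃ n : ℕ, ∀ h ∈ φ.coeff.support, ℓ h < n := by
    refine ⟨φ.coeff.support.sup ℓ + 1, fun h hh => ?_⟩
    have := Finset.le_sup (f := ℓ) hh
    omega
  set F : ℕ → MonoidAlgebra ℝ G := fun k => MonoidAlgebra.ofCoeff (φ.coeff.filter (fun h => ℓ h = k)) with hF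
  have hFc : ∀ k h, (F k).coeff h = if ℓ h = k then φ.coeff h else 0 := by
    intro k h; simp only [hF, MonoidAlgebra.coeff_ofCoeff, Finsupp.filter_apply]
  have hsum : φ = ∑ k ∈ Finset.range n, F k := by
    ext h
    rw [MonoidAlgebra.coeff_sum, Finsupp.finset_sum_apply]
    simp only [hFc]
    rw [Finset.sum_ite_eq]
    split_ifs with h1
    · rfl
    · by_contra h2
      exact h1 (Finset.mem_range.2 (hn h (Finsupp.mem_support_iff.2 h2)))
  have hFs : ∀ k, ∀ h ∈ (F k).coeff.support, ℓ h ≤ k := by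
    intro k h hh
    rw [Finsupp.mem_support_iff, hFc] at hh
    by_contra h2; apply hh; rw [if_neg]; omega
  have hNk : ∀ k, nrm (F k) ^ 2 = ∑ g ∈ φ.coeff.support, if ℓ g = k then φ.coeff g ^ 2 else 0 := by
    intro k
    rw [nrm_sq, ip_eq_sum _ _ φ.coeff.support]
    · refine Finset.sum_congr rfl fun g _ => ?_
      rw [hFc]; split_ifs <;> ring
    · intro h hh
      rw [Finsupp.mem_support_iff, hFc] at hh
      rw [Finsupp.mem_support_iff]; intro h2; apply hh; simp [h2]
  have h1 : nrm (φ * ψ) ≤ ∑ k ∈ Finset.range n, (1 / ((k : ℝ) + 1)) * (((k : ℝ) + 1) ^ (D + 1) * nrm (F k)) * (K * nrm ψ) := by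
    conv_lhs => rw [hsum, Finset.sum_mul]
    refine (nrm_sum_le _ _).trans (Finset.sum_le_sum fun k _ => ?_)
    refine (hB k _ _ (hFs k)).trans (le_of_eq ?_)
    have : (k : ℝ) + 1 ≠ 0 := by positivity
    field_simp
    ring
  rw [← Finset.sum_mul] at h1
  have h2 := Finset.sum_mul_sq_le_sq_mul_sq (Finset.range n) (fun k : ℕ => 1 / ((k : ℝ) + 1))
    (fun k => ((k : ℝ) + 1) ^ (D + 1) * nrm (F k))
  have h3 : ∀ n : ℕ, ∑ k ∈ Finset.range n, (1 / ((k : ℝ) + 1)) ^ 2 ≤ 4 - 2 / ((n : ℝ) + 1) := by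
    intro n
    induction n with
    | zero => norm_num
    | succ n ih =>
      rw [Finset.sum_range_succ]
      have hn0 : (0 : ℝ) ≤ n := Nat.cast_nonneg n
      have : (1 / ((n : ℝ) + 1)) ^ 2 ≤ 2 / ((n : ℝ) + 1) - 2 / (((n + 1 : ℕ) : ℝ) + 1) := by
        push_cast
        rw [div_sub_div _ _ (by positivity) (by positivity), div_pow, div_le_div_iff₀ (by positivity) (by positivity)]
        nlinarith
      linarith
  have h4 : ∑ k ∈ Finset.range n, (((k : ℝ) + 1) ^ (D + 1) * nrm (F k)) ^ 2 =
      ∑ g ∈ φ.coeff.support, φ.coeff g ^ 2 * (1 + (ℓ g : ℝ)) ^ (2 * (D + 1)) := by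
    simp only [mul_pow, hNk, Finset.mul_sum]
    rw [Finset.sum_comm]
    refine Finset.sum_congr rfl fun g hg => ?_
    simp only [mul_ite, mul_zero]
    rw [Finset.sum_ite_eq, if_pos (Finset.mem_range.2 (hn g hg)), ← pow_mul]
    rw [mul_comm, add_comm, mul_comm 2]
  rw [h4] at h2
  set Sb := ∑ g ∈ φ.coeff.support, φ.coeff g ^ 2 * (1 + (ℓ g : ℝ)) ^ (2 * (D + 1)) with hSb
  have hSb0 : 0 ≤ Sb := Finset.sum_nonneg fun _ _ => by positivity
  have h5 : ∑ k ∈ Finset.range n, (1 / ((k : ℝ) + 1)) * (((k : ℝ) + 1) ^ (D + 1) * nrm (F k)) ≤ 2 * Real.sqrt Sb := by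
    refine abs_le_of_sq_le_sq' ?_ (by positivity) |>.2
    rw [mul_pow, Real.sq_sqrt hSb0]
    refine h2.trans ?_
    have := h3 n
    have : (0:ℝ) ≤ 2 / ((n : ℝ) + 1) := by positivity
    gcongr
    linarith
  refine h1.trans ?_
  have := nrm_nonneg ψ
  calc _ ≤ (2 * Real.sqrt Sb) * (K * nrm ψ) := by gcongr
    _ = _ := by ring

end Analysis2
end ArtinRD


set_option linter.all false

namespace ArtinRD

section Analysis3
open MonoidAlgebra
variable {G : Type*} [Group G]

theorem rd_criterion (ℓ : G → ℕ) (hmul : ∀ g h, ℓ (g * h) ≤ ℓ g + ℓ h) (hinv : ∀ g, ℓ g⁻¹ = ℓ g)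
    (K D : ℕ)
    (hC : ∀ R : ℕ, ∃ C : G → Finset G, (∀ u, (C u).card ≤ K * (R + 1) ^ D) ∧
      ∀ h u, ℓ h ≤ R → ℓ u ≤ R → ∃ c ∈ C h, h⁻¹ * c ∈ C u ∧ c ∈ C (h * u)) :
    RapidDecay ℓ := by
  classical
  set K' : ℝ := ((K : ℝ) + 1) ^ 2 with hK'
  have hK0 : (0 : ℝ) ≤ K := Nat.cast_nonneg K
  have hK1 : 1 ≤ K' := one_le_pow₀ (by linarith)
  have hA : ∀ (R : ℕ) (f f' : MonoidAlgebra ℝ G), (∀ h ∈ f.coeff.support, ℓ h ≤ R) →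
      (∀ h ∈ f'.coeff.support, ℓ h ≤ R) →
      nrm (f * f') ≤ K' * ((R : ℝ) + 1) ^ (2 * D) * nrm f * nrm f' := by
    intro R f f' hf hf'
    obtain ⟨C, hc1, hc2⟩ := hC R
    have hP : ∀ u, (C u).card ≤ (K + 1) * (R + 1) ^ D := fun u => (hc1 u).trans (by gcongr; omega)
    have h1 := stepA ℓ R _ C hP hc2 f f' hf hf'
    have hP1 : (1 : ℝ) ≤ (((K + 1) * (R + 1) ^ D : ℕ) : ℝ) := by
      exact_mod_cast Nat.mul_pos (Nat.succ_pos _) (Nat.pos_pow_of_pos' D)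
    have hnf := nrm_nonneg f
    have hnf' := nrm_nonneg f'
    have h2 : nrm (f * f') ^ 2 ≤ (K' * ((R : ℝ) + 1) ^ (2 * D) * nrm f * nrm f') ^ 2 := by
      refine h1.trans ?_
      have : (K' * ((R : ℝ) + 1) ^ (2 * D) * nrm f * nrm f') ^ 2 =
          (((K + 1) * (R + 1) ^ D : ℕ) : ℝ) ^ 4 * nrm f ^ 2 * nrm f' ^ 2 := by
        push_cast; rw [hK']; ring
      rw [this]
      gcongr
      norm_num
    exact (abs_le_of_sq_le_sq' h2 (by positivity)).2
  have hB := stepB ℓ hmul hinv K' hK1 (2 * D) hA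
  have hCC := stepC ℓ (K' * 2 ^ (2 * D)) (by positivity) (2 * D) hB
  refine ⟨2 * (K' * 2 ^ (2 * D)), by positivity, (2 * D + 1 : ℕ), by positivity, fun φ ψ => ?_⟩
  set f : MonoidAlgebra ℝ G := MonoidAlgebra.ofCoeff (φ.mapRange (fun z => ‖z‖) norm_zero) with hf
  set f' : MonoidAlgebra ℝ G := MonoidAlgebra.ofCoeff (ψ.mapRange (fun z => ‖z‖) norm_zero) with hf'
  have hfc : ∀ g, f.coeff g = ‖φ g‖ := fun g => by simp [hf, MonoidAlgebra.coeff_ofCoeff]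
  have hfc' : ∀ g, f'.coeff g = ‖ψ g‖ := fun g => by simp [hf', MonoidAlgebra.coeff_ofCoeff]
  have hconv : ∀ g, ‖conv φ ψ g‖ ≤ (f * f').coeff g := by
    intro g
    rw [coeff_mul_apply_left]
    have hs : f.coeff.support = φ.support := by ext x; simp [hfc]
    rw [Finsupp.sum, hs]
    unfold conv
    rw [Finsupp.sum]
    refine (norm_sum_le _ _).trans (Finset.sum_le_sum fun h _ => ?_)
    rw [norm_mul, hfc, hfc']
  have h1 : l2Norm (conv φ ψ) ≤ nrm (f * f') := by
    unfold l2Norm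
    apply Real.sqrt_le_iff.2 ⟨nrm_nonneg _, ?_⟩
    rw [nrm_sq_sum, tsum_eq_sum (s := (f * f').coeff.support)]
    · exact Finset.sum_le_sum fun g _ => by have := hconv g; gcongr
    · intro g hg
      have h2 := hconv g
      rw [Finsupp.notMem_support_iff.1 hg] at h2
      have : ‖conv φ ψ g‖ = 0 := le_antisymm h2 (norm_nonneg _)
      rw [this]; simp
  have h2 : l2Norm (fun g => ψ g) = nrm f' := by
    unfold l2Norm
    rw [tsum_eq_sum (s := f'.coeff.support)]
    · rw [nrm, ip_eq_sum f' f' _ subset_rfl]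
      congr 1
      exact Finset.sum_congr rfl fun g _ => by rw [hfc']; ring
    · intro g hg
      rw [Finsupp.notMem_support_iff, hfc'] at hg
      rw [hg]; simp
  have h3 : sobolevNorm ℓ (2 * D + 1 : ℕ) (fun g => φ g) = Real.sqrt (∑ g ∈ f.coeff.support,
      f.coeff g ^ 2 * (1 + (ℓ g : ℝ)) ^ (2 * (2 * D + 1))) := by
    unfold sobolevNorm
    rw [tsum_eq_sum (s := f.coeff.support)]
    · congr 1
      refine Finset.sum_congr rfl fun g _ => ?_
      rw [hfc, ← Real.rpow_natCast (1 + (ℓ g : ℝ))]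
      norm_num
    · intro g hg
      rw [Finsupp.notMem_support_iff, hfc] at hg
      rw [hg]; simp
  rw [h2, h3]
  exact h1.trans (hCC f f')
where
  Nat.pos_pow_of_pos' {R : ℕ} (D : ℕ) : 0 < (R + 1) ^ D := Nat.pow_pos (Nat.succ_pos R)

end Analysis3

/-! ## Generic word length -/
section WordLength
variable {G : Type*} [Group G] {S : Set G}

structure SymGen (S : Set G) : Prop where
  inv : ∀ x ∈ S, x⁻¹ ∈ S
  gen : ∀ g : G, ∃ w : List G, (∀ a ∈ w, a ∈ S) ∧ w.prod = g

lemma SymGen.of_closure (S : Set G) (h1 : ∀ x ∈ S, x⁻¹ ∈ S) (h2 : Subgroup.closure S = ⊤) : SymGen S := by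
  refine ⟨h1, fun g => ?_⟩
  have hg : g ∈ Subgroup.closure S := by rw [h2]; trivial
  induction hg using Subgroup.closure_induction with
  | mem x hx => exact ⟨[x], by simpa using hx, by simp⟩
  | one => exact ⟨[], by simp, rfl⟩
  | mul x y _ _ hx hy =>
    obtain ⟨w, h3, rfl⟩ := hx
    obtain ⟨w', h3', rfl⟩ := hy
    refine ⟨w ++ w', fun a ha => ?_, by simp⟩
    rcases List.mem_append.1 ha with h | h
    · exact h3 a h
    · exact h3' a h
  | inv x _ hx =>
    obtain ⟨w, h3, rfl⟩ := hx
    refine ⟨(w.map (fun x => x⁻¹)).reverse, fun a ha => ?_, by rw [List.prod_inv_reverse]⟩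
    simp only [List.mem_reverse, List.mem_map] at ha
    obtain ⟨b, hb, rfl⟩ := ha
    exact h1 _ (h3 b hb)

lemma wl_le (w : List G) (hw : ∀ a ∈ w, a ∈ S) : wordLength S w.prod ≤ w.length :=
  Nat.sInf_le ⟨w, hw, rfl, rfl⟩

lemma wl_word (hS : SymGen S) (g : G) :
    ∃ w : List G, (∀ a ∈ w, a ∈ S) ∧ w.length = wordLength S g ∧ w.prod = g := by
  have : {N : ℕ | ∃ w : List G, (∀ a ∈ w, a ∈ S) ∧ w.length = N ∧ w.prod = g}.Nonempty := by
    obtain ⟨w, h1, h2⟩ := hS.gen g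
    exact ⟨w.length, w, h1, rfl, h2⟩
  exact Nat.sInf_mem this

lemma wl_one : wordLength S (1 : G) = 0 := by
  have := wl_le (S := S) ([] : List G) (by simp)
  simpa using this

lemma wl_mul (hS : SymGen S) (g h : G) : wordLength S (g * h) ≤ wordLength S g + wordLength S h := by
  obtain ⟨w, h1, h2, rfl⟩ := wl_word hS g
  obtain ⟨w', h1', h2', rfl⟩ := wl_word hS h
  rw [← List.prod_append, ← h2, ← h2', ← List.length_append]
  refine wl_le _ fun a ha => ?_
  rcases List.mem_append.1 ha with h | h
  · exact h1 a h
  · exact h1' a h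

lemma wl_inv_le (hS : SymGen S) (g : G) : wordLength S g⁻¹ ≤ wordLength S g := by
  obtain ⟨w, h1, h2, rfl⟩ := wl_word hS g
  rw [List.prod_inv_reverse, ← h2]
  have : w.length = ((w.map (fun x => x⁻¹)).reverse).length := by simp
  rw [this]
  refine wl_le _ fun a ha => ?_
  simp only [List.mem_reverse, List.mem_map] at ha
  obtain ⟨b, hb, rfl⟩ := ha
  exact hS.inv _ (h1 b hb)

lemma wl_inv (hS : SymGen S) (g : G) : wordLength S g⁻¹ = wordLength S g :=
  le_antisymm (wl_inv_le hS g) (by simpa using wl_inv_le hS g⁻¹)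

lemma wl_mem_le {x : G} (hx : x ∈ S) : wordLength S x ≤ 1 := by
  have := wl_le (S := S) [x] (by simpa using hx)
  simpa using this

lemma wl_eq_zero (hS : SymGen S) {g : G} (h : wordLength S g = 0) : g = 1 := by
  obtain ⟨w, h1, h2, rfl⟩ := wl_word hS g
  rw [h] at h2
  rw [List.length_eq_zero_iff.1 h2]; rfl

/-- descending letter -/
lemma wl_desc (hS : SymGen S) {g : G} {N : ℕ} (h : wordLength S g = N + 1) :
    ∃ x ∈ S, wordLength S (g * x) = N := by
  obtain ⟨w, h1, h2, rfl⟩ := wl_word hS g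
  rw [h] at h2
  have hne : w ≠ [] := by rintro rfl; simp at h2
  obtain ⟨v, x, rfl⟩ : ∃ v x, w = v ++ [x] := ⟨_, _, (List.dropLast_append_getLast hne).symm⟩
  have hx : x ∈ S := h1 x (by simp)
  have hv : (v ++ [x]).prod * x⁻¹ = v.prod := by simp
  refine ⟨x⁻¹, hS.inv _ hx, ?_⟩
  rw [hv]
  have hl : v.length = N := by simpa using h2
  have h3 : wordLength S v.prod ≤ N := hl ▸ wl_le v (fun a ha => h1 a (by simp [ha]))
  have h4 := wl_mul hS v.prod x
  have h5 := wl_mem_le hx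
  have h6 : (v ++ [x]).prod = v.prod * x := by simp
  rw [h6] at h
  omega

/-- Characterisation of the word length by a Lipschitz function with descents. -/
lemma wl_eq_of (hS : SymGen S) (L : G → ℕ) (h1 : L 1 = 0) (hlip : ∀ g, ∀ x ∈ S, L (g * x) ≤ L g + 1)
    (h0 : ∀ g, L g = 0 → g = 1) (hd : ∀ g, L g ≠ 0 → ∃ x ∈ S, L (g * x) < L g) (g : G) :
    wordLength S g = L g := by
  apply le_antisymm
  · induction hn : L g using Nat.strong_induction_on generalizing g with
    | _ n ih =>
      by_cases hz : L g = 0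
      · rw [h0 g hz, wl_one]; omega
      · obtain ⟨x, hx, hlt⟩ := hd g hz
        have := ih _ (hn ▸ hlt) (g * x) rfl
        have h2 := wl_mul hS (g * x) x⁻¹
        have h3 := wl_mem_le (hS.inv x hx)
        rw [mul_inv_cancel_right] at h2
        omega
  · obtain ⟨w, hw1, hw2, rfl⟩ := wl_word hS g
    rw [← hw2]
    clear hw2
    induction w using List.reverseRecOn with
    | nil => simp [h1]
    | append_singleton v x ih =>
      have := ih (fun a ha => hw1 a (by simp [ha]))
      have h2 := hlip v.prod x (hw1 x (by simp))
      simp only [List.prod_append, List.prod_singleton, List.length_append, List.length_singleton]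
      omega

end WordLength
end ArtinRD


set_option linter.all false

namespace ArtinRD

/-! ## The state machine for dihedral Artin groups -/

structure DState where
  c : Bool
  U : List ℕ
  b : ℕ
  k : ℤ

namespace DState

def Valid (m : ℕ) (s : DState) : Prop := (∀ l ∈ s.U, 1 ≤ l ∧ l < m) ∧ s.b < m

/-- current run -/
def cur (s : DState) : ℕ := match s.U with
  | [] => s.b
  | l :: _ => l

def ext (m : ℕ) : DState → DState
  | ⟨c, [], b, k⟩ => if b + 1 < m then ⟨!c, [], b + 1, k⟩ else ⟨!c, [], 0, k + 1⟩
  | ⟨c, l :: U, b, k⟩ => if l + 1 < m then ⟨!c, (l + 1) :: U, b, k⟩ else ⟨c, U, b, k + 1⟩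

def new : DState → DState
  | ⟨c, U, b, k⟩ => ⟨c, 1 :: U, b, k⟩

def pop (m : ℕ) : DState → DState
  | ⟨c, [], b, k⟩ => if b = 0 then ⟨!c, [], m - 1, k - 1⟩ else ⟨!c, [], b - 1, k⟩
  | ⟨c, l :: U, b, k⟩ => if l = 1 then ⟨c, U, b, k⟩ else ⟨!c, (l - 1) :: U, b, k⟩

def negnew (m : ℕ) : DState → DState
  | ⟨c, U, b, k⟩ => ⟨c, (m - 1) :: U, b, k - 1⟩

def up (m : ℕ) (g : Bool) (s : DState) : DState := if g = s.c then ext m s else new s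
def dn (m : ℕ) (g : Bool) (s : DState) : DState := if g = s.c then negnew m s else pop m s

lemma up_valid {m : ℕ} (hm : 2 ≤ m) (g : Bool) (s : DState) (h : s.Valid m) : (up m g s).Valid m := by
  obtain ⟨c, U, b, k⟩ := s
  obtain ⟨h1, h2⟩ := h
  simp only at h1 h2
  unfold up
  split_ifs with hg
  · cases U with
    | nil =>
      simp only [ext]; split_ifs <;> simp [Valid] <;> omega
    | cons l U =>
      have hl := h1 l (by simp)
      simp only [ext]; split_ifs with h3
      · refine ⟨?_, h2⟩
        intro x hx
        rcases List.mem_cons.1 hx with rfl | hx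
        · omega
        · exact h1 x (by simp [hx])
      · exact ⟨fun x hx => h1 x (by simp [hx]), h2⟩
  · refine ⟨?_, h2⟩
    intro x hx
    rcases List.mem_cons.1 hx with rfl | hx
    · omega
    · exact h1 x (by simp [hx])

lemma dn_valid {m : ℕ} (hm : 2 ≤ m) (g : Bool) (s : DState) (h : s.Valid m) : (dn m g s).Valid m := by
  obtain ⟨c, U, b, k⟩ := s
  obtain ⟨h1, h2⟩ := h
  simp only at h1 h2
  unfold dn
  split_ifs with hg
  · refine ⟨?_, h2⟩
    intro x hx
    rcases List.mem_cons.1 hx with rfl | hx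
    · omega
    · exact h1 x hx
  · cases U with
    | nil =>
      simp only [pop]; split_ifs <;> simp [Valid] <;> omega
    | cons l U =>
      have hl := h1 l (by simp)
      simp only [pop]; split_ifs with h3
      · exact ⟨fun x hx => h1 x (by simp [hx]), h2⟩
      · refine ⟨?_, h2⟩
        intro x hx
        rcases List.mem_cons.1 hx with rfl | hx
        · omega
        · exact h1 x (by simp [hx])

lemma dn_up {m : ℕ} (hm : 2 ≤ m) (g : Bool) (s : DState) (h : s.Valid m) : dn m g (up m g s) = s := by
  obtain ⟨c, U, b, k⟩ := s
  obtain ⟨h1, h2⟩ := h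
  simp only at h1 h2
  unfold up
  by_cases hg : g = c
  · subst hg
    simp only [if_true]
    cases U with
    | nil =>
      by_cases h3 : b + 1 < m
      · simp [ext, h3, dn, pop]
      · simp [ext, h3, dn, pop]; omega
    | cons l U =>
      have hl := h1 l (by simp)
      by_cases h3 : l + 1 < m
      · simp [ext, h3, dn, pop]; omega
      · simp [ext, h3, dn, negnew]; omega
  · simp [hg, new, dn, pop]

lemma up_dn {m : ℕ} (hm : 2 ≤ m) (g : Bool) (s : DState) (h : s.Valid m) : up m g (dn m g s) = s := by
  obtain ⟨c, U, b, k⟩ := s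
  obtain ⟨h1, h2⟩ := h
  simp only at h1 h2
  unfold dn
  by_cases hg : g = c
  · subst hg
    have : ¬ (m - 1 + 1 < m) := by omega
    simp [negnew, up, ext, this]
  · have hg2 : g = !c := by cases g <;> cases c <;> simp_all
    simp only [hg, if_false]
    cases U with
    | nil =>
      by_cases h3 : b = 0
      · have : ¬ (m - 1 + 1 < m) := by omega
        simp [pop, h3, up, hg2, ext, this]
      · have : b - 1 + 1 = b := by omega
        simp [pop, h3, up, hg2, ext, this, h2]
    | cons l U =>
      have hl := h1 l (by simp)
      by_cases h3 : l = 1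
      · simp [pop, h3, up, hg, new]
      · have : l - 1 + 1 = l := by omega
        simp [pop, h3, up, hg2, ext, this, hl.2]

/-! Alternating words. -/
def alt (m : ℕ) : ℕ → Bool → DState → DState
  | 0, _, s => s
  | n + 1, g, s => alt m n (!g) (up m g s)

lemma alt_add (m i j : ℕ) (g : Bool) (s : DState) :
    alt m (i + j) g s = alt m j (xor g i.bodd) (alt m i g s) := by
  induction i generalizing g s with
  | zero => simp [alt]
  | succ i ih =>
    rw [show i + 1 + j = (i + j) + 1 by omega, alt, ih]
    simp [alt, Nat.bodd_succ]

lemma alt_bot (m : ℕ) (j : ℕ) (c : Bool) (b : ℕ) (k : ℤ) (h : b + j < m) :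
    alt m j c ⟨c, [], b, k⟩ = ⟨xor c j.bodd, [], b + j, k⟩ := by
  induction j generalizing c b with
  | zero => simp [alt]
  | succ j ih =>
    have : b + 1 < m := by omega
    rw [alt]
    simp only [up, ext, this, if_true]
    rw [ih _ _ (by omega)]
    simp [Nat.bodd_succ]; omega

lemma alt_upper (m : ℕ) (j : ℕ) (c : Bool) (l : ℕ) (U : List ℕ) (b : ℕ) (k : ℤ) (h : l + j < m) :
    alt m j c ⟨c, l :: U, b, k⟩ = ⟨xor c j.bodd, (l + j) :: U, b, k⟩ := by
  induction j generalizing c l with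
  | zero => simp [alt]
  | succ j ih =>
    have : l + 1 < m := by omega
    rw [alt]
    simp only [up, ext, this, if_true]
    rw [ih _ _ (by omega)]
    simp [Nat.bodd_succ]; omega

lemma bodd_sub_one {n : ℕ} (h : 1 ≤ n) : n.bodd = !((n - 1).bodd) := by
  obtain ⟨j, rfl⟩ : ∃ j, n = j + 1 := ⟨n - 1, by omega⟩
  simp

lemma alt_full {m : ℕ} (hm : 2 ≤ m) (g : Bool) (s : DState) (h : s.Valid m) :
    alt m m g s = ⟨xor s.c m.bodd, s.U, s.b, s.k + 1⟩ := by
  obtain ⟨c, U, b, k⟩ := s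
  obtain ⟨h1, h2⟩ := h
  simp only at h1 h2 ⊢
  by_cases hg : g = c
  · subst hg
    cases U with
    | nil =>
      have hs : m = (m - 1 - b) + (1 + b) := by omega
      have hb : m.bodd = xor (m - 1 - b).bodd (!b.bodd) := by
        conv_lhs => rw [hs]
        simp [Nat.bodd_add]
      conv_lhs => rw [show alt m m = alt m ((m - 1 - b) + (1 + b)) by rw [← hs]]
      rw [alt_add, alt_bot _ _ _ _ _ (by omega), alt_add, alt, alt]
      have h3 : ¬ (b + (m - 1 - b) + 1 < m) := by omega
      simp only [up, ext, if_true, h3, if_false]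
      have := alt_bot m b (!(xor g (m - 1 - b).bodd)) 0 (k + 1) (by omega)
      simp at this ⊢
      rw [this, hb]
      simp
    | cons l U =>
      have hl := h1 l (by simp)
      have hs : m = (m - 1 - l) + (1 + (1 + (l - 1))) := by omega
      have hb : m.bodd = xor (m - 1 - l).bodd ((l - 1).bodd) := by
        conv_lhs => rw [hs]
        simp [Nat.bodd_add]
      conv_lhs => rw [show alt m m = alt m ((m - 1 - l) + (1 + (1 + (l - 1)))) by rw [← hs]]
      rw [alt_add, alt_upper _ _ _ _ _ _ _ (by omega), alt_add, alt, alt, alt_add, alt, alt]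
      have h3 : ¬ (l + (m - 1 - l) + 1 < m) := by omega
      simp only [up, ext, if_true, h3, if_false]
      have := alt_upper m (l - 1) ((xor g (m - 1 - l).bodd)) 1 U b (k + 1) (by omega)
      simp [new] at this ⊢
      rw [this, hb]
      simp; omega
  · have hg2 : g = !c := by cases g <;> cases c <;> simp_all
    subst hg2
    have hs : m = 1 + ((m - 2) + 1) := by omega
    have hb : m.bodd = (m - 2).bodd := by
      conv_lhs => rw [hs]
      simp [Nat.bodd_add]
    conv_lhs => rw [show alt m m = alt m (1 + ((m - 2) + 1)) by rw [← hs]]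
    rw [alt_add, alt_add]
    have := alt_upper m (m - 2) c 1 U b k (by omega)
    have h3 : ¬ (1 + (m - 2) + 1 < m) := by omega
    simp [up, new, this, alt, ext, h3]
    rw [hb]

/-- heights -/
def ht (s : DState) (t : ℕ) : ℤ :=
  -s.k - (if t < s.b then 1 else 0) - ((s.U.filter (fun l => t < l)).length : ℤ)

/-- coordinate changed by the positive / negative letter -/
def ip (g : Bool) (s : DState) : ℕ := if g = s.c then s.cur else 0
def im (m : ℕ) (g : Bool) (s : DState) : ℕ :=
  if g = s.c then m - 1 else (if s.cur = 0 then m - 1 else s.cur - 1)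

lemma ip_lt {m : ℕ} (hm : 2 ≤ m) (g : Bool) (s : DState) (h : s.Valid m) : ip g s < m := by
  obtain ⟨c, U, b, k⟩ := s
  obtain ⟨h1, h2⟩ := h
  unfold ip
  split_ifs
  · cases U with
    | nil => exact h2
    | cons l U => exact (h1 l (by simp)).2
  · omega

lemma im_lt {m : ℕ} (hm : 2 ≤ m) (g : Bool) (s : DState) (h : s.Valid m) : im m g s < m := by
  obtain ⟨c, U, b, k⟩ := s
  obtain ⟨h1, h2⟩ := h
  unfold im
  split_ifs
  · omega
  · omega
  · cases U with
    | nil => simp only [cur] at *; omega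
    | cons l U => have := (h1 l (by simp)).2; simp only [cur] at *; omega

lemma ht_cons (c : Bool) (l : ℕ) (U : List ℕ) (b : ℕ) (k : ℤ) (t : ℕ) :
    ht ⟨c, l :: U, b, k⟩ t = ht ⟨c, U, b, k⟩ t - (if t < l then 1 else 0) := by
  unfold ht
  by_cases h : t < l
  · simp [h]; ring
  · simp [h]

lemma ht_congr (c c' : Bool) (U : List ℕ) (b : ℕ) (k : ℤ) (t : ℕ) :
    ht ⟨c, U, b, k⟩ t = ht ⟨c', U, b, k⟩ t := rfl

lemma ht_k (c : Bool) (U : List ℕ) (b : ℕ) (k j : ℤ) (t : ℕ) :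
    ht ⟨c, U, b, k + j⟩ t = ht ⟨c, U, b, k⟩ t - j := by
  unfold ht; simp; ring

lemma ht_nil (c : Bool) (b : ℕ) (k : ℤ) (t : ℕ) :
    ht ⟨c, [], b, k⟩ t = - k - (if t < b then 1 else 0) := by
  unfold ht; simp

lemma ht_up {m : ℕ} (hm : 2 ≤ m) (g : Bool) (s : DState) (h : s.Valid m) (t : ℕ) (ht' : t < m) :
    ht (up m g s) t = ht s t - (if t = ip g s then 1 else 0) := by
  obtain ⟨c, U, b, k⟩ := s
  obtain ⟨h1, h2⟩ := h
  simp only at h1 h2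
  unfold up ip
  by_cases hg : g = c
  · subst hg
    simp only [if_true]
    cases U with
    | nil =>
      simp only [ext, cur]
      split_ifs <;> simp only [ht_nil] <;> split_ifs <;> omega
    | cons l U =>
      have hl := h1 l (by simp)
      simp only [ext, cur]
      split_ifs <;> simp only [ht_cons, ht_k, ht_congr (!g) g] <;> split_ifs <;> omega
  · simp only [hg, if_false, new, ht_cons]
    split_ifs <;> omega

lemma ht_dn {m : ℕ} (hm : 2 ≤ m) (g : Bool) (s : DState) (h : s.Valid m) (t : ℕ) (ht' : t < m) :
    ht (dn m g s) t = ht s t + (if t = im m g s then 1 else 0) := by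
  obtain ⟨c, U, b, k⟩ := s
  obtain ⟨h1, h2⟩ := h
  simp only at h1 h2
  unfold dn im
  by_cases hg : g = c
  · subst hg
    simp only [if_true, negnew, ht_cons, sub_eq_add_neg, ht_k]
    split_ifs <;> omega
  · simp only [hg, if_false]
    cases U with
    | nil =>
      simp only [pop, cur]
      by_cases h3 : b = 0
      · simp only [h3, if_true, ht_nil]; split_ifs <;> omega
      · simp only [h3, if_false, ht_nil]; split_ifs <;> omega
    | cons l U =>
      have hl := h1 l (by simp)
      simp only [pop, cur]
      have h0 : l ≠ 0 := by omega
      by_cases h3 : l = 1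
      · simp only [h3, if_true, ht_cons, one_ne_zero, if_false]; split_ifs <;> omega
      · simp only [h3, h0, if_false, ht_cons, ht_congr (!c) c]; split_ifs <;> omega

lemma ht_mono (s : DState) {t t' : ℕ} (h : t ≤ t') : ht s t ≤ ht s t' := by
  obtain ⟨c, U, b, k⟩ := s
  induction U with
  | nil => simp only [ht_nil]; split_ifs <;> omega
  | cons l U ih => simp only [ht_cons]; split_ifs <;> omega

lemma ht_strict {m : ℕ} (s : DState) (h : s.Valid m) (h0 : s.cur ≠ 0) :
    ht s (s.cur - 1) < ht s s.cur := by
  obtain ⟨c, U, b, k⟩ := s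
  cases U with
  | nil => simp only [ht_nil, cur] at *; split_ifs <;> omega
  | cons l U =>
    have := ht_mono ⟨c, U, b, k⟩ (t := l - 1) (t' := l) (by omega)
    simp only [ht_cons, cur] at *; split_ifs <;> omega

lemma ht_last {m : ℕ} (hm : 2 ≤ m) (s : DState) (h : s.Valid m) : ht s (m - 1) = - s.k := by
  obtain ⟨c, U, b, k⟩ := s
  obtain ⟨h1, h2⟩ := h
  simp only at h1 h2
  unfold ht
  have : (U.filter (fun l => m - 1 < l)) = [] := by
    rw [List.filter_eq_nil_iff]
    intro l hl
    have := h1 l hl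
    simp; omega
  have h3 : ¬ (m - 1 < b) := by omega
  simp [this, h3]

lemma ht_zero {m : ℕ} (s : DState) (h : s.Valid m) :
    ht s 0 = - s.k - (if 0 < s.b then 1 else 0) - s.U.length := by
  obtain ⟨c, U, b, k⟩ := s
  obtain ⟨h1, h2⟩ := h
  simp only at h1 h2
  unfold ht
  have : (U.filter (fun l => 0 < l)) = U := by
    rw [List.filter_eq_self]
    intro l hl
    have := h1 l hl
    simp; omega
  simp only [this]

/-- the basic inequality -/
lemma ht_ip_le_im {m : ℕ} (hm : 2 ≤ m) (g : Bool) (s : DState) (h : s.Valid m) :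
    ht s (ip g s) ≤ ht s (im m g s) := by
  apply ht_mono
  have := ip_lt hm g s h
  unfold ip im at *
  split_ifs at * <;> omega

def len (m : ℕ) (s : DState) : ℕ := ∑ t ∈ Finset.range m, (ht s t).natAbs
def zer (m : ℕ) (s : DState) : ℕ := ((Finset.range m).filter (fun t => ht s t = 0)).card

end DState
end ArtinRD


set_option linter.all false

namespace ArtinRD

namespace DState

lemma sum_natAbs_change (m i : ℕ) (hi : i < m) (f g : ℕ → ℤ) (h : ∀ t < m, t ≠ i → f t = g t) :
    (∑ t ∈ Finset.range m, (f t).natAbs) + (g i).natAbs =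
      (∑ t ∈ Finset.range m, (g t).natAbs) + (f i).natAbs := by
  have hi' : i ∈ Finset.range m := Finset.mem_range.2 hi
  rw [← Finset.add_sum_erase _ _ hi', ← Finset.add_sum_erase _ (fun t => (g t).natAbs) hi']
  have : ∑ t ∈ (Finset.range m).erase i, (f t).natAbs = ∑ t ∈ (Finset.range m).erase i, (g t).natAbs := by
    refine Finset.sum_congr rfl fun t ht => ?_
    rw [Finset.mem_erase, Finset.mem_range] at ht
    rw [h t ht.2 ht.1]
  rw [this]; ring

variable {m : ℕ} (hm : 2 ≤ m)
include hm

lemma len_up (g : Bool) (s : DState) (h : s.Valid m) :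
    len m (up m g s) + (ht s (ip g s)).natAbs = len m s + (ht s (ip g s) - 1).natAbs := by
  have h1 := sum_natAbs_change m (ip g s) (ip_lt hm g s h) (ht (up m g s)) (ht s) (fun t ht hne => by
    rw [ht_up hm g s h t ht, if_neg hne, sub_zero])
  rw [ht_up hm g s h _ (ip_lt hm g s h), if_pos rfl] at h1
  exact h1

lemma len_dn (g : Bool) (s : DState) (h : s.Valid m) :
    len m (dn m g s) + (ht s (im m g s)).natAbs = len m s + (ht s (im m g s) + 1).natAbs := by
  have h1 := sum_natAbs_change m (im m g s) (im_lt hm g s h) (ht (dn m g s)) (ht s) (fun t ht hne => by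
    rw [ht_dn hm g s h t ht, if_neg hne, add_zero])
  rw [ht_dn hm g s h _ (im_lt hm g s h), if_pos rfl] at h1
  exact h1

lemma len_up_lt (g : Bool) (s : DState) (h : s.Valid m) :
    len m (up m g s) < len m s ↔ 0 < ht s (ip g s) := by
  have := len_up hm g s h; omega

lemma len_dn_lt (g : Bool) (s : DState) (h : s.Valid m) :
    len m (dn m g s) < len m s ↔ ht s (im m g s) < 0 := by
  have := len_dn hm g s h; omega

lemma zer_pos_of (s : DState) (hz : 0 < zer m s) : ∃ t < m, ht s t = 0 := by
  obtain ⟨t, ht'⟩ := Finset.card_pos.1 hz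
  rw [Finset.mem_filter, Finset.mem_range] at ht'
  exact ⟨t, ht'⟩

lemma zer_change (i : ℕ) (s s' : DState) (h : ∀ t < m, t ≠ i → ht s' t = ht s t) :
    zer m s ≤ zer m s' + 1 ∧ (ht s i ≠ 0 → zer m s ≤ zer m s') := by
  constructor
  · have : ((Finset.range m).filter (fun t => ht s t = 0)) ⊆
        insert i ((Finset.range m).filter (fun t => ht s' t = 0)) := by
      intro t ht'
      rw [Finset.mem_filter, Finset.mem_range] at ht'
      rw [Finset.mem_insert, Finset.mem_filter, Finset.mem_range]
      by_cases hti : t = i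
      · exact Or.inl hti
      · exact Or.inr ⟨ht'.1, by rw [h t ht'.1 hti]; exact ht'.2⟩
    exact (Finset.card_le_card this).trans (Finset.card_insert_le _ _)
  · intro hne
    apply Finset.card_le_card
    intro t ht'
    rw [Finset.mem_filter, Finset.mem_range] at ht' ⊢
    refine ⟨ht'.1, ?_⟩
    rw [h t ht'.1 ?_]
    · exact ht'.2
    · rintro rfl; exact hne ht'.2

/-- syllables with positive exponents -/
lemma zer_up_iter (g : Bool) (s : DState) (h : s.Valid m) (n : ℕ) :
    ((up m g)^[n] s).Valid m ∧ (zer m s ≤ zer m ((up m g)^[n] s) ∨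
      (zer m s ≤ zer m ((up m g)^[n] s) + 1 ∧
        ht ((up m g)^[n] s) (im m g ((up m g)^[n] s)) < 0)) := by
  induction n with
  | zero => exact ⟨h, Or.inl le_rfl⟩
  | succ n ih =>
    rw [Function.iterate_succ_apply']
    set s' := (up m g)^[n] s
    obtain ⟨hv, ih⟩ := ih
    refine ⟨up_valid hm g s' hv, ?_⟩
    have hz := zer_change hm (ip g s') s' (up m g s') (fun t ht' hne => by
      rw [ht_up hm g s' hv t ht', if_neg hne, sub_zero])
    have hl := len_up hm g s' hv
    have hback : ht s' (ip g s') ≤ 0 → ht (up m g s') (im m g (up m g s')) < 0 := by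
      intro hle
      rw [← len_dn_lt hm g _ (up_valid hm g s' hv), dn_up hm g s' hv]
      omega
    rcases ih with ih | ⟨ih1, ih2⟩
    · by_cases h0 : ht s' (ip g s') = 0
      · exact Or.inr ⟨by omega, hback (by omega)⟩
      · exact Or.inl (by have := hz.2 h0; omega)
    · have := ht_ip_le_im hm g s' hv
      exact Or.inr ⟨by have := hz.2 (by omega); omega, hback (by omega)⟩

lemma zer_dn_iter (g : Bool) (s : DState) (h : s.Valid m) (n : ℕ) :
    ((dn m g)^[n] s).Valid m ∧ (zer m s ≤ zer m ((dn m g)^[n] s) ∨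
      (zer m s ≤ zer m ((dn m g)^[n] s) + 1 ∧
        0 < ht ((dn m g)^[n] s) (ip g ((dn m g)^[n] s)))) := by
  induction n with
  | zero => exact ⟨h, Or.inl le_rfl⟩
  | succ n ih =>
    rw [Function.iterate_succ_apply']
    set s' := (dn m g)^[n] s
    obtain ⟨hv, ih⟩ := ih
    refine ⟨dn_valid hm g s' hv, ?_⟩
    have hz := zer_change hm (im m g s') s' (dn m g s') (fun t ht' hne => by
      rw [ht_dn hm g s' hv t ht', if_neg hne, add_zero])
    have hl := len_dn hm g s' hv
    have hback : 0 ≤ ht s' (im m g s') → 0 < ht (dn m g s') (ip g (dn m g s')) := by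
      intro hle
      rw [← len_up_lt hm g _ (dn_valid hm g s' hv), up_dn hm g s' hv]
      omega
    rcases ih with ih | ⟨ih1, ih2⟩
    · by_cases h0 : ht s' (im m g s') = 0
      · exact Or.inr ⟨by omega, hback (by omega)⟩
      · exact Or.inl (by have := hz.2 h0; omega)
    · have := ht_ip_le_im hm g s' hv
      exact Or.inr ⟨by have := hz.2 (by omega); omega, hback (by omega)⟩

/-- double implies no zero heights -/
lemma double_ne (s : DState) (h : s.Valid m)
    (hd : ∀ g : Bool, 0 < ht s (ip g s) ∨ ht s (im m g s) < 0) : ∀ t < m, ht s t ≠ 0 := by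
  intro t htm
  have h1 := hd s.c
  have h2 := hd (!s.c)
  have hlast := ht_mono s (t := t) (t' := m - 1) (by omega)
  have hfirst := ht_mono s (t := 0) (t' := t) (by omega)
  have hne : (!s.c) ≠ s.c := by cases s.c <;> simp
  unfold ip im at h1 h2
  simp only [if_true, hne, if_false] at h1 h2
  by_cases h0 : s.cur = 0
  · simp only [h0, if_true] at h1 h2; omega
  · simp only [h0, if_false] at h1 h2
    rcases lt_or_ge t s.cur with h3 | h3
    · have := ht_mono s (t := t) (t' := s.cur - 1) (by omega)
      omega
    · have := ht_mono s (t := s.cur) (t' := t) (by omega)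
      omega

lemma exists_desc (s : DState) (h : s.Valid m) (hne : len m s ≠ 0) :
    ∃ g : Bool, 0 < ht s (ip g s) ∨ ht s (im m g s) < 0 := by
  by_contra hcon
  push Not at hcon
  have h1 := hcon s.c
  have h2 := hcon (!s.c)
  have hne2 : (!s.c) ≠ s.c := by cases s.c <;> simp
  unfold ip im at h1 h2
  simp only [if_true, hne2, if_false] at h1 h2
  apply hne
  unfold len
  rw [Finset.sum_eq_zero_iff]
  intro t htm
  rw [Finset.mem_range] at htm
  by_cases h0 : s.cur = 0
  · -- then bottom, heights constant
    obtain ⟨c, U, b, k⟩ := s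
    cases U with
    | nil =>
      simp only [cur] at h0
      subst h0
      simp only [ht_nil, cur] at *
      split_ifs at * <;> omega
    | cons l U =>
      have := h.1 l (by simp)
      simp only [cur] at h0; omega
  · simp only [h0, if_false] at h1 h2
    have := ht_strict s h h0
    omega

lemma len_zero (s : DState) (h : s.Valid m) (hz : len m s = 0) : s.U = [] ∧ s.b = 0 ∧ s.k = 0 := by
  unfold len at hz
  rw [Finset.sum_eq_zero_iff] at hz
  have h1 := hz (m - 1) (Finset.mem_range.2 (by omega))
  have h2 := hz 0 (Finset.mem_range.2 (by omega))
  rw [ht_last hm s h] at h1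
  rw [ht_zero s h] at h2
  have h3 : s.U.length = 0 := by split_ifs at h2 <;> omega
  refine ⟨List.length_eq_zero_iff.1 h3, ?_, by omega⟩
  split_ifs at h2 <;> omega

lemma natAbs_ht_le (s : DState) (t : ℕ) (ht' : t < m) : (ht s t).natAbs ≤ len m s := by
  unfold len
  exact Finset.single_le_sum (f := fun t => (ht s t).natAbs) (fun _ _ => Nat.zero_le _) (Finset.mem_range.2 ht')

lemma k_le (s : DState) (h : s.Valid m) : s.k.natAbs ≤ len m s := by
  have := natAbs_ht_le hm s (m - 1) (by omega)
  rw [ht_last hm s h] at this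
  omega

lemma U_le (s : DState) (h : s.Valid m) : s.U.length ≤ 2 * len m s := by
  have := natAbs_ht_le hm s 0 (by omega)
  have h2 := k_le hm s h
  rw [ht_zero s h] at this
  split_ifs at this <;> omega

end DState

/-! ## list adjacency -/
def LAdj {T : Type*} (l l' : List T) : Prop :=
  (∃ e, l' = e :: l) ∨ (∃ e, l = e :: l') ∨ (∃ e e' r, l = e :: r ∧ l' = e' :: r)

lemma LAdj.suffix {T : Type*} {l l' μ : List T} (h : LAdj l l') (hl : μ.length < l.length)
    (hl' : μ.length < l'.length) (hs : μ <:+ l) : μ <:+ l' := by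
  rcases h with ⟨e, rfl⟩ | ⟨e, rfl⟩ | ⟨e, e', r, rfl, rfl⟩
  · exact hs.trans (List.suffix_cons e l)
  · rcases List.suffix_cons_iff.1 hs with rfl | h
    · simp at hl
    · exact h
  · rcases List.suffix_cons_iff.1 hs with rfl | h
    · simp at hl
    · exact h.trans (List.suffix_cons e' r)

lemma LAdj.symm {T : Type*} {l l' : List T} (h : LAdj l l') : LAdj l' l := by
  rcases h with ⟨e, rfl⟩ | ⟨e, rfl⟩ | ⟨e, e', r, rfl, rfl⟩
  · exact Or.inr (Or.inl ⟨e, rfl⟩)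
  · exact Or.inl ⟨e, rfl⟩
  · exact Or.inr (Or.inr ⟨e', e, r, rfl, rfl⟩)

/-- Minimal point on a path of lists. -/
lemma LAdj.path {T : Type*} (p : ℕ → List T) (N : ℕ) (h : ∀ t < N, LAdj (p t) (p (t + 1))) :
    ∃ t ≤ N, ∃ μ : List T, (p t = μ ∨ ∃ e, p t = e :: μ) ∧ μ <:+ p 0 ∧ μ <:+ p N := by
  obtain ⟨t, ht, hmin⟩ := Finset.exists_min_image (Finset.range (N + 1)) (fun t => (p t).length)
    ⟨0, by simp⟩
  rw [Finset.mem_range] at ht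
  have hmin' : ∀ s ≤ N, (p t).length ≤ (p s).length := fun s hs => hmin s (Finset.mem_range.2 (by omega))
  rcases hp : p t with _ | ⟨e, μ⟩
  · exact ⟨t, by omega, [], Or.inl hp, List.nil_suffix, List.nil_suffix⟩
  refine ⟨t, by omega, μ, Or.inr ⟨e, hp⟩, ?_, ?_⟩
  all_goals
    have hlen : ∀ s ≤ N, μ.length < (p s).length := by
      intro s hs
      have := hmin' s hs
      rw [hp] at this
      simp at this; omega
    have h0 : μ <:+ p t := by rw [hp]; exact List.suffix_cons e μ
  · have : ∀ j ≤ t, μ <:+ p (t - j) := by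
      intro j
      induction j with
      | zero => intro _; exact h0
      | succ j ih =>
        intro hj
        have h1 := ih (by omega)
        have h2 := h (t - (j + 1)) (by omega)
        rw [show t - (j + 1) + 1 = t - j by omega] at h2
        exact h2.symm.suffix (hlen _ (by omega)) (hlen _ (by omega)) h1
    have := this t le_rfl
    rwa [Nat.sub_self] at this
  · have : ∀ j, t + j ≤ N → μ <:+ p (t + j) := by
      intro j
      induction j with
      | zero => intro _; exact h0
      | succ j ih =>
        intro hj
        exact (h (t + j) (by omega)).suffix (hlen _ (by omega)) (hlen _ (by omega)) (ih (by omega))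
    have := this (N - t) (by omega)
    rwa [show t + (N - t) = N by omega] at this

/-- Generic centroid theorem for groups with a tree-like map. -/
theorem centroid_of_tree {D T : Type*} [Group D] [Finite T] {S : Set D} (hS : SymGen S)
    (τ : D → List T) (κ : D → Bool × ℤ) (hadj : ∀ d, ∀ x ∈ S, LAdj (τ d) (τ (d * x)))
    (hlen : ∀ d, (τ d).length ≤ 2 * wordLength S d + 1) (hk : ∀ d, (κ d).2.natAbs ≤ wordLength S d)
    (hinj : ∀ d d', τ d = τ d' → κ d = κ d' → d = d') :
    ∃ K N : ℕ, ∀ R : ℕ, ∃ C : D → Finset D, (∀ u, (C u).card ≤ K * (R + 1) ^ N) ∧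
      ∀ h u, wordLength S h ≤ R → wordLength S u ≤ R → ∃ c ∈ C h, h⁻¹ * c ∈ C u ∧ c ∈ C (h * u) := by
  classical
  have := Fintype.ofFinite T
  set c := Fintype.card T with hc
  choose w hw1 hw2 hw3 using wl_word hS
  refine ⟨2 + 48 * (c + 1), 2, fun R => ?_⟩
  -- lists of allowed types
  set sfx : D → Finset (List T) := fun a =>
    (τ a).tails.toFinset.biUnion (fun μ => insert μ (Finset.univ.image (fun e => e :: μ))) with hsfx
  set tgt : D → Finset (List T × (Bool × ℤ)) := fun a =>
    sfx a ×ˢ (Finset.univ ×ˢ Finset.Icc (-(2 * R : ℤ)) (2 * R)) with htgt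
  have hset : ∀ a, {d : D | (τ d, κ d) ∈ tgt a}.Finite := by
    intro a
    refine Set.Finite.of_injOn (f := fun d => (τ d, κ d)) (t := (tgt a : Set _)) ?_ ?_ (Finset.finite_toSet _)
    · intro d hd; exact hd
    · intro d _ d' _ h
      simp only [Prod.mk.injEq] at h
      exact hinj d d' h.1 h.2
  set C1 : D → Finset D := fun a => (hset a).toFinset with hC1
  set C2 : D → Finset D := fun a => (Finset.range (R + 1)).image (fun t => ((w a).take t).prod) with hC2
  refine ⟨fun a => if wordLength S a ≤ 2 * R then C1 a ∪ C2 a else ∅, ?_, ?_⟩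
  · intro u
    show (if wordLength S u ≤ 2 * R then C1 u ∪ C2 u else ∅).card ≤ _
    split_ifs with hu
    · have h1 : (C1 u).card ≤ (tgt u).card := by
        refine Finset.card_le_card_of_injOn (fun d => (τ d, κ d)) ?_ ?_
        · intro d hd
          simpa [hC1] using hd
        · intro d _ d' _ h
          simp only [Prod.mk.injEq] at h
          exact hinj d d' h.1 h.2
      have h2 : (sfx u).card ≤ (4 * R + 2) * (c + 1) := by
        refine (Finset.card_biUnion_le_card_mul _ _ (c + 1) ?_).trans ?_
        · intro μ _
          refine (Finset.card_insert_le _ _).trans ?_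
          have := Finset.card_image_le (s := (Finset.univ : Finset T)) (f := fun e => e :: μ)
          rw [Finset.card_univ] at this
          omega
        · gcongr
          refine (List.toFinset_card_le _).trans ?_
          rw [List.length_tails]
          have := hlen u
          omega
      have h3 : (tgt u).card ≤ ((4 * R + 2) * (c + 1)) * (2 * (4 * R + 1)) := by
        simp only [htgt, Finset.card_product, Finset.card_univ, Fintype.card_bool, Int.card_Icc]
        gcongr
        omega
      have h4 : (C2 u).card ≤ R + 1 := Finset.card_image_le.trans (by simp)
      refine (Finset.card_union_le _ _).trans ?_
      have h5 : (C1 u).card + (C2 u).card ≤ ((4 * R + 2) * (c + 1)) * (2 * (4 * R + 1)) + (R + 1) := by omega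
      refine h5.trans ?_
      have e1 : (4 * R + 2) * (2 * (4 * R + 1)) ≤ 48 * (R + 1) ^ 2 := by nlinarith
      have e2 : ((4 * R + 2) * (c + 1)) * (2 * (4 * R + 1)) ≤ 48 * (R + 1) ^ 2 * (c + 1) := by
        calc ((4 * R + 2) * (c + 1)) * (2 * (4 * R + 1)) = (4 * R + 2) * (2 * (4 * R + 1)) * (c + 1) := by ring
          _ ≤ _ := by gcongr
      nlinarith
    · simp
  · intro a b ha hb
    have hab : wordLength S (a * b) ≤ 2 * R := (wl_mul hS a b).trans (by omega)
    set p : ℕ → D := fun t => a * ((w b).take t).prod with hp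
    obtain ⟨t, ht, μ, hμ, hμ0, hμN⟩ := LAdj.path (fun t => τ (p t)) (w b).length (fun t ht => by
      have : p (t + 1) = p t * (w b)[t] := by
        simp only [hp]
        rw [List.take_succ_eq_append_getElem ht, List.prod_append, List.prod_singleton, mul_assoc]
      show LAdj (τ (p t)) (τ (p (t + 1)))
      rw [this]
      exact hadj _ _ (hw1 b _ (List.getElem_mem ht)))
    have hp0 : p 0 = a := by simp [hp]
    have hpN : p (w b).length = a * b := by simp [hp, hw3]
    rw [hp0] at hμ0
    rw [hpN] at hμN
    have hlp : wordLength S (p t) ≤ 2 * R := by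
      refine (wl_mul hS _ _).trans ?_
      have := wl_le (S := S) ((w b).take t) (fun x hx => hw1 b x (List.mem_of_mem_take hx))
      have h2 : ((w b).take t).length ≤ (w b).length := by simp
      rw [hw2] at h2
      omega
    have hmem : ∀ a', μ <:+ τ a' → p t ∈ C1 a' := by
      intro a' hs
      simp only [hC1, Set.Finite.mem_toFinset, Set.mem_setOf_eq, htgt, Finset.mem_product, Finset.mem_univ,
        true_and, Finset.mem_Icc]
      refine ⟨?_, ?_⟩
      · simp only [hsfx, Finset.mem_biUnion, List.mem_toFinset, List.mem_tails, Finset.mem_insert,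
          Finset.mem_image, Finset.mem_univ, true_and]
        refine ⟨μ, hs, ?_⟩
        rcases hμ with h | ⟨e, h⟩
        · exact Or.inl h
        · exact Or.inr ⟨e, h.symm⟩
      · have := hk (p t)
        omega
    refine ⟨p t, ?_, ?_, ?_⟩
    · show p t ∈ (if wordLength S a ≤ 2 * R then C1 a ∪ C2 a else ∅)
      rw [if_pos (by omega)]
      exact Finset.mem_union_left _ (hmem a hμ0)
    · show a⁻¹ * p t ∈ (if wordLength S b ≤ 2 * R then C1 b ∪ C2 b else ∅)
      rw [if_pos (by omega)]
      refine Finset.mem_union_right _ ?_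
      simp only [hC2, Finset.mem_image, Finset.mem_range]
      refine ⟨t, ?_, by simp [hp]⟩
      rw [hw2] at ht
      omega
    · show p t ∈ (if wordLength S (a * b) ≤ 2 * R then C1 (a * b) ∪ C2 (a * b) else ∅)
      rw [if_pos hab]
      exact Finset.mem_union_left _ (hmem _ hμN)

end ArtinRD


set_option linter.all false

namespace ArtinRD

/-- signed letter -/
def sgn {G : Type*} [Group G] (x : G) : Bool → G
  | true => x
  | false => x⁻¹

@[simp] lemma sgn_true {G : Type*} [Group G] (x : G) : sgn x true = x := rfl
@[simp] lemma sgn_false {G : Type*} [Group G] (x : G) : sgn x false = x⁻¹ := rfl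
lemma sgn_not {G : Type*} [Group G] (x : G) (ε : Bool) : sgn x (!ε) = (sgn x ε)⁻¹ := by cases ε <;> simp
lemma map_sgn {G H : Type*} [Group G] [Group H] (f : G →* H) (x : G) (ε : Bool) : f (sgn x ε) = sgn (f x) ε := by
  cases ε <;> simp

lemma map_altProd {G H : Type*} [Group G] [Group H] (f : G →* H) (n : ℕ) (x y : G) :
    f (altProd n x y) = altProd n (f x) (f y) := by
  induction n generalizing x y with
  | zero => simp [altProd]
  | succ n ih => simp [altProd, ih]

/-- the letters -/
def dS {D : Type*} [Group D] (e : Bool → D) : Set D := {g | ∃ c ε, g = sgn (e c) ε}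

noncomputable def dlen {D : Type*} [Group D] (e : Bool → D) (d : D) : ℕ := wordLength (dS e) d

def Dbl {D : Type*} [Group D] (e : Bool → D) (d : D) : Prop :=
  ∀ g, ∃ ε, dlen e (d * sgn (e g) ε) < dlen e d

structure DihFacts {D : Type*} [Group D] (e : Bool → D) (m : ℕ∞) : Prop where
  sg : SymGen (dS e)
  par : ∀ d g ε, dlen e (d * sgn (e g) ε) = dlen e d + 1 ∨ dlen e (d * sgn (e g) ε) + 1 = dlen e d
  db : ∀ d g ε, dlen e (d * sgn (e g) ε) < dlen e d → ¬ dlen e (d * sgn (e g) (!ε)) < dlen e d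
  dc : ∀ g (u v : ℤ), ¬ Dbl e (e g ^ u * e (!g) ^ v)
  dd : m ≠ 3 → ∀ g (u v w : ℤ), ¬ Dbl e (e g ^ u * e (!g) ^ v * e g ^ w)
  dinf : m = ⊤ → ∀ d, ¬ Dbl e d
  cent : ∃ K N : ℕ, ∀ R : ℕ, ∃ C : D → Finset D, (∀ u, (C u).card ≤ K * (R + 1) ^ N) ∧
      ∀ h u, dlen e h ≤ R → dlen e u ≤ R → ∃ c ∈ C h, h⁻¹ * c ∈ C u ∧ c ∈ C (h * u)

def dihRels (m : ℕ∞) : Set (FreeGroup Bool) :=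
  {r | ∃ k : ℕ, m = k ∧ r = altProd k (FreeGroup.of false) (FreeGroup.of true) *
    (altProd k (FreeGroup.of true) (FreeGroup.of false))⁻¹}

abbrev Dih (m : ℕ∞) : Type := PresentedGroup (dihRels m)

def dg (m : ℕ∞) (c : Bool) : Dih m := PresentedGroup.of c

lemma dih_sg (m : ℕ∞) : SymGen (dS (dg m)) := by
  apply SymGen.of_closure
  · rintro x ⟨c, ε, rfl⟩
    exact ⟨c, !ε, (sgn_not _ _).symm⟩
  · rw [eq_top_iff, ← PresentedGroup.closure_range_of (dihRels m)]
    apply Subgroup.closure_mono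
    rintro x ⟨c, rfl⟩
    exact ⟨c, true, rfl⟩

lemma dg_rel (m : ℕ∞) (k : ℕ) (h : m = k) :
    altProd k (dg m false) (dg m true) = altProd k (dg m true) (dg m false) := by
  have := PresentedGroup.one_of_mem (rels := dihRels m) ⟨k, h, rfl⟩
  rw [map_mul, map_inv, map_altProd, map_altProd, mul_inv_eq_one] at this
  exact this

lemma dih_lift (m : ℕ∞) {H : Type*} [Group H] (a : Bool → H)
    (h : ∀ k : ℕ, m = k → altProd k (a false) (a true) = altProd k (a true) (a false)) :
    ∃ f : Dih m →* H, ∀ c, f (dg m c) = a c := by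
  have hr : ∀ r ∈ dihRels m, FreeGroup.lift a r = 1 := by
    rintro r ⟨k, hk, rfl⟩
    rw [map_mul, map_inv, map_altProd, map_altProd, mul_inv_eq_one]
    simpa using h k hk
  exact ⟨PresentedGroup.toGroup hr, fun c => PresentedGroup.toGroup.of hr⟩

/-! ### normal forms -/
section nf
variable {D : Type*} [Group D] (e : Bool → D)

def altEnd : ℕ → Bool → D
  | 0, _ => 1
  | l + 1, c => altEnd l (!c) * e (!c)

lemma altEnd_succ_left (n : ℕ) (c : Bool) :
    altEnd e (n + 1) c = e (xor c (n + 1).bodd) * altEnd e n c := by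
  induction n generalizing c with
  | zero => simp [altEnd]
  | succ n ih =>
    rw [altEnd, ih, altEnd, mul_assoc]
    congr 2
    simp only [Nat.bodd_succ]; cases c <;> cases n.bodd <;> rfl

lemma altProd_eq_altEnd (n : ℕ) (x : Bool) : altProd n (e x) (e (!x)) = altEnd e n (xor x n.bodd) := by
  induction n generalizing x with
  | zero => simp [altEnd, altProd]
  | succ n ih =>
    rw [altProd, altEnd_succ_left]
    have := ih (!x)
    rw [Bool.not_not] at this
    rw [this]
    congr 2 <;> (simp only [Nat.bodd_succ]; cases x <;> cases n.bodd <;> rfl)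

variable (m : ℕ) (hrel : altProd m (e false) (e true) = altProd m (e true) (e false))
include hrel

lemma altEnd_full (c c' : Bool) : altEnd e m c = altEnd e m c' := by
  have h : altEnd e m false = altEnd e m true := by
    have h1 := altProd_eq_altEnd e m false
    have h2 := altProd_eq_altEnd e m true
    simp only [Bool.not_false, Bool.not_true] at h1 h2
    rw [h1, h2] at hrel
    cases hb : m.bodd <;> simp [hb] at hrel
    · exact hrel
    · exact hrel.symm
  cases c <;> cases c' <;> simp [h]

lemma delta_comm (x c c' : Bool) : e x * altEnd e m c = altEnd e m c' * e (xor x m.bodd) := by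
  have h1 := altEnd_succ_left e m (xor x (m + 1).bodd)
  rw [altEnd] at h1
  rw [altEnd_full e m hrel c (xor x (m + 1).bodd), altEnd_full e m hrel c' (!(xor x (m + 1).bodd))]
  have e1 : (xor (xor x (m + 1).bodd) (m + 1).bodd) = x := by cases x <;> cases (m+1).bodd <;> rfl
  have e2 : (!(xor x (m + 1).bodd)) = xor x m.bodd := by
    simp only [Nat.bodd_succ]; cases x <;> cases m.bodd <;> rfl
  rw [e1] at h1
  rw [e2] at h1 ⊢
  exact h1.symm

lemma delta_comm_altEnd (l : ℕ) (x c c' : Bool) :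
    altEnd e l (xor x m.bodd) * altEnd e m c = altEnd e m c' * altEnd e l x := by
  induction l generalizing x c c' with
  | zero => simp [altEnd]; exact altEnd_full e m hrel _ _
  | succ l ih =>
    simp only [altEnd]
    have : (!(xor x m.bodd)) = xor (!x) m.bodd := by cases x <;> cases m.bodd <;> rfl
    rw [this, mul_assoc, delta_comm e m hrel _ c c', ← mul_assoc, ih (!x) c' c', mul_assoc]
    congr 3
    cases x <;> cases m.bodd <;> rfl

omit hrel in
def pos : List ℕ → Bool → ℕ → D
  | [], c, b => altEnd e b c
  | l :: U, c, b => pos U (xor c (l - 1).bodd) b * altEnd e l c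

lemma delta_comm_pos (U : List ℕ) (x c c' : Bool) (b : ℕ) :
    pos e U (xor x m.bodd) b * altEnd e m c = altEnd e m c' * pos e U x b := by
  induction U generalizing x c c' with
  | nil => exact delta_comm_altEnd e m hrel _ _ _ _
  | cons l U ih =>
    simp only [pos]
    rw [mul_assoc, delta_comm_altEnd e m hrel _ _ c c', ← mul_assoc]
    have : (xor (xor x m.bodd) (l - 1).bodd) = xor (xor x (l - 1).bodd) m.bodd := by
      cases x <;> cases m.bodd <;> cases (l - 1).bodd <;> rfl
    rw [this, ih _ c' c', mul_assoc]

omit hrel in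
def nf (s : DState) : D := (altEnd e m false) ^ s.k * pos e s.U s.c s.b

lemma nf_up (hm : 2 ≤ m) (g : Bool) (s : DState) (h : s.Valid m) :
    nf e m (DState.up m g s) = nf e m s * e g := by
  obtain ⟨c, U, b, k⟩ := s
  obtain ⟨h1, h2⟩ := h
  simp only at h1 h2
  by_cases hg : g = c
  · subst hg
    simp only [DState.up, if_true]
    cases U with
    | nil =>
      simp only [DState.ext]
      split_ifs with hb
      · simp [nf, pos, altEnd, mul_assoc]
      · have hb' : b + 1 = m := by omega
        simp only [nf, pos, altEnd, mul_one, zpow_add_one, mul_assoc]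
        rw [altEnd_full e m hrel false (!g), ← hb', altEnd, Bool.not_not]
    | cons l U =>
      obtain ⟨hl1, hl2⟩ := h1 l (by simp)
      simp only [DState.ext]
      split_ifs with hb
      · simp only [nf, pos, altEnd, Bool.not_not, mul_assoc]
        have : (xor (!g) (l + 1 - 1).bodd) = xor g (l - 1).bodd := by
          rw [Nat.add_sub_cancel, DState.bodd_sub_one hl1]
          cases g <;> cases (l - 1).bodd <;> rfl
        rw [this]
      · have hb' : l + 1 = m := by omega
        simp only [nf, pos, zpow_add_one, mul_assoc]
        rw [← delta_comm_pos e m hrel U g (!g) false b]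
        congr 2
        · congr 1
          have : m.bodd = (l - 1).bodd := by
            rw [← hb', Nat.bodd_succ, DState.bodd_sub_one hl1]; simp
          rw [this]
        · rw [← hb', altEnd, Bool.not_not]
  · have hg' : g = !c := by cases g <;> cases c <;> simp_all
    subst hg'
    simp [DState.up, DState.new, nf, pos, altEnd, mul_assoc]
end nf

end ArtinRD


set_option linter.all false

namespace ArtinRD

lemma LAdj.map {T T' : Type*} (f : T → T') {l l' : List T} (h : LAdj l l') : LAdj (l.map f) (l'.map f) := by
  rcases h with ⟨e, rfl⟩ | ⟨e, rfl⟩ | ⟨e, e', r, rfl, rfl⟩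
  · exact Or.inl ⟨f e, rfl⟩
  · exact Or.inr (Or.inl ⟨f e, rfl⟩)
  · exact Or.inr (Or.inr ⟨f e, f e', r.map f, rfl, rfl⟩)

namespace DState
def tl (s : DState) : List ℕ := s.U ++ [s.b]

lemma tl_up (m : ℕ) (g : Bool) (s : DState) : LAdj s.tl (up m g s).tl := by
  obtain ⟨c, U, b, k⟩ := s
  unfold up
  split_ifs with h
  · cases U with
    | nil =>
      simp only [ext]
      split_ifs
      · exact Or.inr (Or.inr ⟨b, b + 1, [], rfl, rfl⟩)
      · exact Or.inr (Or.inr ⟨b, 0, [], rfl, rfl⟩)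
    | cons l U =>
      simp only [ext]
      split_ifs
      · exact Or.inr (Or.inr ⟨l, l + 1, U ++ [b], rfl, rfl⟩)
      · exact Or.inr (Or.inl ⟨l, rfl⟩)
  · exact Or.inl ⟨1, rfl⟩

lemma tl_dn {m : ℕ} (hm : 2 ≤ m) (g : Bool) (s : DState) (h : s.Valid m) : LAdj s.tl (dn m g s).tl := by
  have := tl_up m g (dn m g s)
  rw [up_dn hm g s h] at this
  exact this.symm
end DState

section finite

abbrev VState (m : ℕ) := {s : DState // s.Valid m}

def upPerm (m : ℕ) (hm : 3 ≤ m) (g : Bool) : Equiv.Perm (VState m) where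
  toFun s := ⟨DState.up m g s.1, DState.up_valid (by omega) g s.1 s.2⟩
  invFun s := ⟨DState.dn m g s.1, DState.dn_valid (by omega) g s.1 s.2⟩
  left_inv s := Subtype.ext (DState.dn_up (by omega) g s.1 s.2)
  right_inv s := Subtype.ext (DState.up_dn (by omega) g s.1 s.2)

lemma alt_perm (m : ℕ) (hm : 3 ≤ m) (n : ℕ) (g : Bool) (s : VState m) :
    ((altProd n ((upPerm m hm g)⁻¹) ((upPerm m hm (!g))⁻¹))⁻¹ s).1 = DState.alt m n g s.1 := by
  induction n generalizing g s with
  | zero => simp [altProd, DState.alt]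
  | succ n ih =>
    rw [altProd, mul_inv_rev, Equiv.Perm.mul_apply, inv_inv, DState.alt]
    have := ih (!g) (upPerm m hm g s)
    rw [Bool.not_not] at this
    rw [this]; rfl

lemma exists_act (m : ℕ) (hm : 3 ≤ m) : ∃ f : Dih m →* Equiv.Perm (VState m), ∀ c, f (dg m c) = (upPerm m hm c)⁻¹ := by
  refine dih_lift (m : ℕ∞) (fun c => (upPerm m hm c)⁻¹) ?_
  intro k hk
  have hk' : m = k := by exact_mod_cast hk
  subst hk'
  apply inv_injective
  ext1 s
  apply Subtype.ext
  have h1 := alt_perm m hm m false s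
  have h2 := alt_perm m hm m true s
  simp only [Bool.not_false, Bool.not_true] at h1 h2
  rw [h1, h2, DState.alt_full (by omega) _ _ s.2, DState.alt_full (by omega) _ _ s.2]

theorem dihFacts_fin (m : ℕ) (hm : 3 ≤ m) : DihFacts (dg m) (m : ℕ∞) := by
  obtain ⟨f, hf⟩ := exists_act m hm
  have hm2 : 2 ≤ m := by omega
  set s0 : VState m := ⟨⟨false, [], 0, 0⟩, by simp, by simp; omega⟩ with hs0
  set st : Dih m → DState := fun d => ((f d)⁻¹ s0).1 with hst
  have hv : ∀ d, (st d).Valid m := fun d => ((f d)⁻¹ s0).2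
  have hup : ∀ d g, st (d * dg m g) = DState.up m g (st d) := by
    intro d g
    simp only [hst, map_mul, mul_inv_rev, hf, inv_inv, Equiv.Perm.mul_apply]
    rfl
  have hdn : ∀ d g, st (d * (dg m g)⁻¹) = DState.dn m g (st d) := by
    intro d g
    have := hup (d * (dg m g)⁻¹) g
    rw [inv_mul_cancel_right] at this
    rw [this, DState.dn_up hm2 g _ (hv _)]
  have hst1 : st 1 = ⟨false, [], 0, 0⟩ := by
    simp only [hst, map_one, inv_one, Equiv.Perm.one_apply, hs0]
  have hrel := dg_rel (m : ℕ∞) m rfl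
  have hnfu : ∀ d g, nf (dg m) m (st (d * dg m g)) = nf (dg m) m (st d) * dg m g := by
    intro d g
    rw [hup, nf_up _ _ hrel hm2 _ _ (hv d)]
  have hnf : ∀ d, nf (dg m) m (st d) = d := by
    have key : ∀ w : List (Dih m), (∀ a ∈ w, a ∈ dS (dg (m : ℕ∞))) → ∀ d, nf (dg m) m (st d) = d →
        nf (dg m) m (st (d * w.prod)) = d * w.prod := by
      intro w
      induction w with
      | nil => intro _ d hd; simpa using hd
      | cons x w ih =>
        intro hw d hd
        rw [List.prod_cons, ← mul_assoc]
        apply ih (fun a ha => hw a (by simp [ha]))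
        obtain ⟨g, ε, rfl⟩ := hw x (by simp)
        cases ε
        · have := hnfu (d * (dg m g)⁻¹) g
          rw [inv_mul_cancel_right, hd] at this
          simp only [sgn_false]
          rw [eq_mul_inv_iff_mul_eq]
          exact this.symm
        · simp only [sgn_true]
          rw [hnfu, hd]
    intro d
    obtain ⟨w, hw, rfl⟩ := (dih_sg m).gen d
    have := key w hw 1 (by rw [hst1]; simp [nf, pos, altEnd])
    simpa using this
  have hlen : ∀ d, dlen (dg m) d = DState.len m (st d) := by
    intro d
    refine wl_eq_of (dih_sg m) (fun d => DState.len m (st d)) ?_ ?_ ?_ ?_ d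
    · show DState.len m (st 1) = 0
      rw [hst1]; simp [DState.len, DState.ht]
    · rintro g x ⟨c, ε, rfl⟩
      cases ε
      · simp only [sgn_false, hdn]
        have := DState.len_dn hm2 c _ (hv g); omega
      · simp only [sgn_true, hup]
        have := DState.len_up hm2 c _ (hv g); omega
    · intro g hg
      obtain ⟨h1, h2, h3⟩ := DState.len_zero hm2 _ (hv g) hg
      rw [← hnf g]
      simp [nf, h1, h2, h3, pos, altEnd]
    · intro g hg
      obtain ⟨c, h | h⟩ := DState.exists_desc hm2 _ (hv g) hg
      · refine ⟨dg m c, ⟨c, true, rfl⟩, ?_⟩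
        simp only [hup]
        exact (DState.len_up_lt hm2 _ _ (hv g)).2 h
      · refine ⟨(dg m c)⁻¹, ⟨c, false, rfl⟩, ?_⟩
        simp only [hdn]
        exact (DState.len_dn_lt hm2 _ _ (hv g)).2 h
  have hdbl : ∀ d, Dbl (dg m) d → DState.zer m (st d) = 0 := by
    intro d hd
    by_contra hz
    obtain ⟨t, ht, h0⟩ := DState.zer_pos_of hm2 (st d) (by omega)
    refine DState.double_ne hm2 (st d) (hv d) ?_ t ht h0
    intro g
    obtain ⟨ε, hε⟩ := hd g
    rw [hlen, hlen] at hε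
    cases ε
    · right
      rw [sgn_false, hdn] at hε
      exact (DState.len_dn_lt hm2 _ _ (hv d)).1 hε
    · left
      rw [sgn_true, hup] at hε
      exact (DState.len_up_lt hm2 _ _ (hv d)).1 hε
  have hpow : ∀ d g (u : ℤ), DState.zer m (st d) ≤ DState.zer m (st (d * dg m g ^ u)) + 1 := by
    intro d g u
    have h1 : ∀ n : ℕ, st (d * dg m g ^ n) = (DState.up m g)^[n] (st d) := by
      intro n
      induction n with
      | zero => simp
      | succ n ih => rw [pow_succ, ← mul_assoc, hup, ih, Function.iterate_succ_apply']
    have h2 : ∀ n : ℕ, st (d * (dg m g ^ n)⁻¹) = (DState.dn m g)^[n] (st d) := by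
      intro n
      induction n with
      | zero => simp
      | succ n ih => rw [pow_succ', mul_inv_rev, ← mul_assoc, hdn, ih, Function.iterate_succ_apply']
    obtain ⟨n, rfl | rfl⟩ := u.eq_nat_or_neg
    · rw [zpow_natCast, h1]
      have := (DState.zer_up_iter hm2 g (st d) (hv d) n).2
      omega
    · rw [zpow_neg, zpow_natCast, h2]
      have := (DState.zer_dn_iter hm2 g (st d) (hv d) n).2
      omega
  have hz1 : DState.zer m (st 1) = m := by
    rw [hst1]; simp [DState.zer, DState.ht]
  have hdc : ∀ g (u v : ℤ), m ≤ DState.zer m (st (dg m g ^ u * dg m (!g) ^ v)) + 2 := by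
    intro g u v
    have h1 := hpow 1 g u
    have h2 := hpow (dg m g ^ u) (!g) v
    rw [one_mul] at h1
    omega
  refine ⟨dih_sg m, ?_, ?_, ?_, ?_, ?_, ?_⟩
  · intro d g ε
    rw [hlen, hlen]
    cases ε
    · rw [sgn_false, hdn]
      have := DState.len_dn hm2 g _ (hv d); omega
    · rw [sgn_true, hup]
      have := DState.len_up hm2 g _ (hv d); omega
  · have : ∀ d g, ¬ (dlen (dg m) (d * dg m g) < dlen (dg m) d ∧ dlen (dg m) (d * (dg m g)⁻¹) < dlen (dg m) d) := by
      rintro d g ⟨h1, h2⟩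
      rw [hlen, hlen] at h1 h2
      rw [hup, DState.len_up_lt hm2 g _ (hv d)] at h1
      rw [hdn, DState.len_dn_lt hm2 g _ (hv d)] at h2
      have := DState.ht_ip_le_im hm2 g _ (hv d)
      omega
    intro d g ε h1 h2
    cases ε
    · exact this d g ⟨h2, h1⟩
    · exact this d g ⟨h1, h2⟩
  · intro g u v h
    have h1 := hdbl _ h
    have h2 := hdc g u v
    omega
  · intro h3 g u v w h
    have h1 := hdbl _ h
    have h2 := hdc g u v
    have h4 := hpow (dg m g ^ u * dg m (!g) ^ v) g w
    have : m ≠ 3 := by rintro rfl; exact h3 rfl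
    omega
  · intro h; simp at h
  · have : NeZero m := ⟨by omega⟩
    refine centroid_of_tree (T := Fin m) (dih_sg m) (fun d => (st d).tl.map (Fin.ofNat m)) (fun d => ((st d).c, (st d).k))
      ?_ ?_ ?_ ?_
    · rintro d x ⟨c, ε, rfl⟩
      apply LAdj.map
      cases ε
      · rw [sgn_false, hdn]; exact DState.tl_dn hm2 _ _ (hv d)
      · rw [sgn_true, hup]; exact DState.tl_up _ _ _
    · intro d
      have := DState.U_le hm2 (st d) (hv d)
      rw [← hlen] at this
      simp only [List.length_map, DState.tl, List.length_append, List.length_singleton]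
      unfold dlen at this
      omega
    · intro d
      have := DState.k_le hm2 (st d) (hv d)
      rw [← hlen] at this
      exact this
    · intro d d' h1 h2
      have hval : ∀ s : DState, s.Valid m → (s.tl.map (Fin.ofNat m)).map Fin.val = s.tl := by
        intro s hs
        rw [List.map_map]
        conv_rhs => rw [← List.map_id s.tl]
        apply List.map_congr_left
        intro a ha
        simp only [Function.comp, Fin.val_ofNat, id]
        apply Nat.mod_eq_of_lt
        rcases List.mem_append.1 ha with h | h
        · exact (hs.1 a h).2
        · rw [List.mem_singleton.1 h]; exact hs.2
      have h3 : (st d).tl = (st d').tl := by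
        rw [← hval _ (hv d), ← hval _ (hv d')]; exact congrArg _ h1
      rw [← hnf d, ← hnf d']
      simp only [DState.tl] at h3
      obtain ⟨h4, h5⟩ := List.append_inj' h3 rfl
      simp only [List.cons.injEq, and_true] at h5
      simp only [Prod.mk.injEq] at h2
      simp only [nf, h4, h5, h2.1, h2.2]
end finite

theorem dihFacts_top : DihFacts (dg ⊤) ⊤ := by
  classical
  obtain ⟨f, hf⟩ := dih_lift ⊤ (H := FreeGroup Bool) FreeGroup.of (fun k hk => by simp at hk)
  set g : FreeGroup Bool →* Dih ⊤ := FreeGroup.lift (dg ⊤) with hg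
  have hgf : ∀ d, g (f d) = d := by
    intro d
    have : g.comp f = MonoidHom.id _ := by
      apply PresentedGroup.ext
      intro x
      show g (f (dg ⊤ x)) = dg ⊤ x
      rw [hf, hg, FreeGroup.lift_apply_of]
    exact DFunLike.congr_fun this d
  set τ : Dih ⊤ → List (Bool × Bool) := fun d => ((f d)⁻¹).toWord with hτ
  have hinj : ∀ d d', τ d = τ d' → d = d' := by
    intro d d' h
    have := inv_injective (FreeGroup.toWord_injective h)
    rw [← hgf d, this, hgf]
  have hτ1 : τ 1 = [] := by simp [hτ]
  have hstep : ∀ d c ε, (∃ t, τ d = (c, ε) :: t ∧ τ (d * sgn (dg ⊤ c) ε) = t) ∨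
      ((∀ t, τ d ≠ (c, ε) :: t) ∧ τ (d * sgn (dg ⊤ c) ε) = (c, !ε) :: τ d) := by
    intro d c ε
    have h1 : τ (d * sgn (dg ⊤ c) ε) = FreeGroup.reduce ((c, !ε) :: τ d) := by
      have e1 : (sgn (FreeGroup.of c) ε)⁻¹ = FreeGroup.mk [(c, !ε)] := by
        cases ε <;> rfl
      simp only [hτ]
      rw [map_mul, map_sgn, hf, mul_inv_rev, e1, FreeGroup.toWord_mul]
      simp
    have h2 : FreeGroup.reduce (τ d) = τ d := FreeGroup.reduce_toWord _
    rw [FreeGroup.reduce.cons, h2] at h1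
    rcases ht : τ d with _ | ⟨⟨c', ε'⟩, t⟩
    · right
      rw [ht] at h1
      exact ⟨by simp, h1⟩
    · rw [ht] at h1
      simp only at h1
      by_cases h : c = c' ∧ ε = ε'
      · left
        obtain ⟨rfl, rfl⟩ := h
        exact ⟨t, rfl, by simpa using h1⟩
      · right
        refine ⟨?_, ?_⟩
        · intro t' h'
          simp only [List.cons.injEq, Prod.mk.injEq] at h'
          exact h ⟨h'.1.1.symm, h'.1.2.symm⟩
        · rw [h1, if_neg]
          rintro ⟨h3, h4⟩
          exact h ⟨h3, by simpa using h4⟩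
  have hlen : ∀ d, dlen (dg ⊤) d = (τ d).length := by
    intro d
    refine wl_eq_of (dih_sg ⊤) (fun d => (τ d).length) ?_ ?_ ?_ ?_ d
    · simp [hτ1]
    · rintro g x ⟨c, ε, rfl⟩
      rcases hstep g c ε with ⟨t, h1, h2⟩ | ⟨_, h2⟩
      · simp only [h1, h2, List.length_cons]; omega
      · simp only [h2, List.length_cons]; omega
    · intro g hg
      exact hinj _ _ (by rw [hτ1]; exact List.length_eq_zero_iff.1 hg)
    · intro g hg
      rcases ht : τ g with _ | ⟨⟨c, ε⟩, t⟩
      · simp [ht] at hg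
      · refine ⟨_, ⟨c, ε, rfl⟩, ?_⟩
        rcases hstep g c ε with ⟨t, h1, h2⟩ | ⟨h1, _⟩
        · simp [← ht, h1, h2]
        · exact absurd ht (h1 t)
  have hlt : ∀ d c ε, dlen (dg ⊤) (d * sgn (dg ⊤ c) ε) < dlen (dg ⊤) d → ∃ t, τ d = (c, ε) :: t := by
    intro d c ε h
    rw [hlen, hlen] at h
    rcases hstep d c ε with ⟨t, h1, h2⟩ | ⟨_, h2⟩
    · exact ⟨t, h1⟩
    · rw [h2] at h; simp at h
  have hdbl : ∀ d, ¬ Dbl (dg ⊤) d := by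
    intro d h
    obtain ⟨ε, h1⟩ := h false
    obtain ⟨ε', h2⟩ := h true
    obtain ⟨t, h1⟩ := hlt _ _ _ h1
    obtain ⟨t', h2⟩ := hlt _ _ _ h2
    rw [h1] at h2; simp at h2
  refine ⟨dih_sg ⊤, ?_, ?_, fun g u v => hdbl _, fun _ g u v w => hdbl _, fun _ => hdbl, ?_⟩
  · intro d c ε
    rw [hlen, hlen]
    rcases hstep d c ε with ⟨t, h1, h2⟩ | ⟨_, h2⟩
    · rw [h1, h2]; simp
    · rw [h2]; simp
  · intro d c ε h1 h2
    obtain ⟨t, h1⟩ := hlt _ _ _ h1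
    obtain ⟨t', h2⟩ := hlt _ _ _ h2
    rw [h1] at h2; simp at h2
  · refine centroid_of_tree (T := Bool × Bool) (dih_sg ⊤) τ (fun _ => (true, 0)) ?_ ?_ ?_ ?_
    · rintro d x ⟨c, ε, rfl⟩
      rcases hstep d c ε with ⟨t, h1, h2⟩ | ⟨_, h2⟩
      · rw [h1, h2]; exact Or.inr (Or.inl ⟨_, rfl⟩)
      · rw [h2]; exact Or.inl ⟨_, rfl⟩
    · intro d
      have := hlen d
      unfold dlen at this
      omega
    · intro d; simp
    · intro d d' h _; exact hinj _ _ h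

theorem dihFacts (m : ℕ∞) (hm : 3 ≤ m) : DihFacts (dg m) m := by
  induction m using ENat.recTopCoe with
  | top => exact dihFacts_top
  | coe m => exact dihFacts_fin m (by exact_mod_cast hm)

end ArtinRD


set_option linter.all false

namespace ArtinRD

/-- A system of dihedral groups. -/
structure Sys where
  I : Type
  S : Type
  p : S → Bool → I
  D : S → Type
  grp : ∀ s, Group (D s)
  e : ∀ s, Bool → D s
  inj : ∀ s c, p s c ≠ p s (!c)
  uniq : ∀ s s' c c' d', p s c = p s' c' → p s (!c) = p s' d' → s = s'
  sg : ∀ s, SymGen (dS (e s))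
  par : ∀ s d g ε, dlen (e s) (d * sgn (e s g) ε) = dlen (e s) d + 1 ∨
    dlen (e s) (d * sgn (e s g) ε) + 1 = dlen (e s) d
  db : ∀ s d g ε, dlen (e s) (d * sgn (e s g) ε) < dlen (e s) d →
    ¬ dlen (e s) (d * sgn (e s g) (!ε)) < dlen (e s) d
  dc : ∀ s g (u v : ℤ), ¬ Dbl (e s) (e s g ^ u * e s (!g) ^ v)

namespace Sys
attribute [instance] Sys.grp

variable (A : Sys)

abbrev v (s : A.S) (c ε : Bool) : A.D s := sgn (A.e s c) ε
noncomputable abbrev dl {s : A.S} (d : A.D s) : ℕ := dlen (A.e s) d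

variable {A}
lemma v_not (s : A.S) (c ε : Bool) : A.v s c (!ε) = (A.v s c ε)⁻¹ := sgn_not _ _
lemma mvv (s : A.S) (c ε : Bool) (d : A.D s) : d * A.v s c (!ε) * A.v s c ε = d := by
  rw [v_not, inv_mul_cancel_right]
lemma mvv' (s : A.S) (c ε : Bool) (d : A.D s) : d * A.v s c ε * A.v s c (!ε) = d := by
  rw [v_not, mul_inv_cancel_right]
lemma dl_one (s : A.S) : A.dl (1 : A.D s) = 0 := wl_one
lemma dl_mul {s : A.S} (a b : A.D s) : A.dl (a * b) ≤ A.dl a + A.dl b := wl_mul (A.sg s) a b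
lemma dl_eq_zero {s : A.S} {a : A.D s} (h : A.dl a = 0) : a = 1 := wl_eq_zero (A.sg s) h
lemma dl_v_le (s : A.S) (c ε : Bool) : A.dl (A.v s c ε) ≤ 1 := wl_mem_le ⟨c, ε, rfl⟩
/-- exchange: from a descent, write `d = d' * v`. -/
lemma dl_desc {s : A.S} {d : A.D s} (h : A.dl d ≠ 0) :
    ∃ d' c ε, d = d' * A.v s c ε ∧ A.dl d = A.dl d' + 1 := by
  obtain ⟨x, ⟨c, ε, rfl⟩, hx⟩ := wl_desc (A.sg s) (N := A.dl d - 1) (g := d)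
    (show dlen (A.e s) d = _ by have : dlen (A.e s) d ≠ 0 := h; show _ = dlen (A.e s) d - 1 + 1; omega)
  refine ⟨d * A.v s c ε, c, !ε, (mvv' s c ε d).symm, ?_⟩
  have h' : A.dl (d * A.v s c ε) = A.dl d - 1 := hx
  omega
lemma dl_lt {s : A.S} {d : A.D s} {c ε : Bool} (h : A.dl (d * A.v s c ε) < A.dl d) :
    A.dl d = A.dl (d * A.v s c ε) + 1 := by
  have := A.par s d c ε; show A.dl d = _ + 1; simp only [dl, v] at *; omega
lemma dl_nlt {s : A.S} {d : A.D s} {c ε : Bool} (h : ¬ A.dl (d * A.v s c ε) < A.dl d) :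
    A.dl (d * A.v s c ε) = A.dl d + 1 := by
  have := A.par s d c ε; simp only [dl, v] at *; omega

/-! ### words and the quotient -/
variable (A) in
abbrev Letter := A.I × Bool
def emb (s : A.S) (a : Bool × Bool) : A.Letter := (A.p s a.1, a.2)
def ev (s : A.S) : List (Bool × Bool) → A.D s
  | [] => 1
  | a :: w => ev s w * A.v s a.1 a.2
def Geo (s : A.S) (w : List (Bool × Bool)) : Prop := A.dl (ev s w) = w.length

inductive Step : List A.Letter → List A.Letter → Prop
  | move (s : A.S) (w w' : List (Bool × Bool)) (u : List A.Letter) (h : Geo s w) (h' : Geo s w')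
      (he : ev s w = ev s w') : Step (w.map (emb s) ++ u) (w'.map (emb s) ++ u)
  | cons (x : A.Letter) {u u' : List A.Letter} (h : Step u u') : Step (x :: u) (x :: u')

lemma Step.length {u u' : List A.Letter} (h : Step u u') : u.length = u'.length := by
  induction h with
  | move s w w' u h h' he =>
    unfold Geo at h h'; rw [he, h'] at h; simp [h]
  | cons x h ih => simp [ih]

variable (A) in
def Q := Quot (Step (A := A))

namespace Q
def mk (u : List A.Letter) : A.Q := Quot.mk _ u
def nil : A.Q := mk []
def snoc (q : A.Q) (x : A.Letter) : A.Q := Quot.map (fun u => x :: u) (fun _ _ h => Step.cons x h) q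
def len (q : A.Q) : ℕ := Quot.lift List.length (fun _ _ h => h.length) q

@[simp] lemma snoc_mk (u : List A.Letter) (x : A.Letter) : snoc (mk u) x = mk (x :: u) := rfl
@[simp] lemma len_mk (u : List A.Letter) : (mk u).len = u.length := rfl
@[simp] lemma len_snoc (q : A.Q) (x : A.Letter) : (q.snoc x).len = q.len + 1 := by
  induction q using Quot.ind; rfl
@[simp] lemma len_nil : (nil : A.Q).len = 0 := rfl
lemma cases' (q : A.Q) : q = nil ∨ ∃ q' x, q = snoc q' x := by
  induction q using Quot.ind with
  | _ u =>
    cases u with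
    | nil => exact Or.inl rfl
    | cons x u => exact Or.inr ⟨mk u, x, rfl⟩
lemma nil_ne_snoc (q : A.Q) (x : A.Letter) : (nil : A.Q) ≠ snoc q x := by
  intro h; have := congrArg len h; simp at this

/-- append an `s`-word -/
def appw (s : A.S) (w : List (Bool × Bool)) (q : A.Q) : A.Q := w.foldr (fun a q => snoc q (emb s a)) q

lemma appw_mk (s : A.S) (w : List (Bool × Bool)) (u : List A.Letter) :
    appw s w (mk u) = mk (w.map (emb s) ++ u) := by
  induction w with
  | nil => rfl
  | cons a w ih => simp [appw] at ih ⊢; rw [ih]; rfl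

lemma appw_congr (s : A.S) {w w' : List (Bool × Bool)} (h : Geo s w) (h' : Geo s w')
    (he : ev s w = ev s w') (q : A.Q) : appw s w q = appw s w' q := by
  induction q using Quot.ind with
  | _ u =>
    have := appw_mk s w u
    have h2 := appw_mk s w' u
    unfold mk at this h2
    rw [this, h2]
    exact Quot.sound (Step.move s w w' u h h' he)

end Q

lemma exists_geo (s : A.S) (d : A.D s) : ∃ w, ev s w = d ∧ Geo s w := by
  induction hn : A.dl d generalizing d with
  | zero => exact ⟨[], (dl_eq_zero hn).symm, wl_one⟩
  | succ n ih =>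
    obtain ⟨d', c, ε, rfl, h⟩ := dl_desc (d := d) (by omega)
    obtain ⟨w, rfl, hw⟩ := ih d' (by omega)
    refine ⟨(c, ε) :: w, rfl, ?_⟩
    unfold Geo at hw ⊢
    simp only [ev, List.length_cons]
    omega

noncomputable def Q.app {s : A.S} (q : A.Q) (d : A.D s) : A.Q := Q.appw s (exists_geo s d).choose q

open Q

lemma appw_eq (s : A.S) {w : List (Bool × Bool)} (h : Geo s w) (q : A.Q) : appw s w q = q.app (ev s w) :=
  appw_congr s h (exists_geo s (ev s w)).choose_spec.2 (exists_geo s (ev s w)).choose_spec.1.symm q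

lemma app_one {s : A.S} (q : A.Q) : q.app (1 : A.D s) = q := by
  have : Geo s [] := by unfold Geo; exact wl_one
  exact (appw_eq s this q).symm

lemma app_step {s : A.S} (q : A.Q) (d : A.D s) (c ε : Bool) (h : A.dl (d * A.v s c ε) = A.dl d + 1) :
    q.app (d * A.v s c ε) = (q.app d).snoc (A.p s c, ε) := by
  obtain ⟨w, rfl, hw⟩ := exists_geo s d
  have : Geo s ((c, ε) :: w) := by
    unfold Geo at hw ⊢
    simp only [ev, List.length_cons]
    omega
  have h2 := appw_eq s this q
  simp only [ev] at h2
  rw [← h2, ← appw_eq s hw]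
  rfl

/-- descending version -/
lemma app_step' {s : A.S} (q : A.Q) (d : A.D s) (c ε : Bool) (h : A.dl (d * A.v s c (!ε)) < A.dl d) :
    q.app d = (q.app (d * A.v s c (!ε))).snoc (A.p s c, ε) := by
  have h1 := dl_lt h
  have := app_step q (d * A.v s c (!ε)) c ε (by rw [mvv]; exact h1)
  rwa [mvv] at this

lemma len_app {s : A.S} (q : A.Q) (d : A.D s) : (q.app d).len = q.len + A.dl d := by
  induction hn : A.dl d generalizing d with
  | zero => rw [dl_eq_zero hn, app_one]; rfl
  | succ n ih =>
    obtain ⟨d', c, ε, rfl, h⟩ := dl_desc (d := d) (by omega)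
    rw [app_step q d' c ε h, len_snoc, ih d' (by omega)]; omega

/-! ### reducedness -/
def inv' (x : A.Letter) : A.Letter := (x.1, !x.2)
@[simp] lemma inv'_inv' (x : A.Letter) : inv' (inv' x) = x := by simp [inv']
lemma inv'_ne (x : A.Letter) : inv' x ≠ x := by
  intro h; have := congrArg Prod.snd h; simp [inv'] at this

def NC (q : A.Q) (x : A.Letter) : Prop := ∀ q'', q ≠ snoc q'' (inv' x)

inductive Red : A.Q → Prop
  | nil : Red nil
  | snoc (q : A.Q) (x : A.Letter) (h : Red q) (hx : NC q x) : Red (snoc q x)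

def KR (x : A.Letter) (q : A.Q) (y : A.Letter) (q' : A.Q) : Prop :=
  (x = y ∧ q = q') ∨ ∃ (s : A.S) (c ε ε' : Bool) (γ : A.Q) (d : A.D s),
    x = (A.p s c, ε) ∧ y = (A.p s (!c), ε') ∧ q = γ.app (d * A.v s c (!ε)) ∧
    q' = γ.app (d * A.v s (!c) (!ε')) ∧ A.dl (d * A.v s c (!ε)) < A.dl d ∧
    A.dl (d * A.v s (!c) (!ε')) < A.dl d

lemma KR.symm {x y : A.Letter} {q q' : A.Q} (h : KR x q y q') : KR y q' x q := by
  rcases h with ⟨rfl, rfl⟩ | ⟨s, c, ε, ε', γ, d, h1, h2, h3, h4, h5, h6⟩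
  · exact Or.inl ⟨rfl, rfl⟩
  · exact Or.inr ⟨s, !c, ε', ε, γ, d, h2, by simpa using h1, h4, by simpa using h3, h6, by simpa using h5⟩

lemma KR.eq {x y : A.Letter} {q q' : A.Q} (h : KR x q y q') (hxy : x.1 = y.1) : x = y ∧ q = q' := by
  rcases h with h | ⟨s, c, ε, ε', γ, d, h1, h2, _⟩
  · exact h
  · subst h1; subst h2
    exact absurd hxy (A.inj s c)

variable (A) in
def Ok (N : ℕ) : Prop := ∀ (q : A.Q) (x : A.Letter) (q' : A.Q) (y : A.Letter), q.len < N → Red q → NC q x →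
  snoc q x = snoc q' y → Red q' ∧ NC q' y ∧ KR x q y q'

def ND (s : A.S) (γ : A.Q) : Prop := ∀ c ε q, γ ≠ snoc q (A.p s c, ε)

section ok
variable {N : ℕ} (ok : A.Ok N)
include ok

lemma red_snoc {q : A.Q} {x : A.Letter} (h : Red (snoc q x)) (hl : q.len < N) : Red q ∧ NC q x := by
  generalize hr : snoc q x = r at h
  cases h with
  | nil => exact absurd hr.symm (nil_ne_snoc _ _)
  | snoc q1 x1 h1 hx1 =>
    have hl1 : q1.len < N := by
      have := congrArg len hr; simp at this; omega
    have := ok q1 x1 q x hl1 h1 hx1 hr.symm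
    exact ⟨this.1, this.2.1⟩

lemma kr_of {q q' : A.Q} {x y : A.Letter} (h : Red (snoc q x)) (hl : q.len < N) (he : snoc q x = snoc q' y) :
    KR x q y q' := by
  obtain ⟨h1, h2⟩ := red_snoc ok h hl
  exact (ok q x q' y hl h1 h2 he).2.2

lemma red_app {s : A.S} {q : A.Q} {d : A.D s} (h : Red (q.app d)) (hl : (q.app d).len ≤ N) : Red q := by
  induction hn : A.dl d generalizing d with
  | zero => rwa [dl_eq_zero hn, app_one] at h
  | succ n ih =>
    obtain ⟨d', c, ε, rfl, h'⟩ := dl_desc (d := d) (by omega)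
    rw [app_step q d' c ε h'] at h hl
    rw [len_snoc] at hl
    exact ih (red_snoc ok h (by omega)).1 (by omega) (by omega)

lemma add_red {s : A.S} {γ : A.Q} {f d : A.D s} (h : Red ((γ.app f).app d)) (hl : ((γ.app f).app d).len ≤ N) :
    (γ.app f).app d = γ.app (f * d) ∧ A.dl (f * d) = A.dl f + A.dl d := by
  induction hn : A.dl d generalizing d with
  | zero => rw [dl_eq_zero hn]; simp [app_one]
  | succ n ih =>
    obtain ⟨d', c, ε, rfl, h'⟩ := dl_desc (d := d) (by omega)
    rw [app_step _ d' c ε h'] at h hl ⊢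
    rw [len_snoc] at hl
    obtain ⟨h1, h2⟩ := red_snoc ok h (by omega)
    obtain ⟨h3, h4⟩ := ih h1 (by omega) (by omega)
    have h5 : A.dl (f * d' * A.v s c ε) = A.dl (f * d') + 1 := by
      apply dl_nlt
      intro hlt
      rw [h3] at h2
      have hlt' : A.dl (f * d' * A.v s c (!(!ε))) < A.dl (f * d') := by rwa [Bool.not_not]
      exact h2 _ (app_step' γ (f * d') c (!ε) hlt')
    rw [h3, ← mul_assoc, app_step γ _ c ε h5]
    exact ⟨rfl, by omega⟩

lemma gate_exists (s : A.S) {q : A.Q} (h : Red q) (hl : q.len ≤ N) :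
    ∃ (γ : A.Q) (d : A.D s), q = γ.app d ∧ Red γ ∧ ND s γ := by
  induction hn : q.len generalizing q with
  | zero =>
    refine ⟨q, 1, (app_one q).symm, h, ?_⟩
    intro c ε q' hq
    rw [hq] at hn; simp at hn
  | succ n ih =>
    by_cases hnd : ND s q
    · exact ⟨q, 1, (app_one q).symm, h, hnd⟩
    · unfold ND at hnd
      push Not at hnd
      obtain ⟨c, ε, q', rfl⟩ := hnd
      rw [len_snoc] at hl hn
      obtain ⟨h1, h2⟩ := red_snoc ok h (by omega)
      obtain ⟨γ, d, rfl, h3, h4⟩ := ih h1 (by omega) (by omega)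
      have h5 : A.dl (d * A.v s c ε) = A.dl d + 1 := by
        apply dl_nlt
        intro hlt
        have hlt' : A.dl (d * A.v s c (!(!ε))) < A.dl d := by rwa [Bool.not_not]
        exact h2 _ (app_step' γ d c (!ε) hlt')
      exact ⟨γ, d * A.v s c ε, (app_step γ d c ε h5).symm, h3, h4⟩

lemma not_eq_bool {a b : Bool} (h : a ≠ b) : b = !a := by cases a <;> cases b <;> simp_all

/-- KR with two letters both in the pair `s` (different generators): refine to `s`. -/
lemma KR.toPair {s : A.S} {c c' ε ε' : Bool} {q q' : A.Q} (hc : c ≠ c')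
    (h : KR (A.p s c, ε) q (A.p s c', ε') q') : ∃ (γ : A.Q) (d : A.D s),
    q = γ.app (d * A.v s c (!ε)) ∧ q' = γ.app (d * A.v s c' (!ε')) ∧
    A.dl (d * A.v s c (!ε)) < A.dl d ∧ A.dl (d * A.v s c' (!ε')) < A.dl d := by
  have hc' : c' = !c := not_eq_bool ok hc
  subst hc'
  rcases h with ⟨h1, h2⟩ | ⟨s', c2, ε2, ε2', γ, d, h1, h2, h3, h4, h5, h6⟩
  · exact absurd (congrArg Prod.fst h1) (A.inj s c)
  · simp only [Prod.mk.injEq] at h1 h2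
    obtain ⟨h1, rfl⟩ := h1
    obtain ⟨h2, rfl⟩ := h2
    have hs := A.uniq s s' c _ _ h1 h2
    subst hs
    have : c2 = c := by
      by_contra hne
      have := not_eq_bool ok hne
      rw [this] at h1
      exact A.inj s c2 h1.symm
    subst this
    exact ⟨γ, d, h3, h4, h5, h6⟩

/-- KR refined with a gate -/
lemma KR.gate {s : A.S} {c c' ε ε' : Bool} {q q' : A.Q} {γ : A.Q} {d : A.D s} (hr : Red q) (hr' : Red q')
    (hl : q.len ≤ N) (hl' : q'.len ≤ N)
    (h1 : q = γ.app (d * A.v s c (!ε))) (h2 : q' = γ.app (d * A.v s c' (!ε')))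
    (h3 : A.dl (d * A.v s c (!ε)) < A.dl d) (h4 : A.dl (d * A.v s c' (!ε')) < A.dl d) :
    ∃ (γ : A.Q) (d : A.D s), Red γ ∧ ND s γ ∧
    q = γ.app (d * A.v s c (!ε)) ∧ q' = γ.app (d * A.v s c' (!ε')) ∧
    A.dl (d * A.v s c (!ε)) + γ.len = q.len ∧ A.dl (d * A.v s c' (!ε')) + γ.len = q'.len := by
  subst h1; subst h2
  have hγ := red_app ok hr hl
  have hγl : γ.len ≤ N := by rw [len_app] at hl; omega
  obtain ⟨γ0, f, rfl, h5, h6⟩ := gate_exists ok s hγ hγl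
  obtain ⟨h7, h8⟩ := add_red ok hr hl
  obtain ⟨h9, h10⟩ := add_red ok hr' hl'
  refine ⟨γ0, f * d, h5, h6, ?_, ?_, ?_, ?_⟩
  · rw [mul_assoc]; exact h7
  · rw [mul_assoc]; exact h9
  · rw [mul_assoc, h7, len_app]; omega
  · rw [mul_assoc, h9, len_app]; omega

lemma gate_unique {s : A.S} {γ γ' : A.Q} {d d' : A.D s} (h : ND s γ) (h' : ND s γ') (hr : Red (γ.app d))
    (hl : (γ.app d).len ≤ N) (he : γ.app d = γ'.app d') : γ = γ' ∧ d = d' := by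
  induction hn : A.dl d using Nat.strong_induction_on generalizing γ γ' d d' with
  | _ n ih =>
  by_cases hd : A.dl d = 0
  · have := dl_eq_zero hd
    subst this
    rw [app_one] at he hl hr
    by_cases hd' : A.dl d' = 0
    · have := dl_eq_zero hd'
      subst this
      rw [app_one] at he
      exact ⟨he, rfl⟩
    · obtain ⟨d1, c, ε, rfl, h1⟩ := dl_desc hd'
      rw [app_step _ _ _ _ h1] at he
      exact absurd he (h _ _ _)
  · by_cases hd' : A.dl d' = 0
    · have := dl_eq_zero hd'
      subst this
      rw [app_one] at he
      obtain ⟨d1, c, ε, rfl, h1⟩ := dl_desc hd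
      rw [app_step _ _ _ _ h1] at he
      exact absurd he.symm (h' _ _ _)
    · obtain ⟨d1, c, ε, rfl, h1⟩ := dl_desc hd
      obtain ⟨d1', c', ε', rfl, h1'⟩ := dl_desc hd'
      rw [app_step _ _ _ _ h1, app_step _ _ _ _ h1'] at he
      rw [app_step _ _ _ _ h1] at hr hl
      rw [len_snoc] at hl
      have hlen := congrArg len he
      rw [len_snoc, len_snoc] at hlen
      obtain ⟨hr1, hnc⟩ := red_snoc ok hr (by omega)
      obtain ⟨hr1', _, hkr⟩ := ok _ _ _ _ (by omega) hr1 hnc he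
      by_cases hc : c = c'
      · subst hc
        obtain ⟨h3, h4⟩ := hkr.eq rfl
        simp only [Prod.mk.injEq, true_and] at h3
        subst h3
        obtain ⟨h5, h6⟩ := ih (A.dl d1) (by omega) h h' hr1 (by omega) h4 rfl
        exact ⟨h5, by rw [h6]⟩
      · obtain ⟨γ3, d3, h3, h4, h5, h6⟩ := KR.toPair ok hc hkr
        obtain ⟨γ4, D, h7, h8, h9, h10, h11, h12⟩ := KR.gate ok hr1 hr1' (by omega) (by omega) h3 h4 h5 h6
        obtain ⟨h13, h14⟩ := ih (A.dl d1) (by omega) h h8 hr1 (by omega) h9 rfl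
        subst h13
        rw [len_app] at hlen h11 h12
        rw [len_app] at hlen
        have h16 := congrArg A.dl h14
        obtain ⟨h17, h18⟩ := ih (A.dl (D * A.v s c' (!ε'))) (by omega) h8 h' (by rw [← h10]; exact hr1')
            (by rw [← h10, len_app]; rw [len_app] at hl; omega) h10.symm rfl
        refine ⟨h17, ?_⟩
        rw [h14, ← h18, mvv, mvv]

/-- EXT -/
lemma ext_red {s : A.S} {γ : A.Q} (h : ND s γ) (hr : Red γ) (d : A.D s) (hl : γ.len + A.dl d ≤ N) :
    Red (γ.app d) ∧ ∀ c ε, A.dl (d * A.v s c ε) = A.dl d + 1 → NC (γ.app d) (A.p s c, ε) := by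
  induction hn : A.dl d generalizing d with
  | zero =>
    have := dl_eq_zero hn
    subst this
    rw [app_one]
    exact ⟨hr, fun c ε _ q'' hq => h _ _ _ hq⟩
  | succ n ih =>
    obtain ⟨d1, z, ζ, rfl, h1⟩ := dl_desc (d := d) (by omega)
    obtain ⟨h2, h3⟩ := ih d1 (by omega) (by omega)
    have h4 := h3 z ζ (by omega)
    have h5 : Red (γ.app (d1 * A.v s z ζ)) := by
      rw [app_step _ _ _ _ h1]; exact Red.snoc _ _ h2 h4
    refine ⟨h5, ?_⟩
    intro c ε hce q'' hq
    rw [app_step _ _ _ _ h1] at hq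
    have hl1 : (γ.app d1).len < N := by rw [len_app]; omega
    obtain ⟨h6, h7, hkr⟩ := ok _ _ _ _ hl1 h2 h4 hq
    simp only [inv'] at hkr hq
    by_cases hzc : z = c
    · subst hzc
      obtain ⟨h8, h9⟩ := hkr.eq rfl
      simp only [Prod.mk.injEq, true_and] at h8
      subst h8
      rw [mvv] at hce
      omega
    · obtain ⟨γ3, d3, h13, h14, h15, h16⟩ := KR.toPair ok hzc hkr
      have hlen := congrArg len hq
      rw [len_snoc, len_snoc] at hlen
      obtain ⟨γ4, D, h17, h18, h9, h10, h11, h12⟩ := KR.gate ok h2 h6 (by omega) (by omega) h13 h14 h15 h16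
      obtain ⟨h21, h22⟩ := gate_unique ok h h18 h2 (by omega) h9
      subst h21
      have h23 : d1 * A.v s z ζ = D := by rw [h22, mvv]
      rw [h23] at hce h1 hn hl
      rw [Bool.not_not] at h12
      rw [len_app] at hlen h11
      omega

/-! ### stripping -/
inductive Strip (i : A.I) (r : A.Q) : A.Q → Prop
  | refl (h : ∀ ε q, r ≠ snoc q (i, ε)) : Strip i r r
  | step (q : A.Q) (ε : Bool) (h : Strip i r q) : Strip i r (snoc q (i, ε))

end ok

end Sys
end ArtinRD


set_option linter.all false

namespace ArtinRD
namespace Sys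
variable {A : Sys}
open Q

lemma Strip.cases'' {i : A.I} {r q : A.Q} (h : Strip i r q) :
    (r = q ∧ ∀ ε q', q ≠ snoc q' (i, ε)) ∨ ∃ q1 ε, q = snoc q1 (i, ε) ∧ Strip i r q1 := by
  cases h with
  | refl h => exact Or.inl ⟨rfl, h⟩
  | step q ε h => exact Or.inr ⟨q, ε, rfl, h⟩

lemma Strip.len_le {i : A.I} {r q : A.Q} (h : Strip i r q) : r.len ≤ q.len := by
  induction h with
  | refl h => exact le_rfl
  | step q ε h ih => rw [len_snoc]; omega

lemma Strip.len_lt {i : A.I} {r q q' : A.Q} {ε : Bool} (h : Strip i r q) (hq : q = snoc q' (i, ε)) : r.len < q.len := by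
  rcases h.cases'' with ⟨h1, h2⟩ | ⟨q1, ε', h1, h2⟩
  · exact absurd hq (h2 _ _)
  · have := h2.len_le
    rw [h1, len_snoc]; omega

section ok
variable {N : ℕ} (ok : A.Ok N)
include ok

lemma Strip.unique {i : A.I} {r r' q : A.Q} (h : Strip i r q) (h' : Strip i r' q) (hr : Red q) (hl : q.len ≤ N) :
    r = r' := by
  induction h with
  | refl h0 =>
    rcases h'.cases'' with ⟨h1, h2⟩ | ⟨q1, ε', h1, h2⟩
    · exact h1.symm
    · exact absurd h1 (h0 _ _)
  | step q ε h ih =>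
    rcases h'.cases'' with ⟨h1, h2⟩ | ⟨q1, ε', h1, h2⟩
    · exact absurd rfl (h2 ε q)
    · rw [len_snoc] at hl
      obtain ⟨h3, h4⟩ := (kr_of ok hr (by omega) h1).eq rfl
      subst h4
      exact ih h2 (red_snoc ok hr (by omega)).1 (by omega)

lemma dstrip {s : A.S} (c : Bool) (d : A.D s) : ∃ (ρ : A.D s) (u : ℤ), d = ρ * A.e s c ^ u ∧ A.dl ρ ≤ A.dl d ∧
    (∀ ε, A.dl (ρ * A.v s c ε) = A.dl ρ + 1) ∧
    ∀ γ, ND s γ → Red γ → γ.len + A.dl d ≤ N → Strip (A.p s c) (γ.app ρ) (γ.app d) := by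
  induction hn : A.dl d using Nat.strong_induction_on generalizing d with
  | _ n ih =>
  by_cases h : ∃ ε, A.dl (d * A.v s c (!ε)) < A.dl d
  · obtain ⟨ε, h⟩ := h
    obtain ⟨ρ, u, h1, h2, h3, h4⟩ := ih _ (by omega) (d * A.v s c (!ε)) rfl
    refine ⟨ρ, u + (if ε then 1 else -1), ?_, by omega, h3, ?_⟩
    · have := mvv s c ε d
      rw [h1] at this
      rw [← this, zpow_add, mul_assoc]
      cases ε <;> simp
    · intro γ hγ hγ' hl
      rw [app_step' γ d c ε h]
      exact Strip.step _ _ (h4 γ hγ hγ' (by omega))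
  · push Not at h
    refine ⟨d, 0, by simp, by omega, ?_, ?_⟩
    · intro ε
      apply dl_nlt
      have := h (!ε)
      rw [Bool.not_not] at this
      omega
    · intro γ hγ hγ' hl
      apply Strip.refl
      intro ε q hq
      have h1 := (ext_red ok hγ hγ' d (by omega)).2 c (!ε) (by
        apply dl_nlt; have := h ε; omega) q
      simp only [inv', Bool.not_not] at h1
      exact h1 hq

/-- last letter of `ρ` -/
lemma last_of {s : A.S} {c : Bool} {ρ : A.D s} (h1 : ρ ≠ 1) (h : ∀ ε, A.dl (ρ * A.v s c ε) = A.dl ρ + 1) (γ : A.Q) :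
    ∃ q ε, γ.app ρ = snoc q (A.p s (!c), ε) := by
  have h0 : A.dl ρ ≠ 0 := fun h0 => h1 (dl_eq_zero h0)
  obtain ⟨ρ', c', ε, rfl, h2⟩ := dl_desc h0
  have : c ≠ c' := by
    rintro rfl
    have := h (!ε)
    rw [mvv'] at this; omega
  rw [not_eq_bool ok this] at h2 ⊢
  exact ⟨_, _, app_step _ _ _ _ h2⟩

/-- a double element is not `k^v i^u`. -/
lemma dbl_of {s : A.S} {c ε ε' : Bool} {d : A.D s} (h1 : A.dl (d * A.v s c ε) < A.dl d)
    (h2 : A.dl (d * A.v s (!c) ε') < A.dl d) : Dbl (A.e s) d := by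
  intro g
  by_cases hg : g = c
  · subst hg; exact ⟨ε, h1⟩
  · rw [show g = !c by cases g <;> cases c <;> simp_all]; exact ⟨ε', h2⟩

lemma claimR {s : A.S} {c ε : Bool} {γ q q1 q2 : A.Q} {a : A.D s} {y : A.Letter} (hγ : ND s γ) (hγr : Red γ)
    (hr : Red q) (hl : q.len ≤ N) (hq : q = γ.app a) (ha : ∀ u : ℤ, a ≠ A.e s c ^ u)
    (hq1 : q = snoc q1 (A.p s c, ε)) (hq2 : q = snoc q2 y) (hy1 : y.1 ≠ A.p s c) (hy2 : y.1 ≠ A.p s (!c)) : False := by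
  induction hn : q.len using Nat.strong_induction_on generalizing s c ε γ q q1 q2 a y with
  | _ n ih =>
  have hl1 : q1.len < N := by rw [hq1, len_snoc] at hl; omega
  have hl2 : q2.len < N := by rw [hq2, len_snoc] at hl; omega
  have hr' := hr
  rw [hq1] at hr'
  obtain ⟨hr1, hnc1⟩ := red_snoc ok hr' hl1
  obtain ⟨hr2, _, hkr⟩ := ok _ _ _ _ hl1 hr1 hnc1 (hq1.symm.trans hq2)
  rcases hkr with ⟨h1, h2⟩ | ⟨s2, c2, ε2, ε2', γ1, d1, h1, h2, h3, h4, h5, h6⟩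
  · exact hy1 (by rw [← h1])
  obtain ⟨γ2, D, h7, h8, h9, h10, h11, h12⟩ := KR.gate ok hr1 hr2 (by omega) (by omega) h3 h4 h5 h6
  simp only [Prod.mk.injEq] at h1
  obtain ⟨h1, rfl⟩ := h1
  subst h2
  simp only at hy1 hy2
  -- D is longer
  have hqD : q = γ2.app D ∧ A.dl (D * A.v s2 c2 (!ε)) < A.dl D ∧ A.dl (D * A.v s2 (!c2) (!ε2')) < A.dl D := by
    by_cases hlt : A.dl (D * A.v s2 c2 (!ε)) < A.dl D
    · refine ⟨?_, hlt, ?_⟩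
      · rw [hq1, h9, h1]; exact (app_step' γ2 D c2 ε hlt).symm
      · have e1 := congrArg len hq1
        have e2 := congrArg len hq2
        rw [len_snoc] at e1 e2
        have := dl_lt hlt
        omega
    · exfalso
      have h13 := dl_nlt hlt
      have := (app_step γ2 D c2 (!ε) h13)
      rw [← h9] at this
      exact hnc1 _ (by simp only [inv']; rw [h1]; exact this)
  obtain ⟨hqD, hD1, hD2⟩ := hqD
  have hdbl : Dbl (A.e s2) D := dbl_of ok hD1 hD2
  have hlD : γ2.len + A.dl D ≤ N := by rw [← len_app, ← hqD]; exact hl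
  have hla : γ.len + A.dl a ≤ N := by rw [← len_app, ← hq]; exact hl
  obtain ⟨ρ, u, hρ1, hρ2, hρ3, hρ4⟩ := dstrip ok c2 D
  obtain ⟨ρ', u', hρ1', hρ2', hρ3', hρ4'⟩ := dstrip ok c a
  have hs1 := hρ4 γ2 h8 h7 hlD
  have hs2 := hρ4' γ hγ hγr hla
  rw [← hqD, ← h1] at hs1
  rw [← hq] at hs2
  have hroot := Strip.unique ok hs1 hs2 hr hl
  have hρk : ∀ w : ℤ, ρ ≠ A.e s2 (!c2) ^ w := by
    rintro w rfl
    rw [hρ1] at hdbl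
    have := A.dc s2 (!c2) w u
    rw [Bool.not_not] at this
    exact this hdbl
  have hρ'1 : ρ' ≠ 1 := by
    rintro rfl
    rw [one_mul] at hρ1'
    exact ha _ hρ1'
  have hρ1 : ρ ≠ 1 := by
    intro h; exact hρk 0 (by simpa using h)
  obtain ⟨q3, ε3, h30⟩ := last_of ok hρ1 hρ3 γ2
  obtain ⟨q4, ε4, h40⟩ := last_of ok hρ'1 hρ3' γ
  have hlt := hs1.len_lt hq1
  refine ih _ (by rw [← hn]; exact hlt) (s := s2) (c := !c2) (γ := γ2) (a := ρ) h8 h7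
    (ext_red ok h8 h7 ρ (by omega)).1 (by omega) rfl hρk h30 (hroot.trans h40) ?_ ?_ rfl
  · exact fun h => hy2 h.symm
  · rw [Bool.not_not, ← h1]; exact (A.inj s c).symm

lemma not_two {s s2 : A.S} {c c2 ε εx εz : Bool} (hs : s ≠ s2) (hj : A.p s c = A.p s2 c2) {q γ γ2 : A.Q}
    {a : A.D s} {a2 : A.D s2} (hr : Red q) (hl : q.len ≤ N) (hγ : ND s γ) (hγr : Red γ) (hγ2 : ND s2 γ2)
    (hγr2 : Red γ2) (hq : q = γ.app a) (hq2 : q = γ2.app a2)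
    (hd : Dbl (A.e s) (a * A.v s c ε)) (hd2 : Dbl (A.e s2) (a2 * A.v s2 c2 ε)) : False := by
  have hla : γ.len + A.dl a ≤ N := by rw [← len_app, ← hq]; exact hl
  have hla2 : γ2.len + A.dl a2 ≤ N := by rw [← len_app, ← hq2]; exact hl
  obtain ⟨ρ, u, hρ1, hρ2, hρ3, hρ4⟩ := dstrip ok c a
  obtain ⟨ρ', u', hρ1', hρ2', hρ3', hρ4'⟩ := dstrip ok c2 a2
  have hs1 := hρ4 γ hγ hγr hla
  have hs2 := hρ4' γ2 hγ2 hγr2 hla2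
  rw [← hq] at hs1
  rw [← hq2, ← hj] at hs2
  have hroot := Strip.unique ok hs1 hs2 hr hl
  have key : ∀ {s : A.S} {c : Bool} {a ρ : A.D s} {u : ℤ}, a = ρ * A.e s c ^ u →
      Dbl (A.e s) (a * A.v s c ε) → ∀ w : ℤ, ρ ≠ A.e s (!c) ^ w := by
    rintro s c a ρ u rfl hd w rfl
    have h := A.dc s (!c) w (u + (if ε then 1 else -1))
    rw [Bool.not_not, zpow_add, ← mul_assoc] at h
    apply h
    have : A.v s c ε = A.e s c ^ (if ε then (1:ℤ) else -1) := by cases ε <;> simp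
    rw [← this]; exact hd
  have hk1 := key hρ1 hd
  have hk2 := key hρ1' hd2
  obtain ⟨q3, ε3, h30⟩ := last_of ok (fun h => hk1 0 (by simpa using h)) hρ3 γ
  obtain ⟨q4, ε4, h40⟩ := last_of ok (fun h => hk2 0 (by simpa using h)) hρ3' γ2
  refine claimR ok (s := s) (c := !c) hγ hγr (ext_red ok hγ hγr ρ (by omega)).1 (by rw [len_app]; omega) rfl hk1 h30
    (hroot.trans h40) ?_ ?_
  · intro h
    exact hs (A.uniq s s2 c c2 (!c2) hj h.symm)
  · rw [Bool.not_not, hj]; exact (A.inj s2 c2).symm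

/-- KR refined all the way, with reducedness. -/
lemma KR.full {s : A.S} {c ε ε' : Bool} {q q' γ1 : A.Q} {d : A.D s} (hr : Red q) (hr' : Red q')
    (hl : q.len ≤ N) (hll : q.len = q'.len) (hnc : NC q (A.p s c, ε)) 
    (h3 : q = γ1.app (d * A.v s c (!ε))) (h4 : q' = γ1.app (d * A.v s (!c) (!ε')))
    (h5 : A.dl (d * A.v s c (!ε)) < A.dl d) (h6 : A.dl (d * A.v s (!c) (!ε')) < A.dl d) :
    ∃ (γ : A.Q) (d : A.D s), Red γ ∧ ND s γ ∧
    q = γ.app (d * A.v s c (!ε)) ∧ q' = γ.app (d * A.v s (!c) (!ε')) ∧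
    A.dl (d * A.v s c (!ε)) < A.dl d ∧ A.dl (d * A.v s (!c) (!ε')) < A.dl d := by
  obtain ⟨γ2, D, h7, h8, h9, h10, h11, h12⟩ := KR.gate ok hr hr' hl (by omega) h3 h4 h5 h6
  by_cases hlt : A.dl (D * A.v s c (!ε)) < A.dl D
  · refine ⟨γ2, D, h7, h8, h9, h10, hlt, ?_⟩
    have := dl_lt hlt
    omega
  · exfalso
    have h13 := dl_nlt hlt
    have := (app_step γ2 D c (!ε) h13)
    rw [← h9] at this
    exact hnc _ (by simp only [inv']; exact this)

lemma KR.trans {x y z : A.Letter} {q q' q'' : A.Q} (h : KR x q y q') (h' : KR y q' z q'') (hr : Red q) (hr' : Red q')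
    (hr'' : Red q'') (hnc : NC q x) (hnc' : NC q' y) (hl : q.len ≤ N) (hll : q.len = q'.len) (hll' : q'.len = q''.len) :
    KR x q z q'' := by
  rcases h with ⟨rfl, rfl⟩ | ⟨s, c, ε, ε', γ, d, rfl, rfl, h3, h4, h5, h6⟩
  · exact h'
  rcases h' with ⟨rfl, rfl⟩ | ⟨s2, c2, ε2, ε2', γ2, d2, h1, rfl, h3', h4', h5', h6'⟩
  · exact Or.inr ⟨s, c, ε, ε', γ, d, rfl, rfl, h3, h4, h5, h6⟩
  obtain ⟨γ, d, g1, g2, rfl, rfl, g5, g6⟩ := KR.full ok hr hr' hl hll hnc h3 h4 h5 h6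
  simp only [Prod.mk.injEq] at h1
  obtain ⟨h1, rfl⟩ := h1
  rw [h1] at hnc'
  obtain ⟨γ2, d2, f1, f2, f3, rfl, f5, f6⟩ := KR.full ok hr' hr'' (by omega) hll' hnc' h3' h4' h5' h6'
  by_cases hs : s = s2
  · subst hs
    have hc : c2 = !c := by
      by_contra hne
      rw [not_eq_bool ok hne] at h1
      exact A.inj s c2 h1.symm
    subst hc
    obtain ⟨e1, e2⟩ := gate_unique ok g2 f2 hr' (by omega) f3
    subst e1
    have e3 := mul_right_cancel e2
    subst e3
    simp only [Bool.not_not] at f5 f6 ⊢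
    by_cases hε : ε = ε2'
    · subst hε
      exact Or.inl ⟨rfl, rfl⟩
    · exfalso
      have := not_eq_bool ok hε
      rw [this] at f6
      rw [Bool.not_not] at f6
      exact A.db s d c ε f6 g5
  · exfalso
    refine not_two ok (εx := ε) (εz := ε) (ε := ε') hs h1 hr' (by omega) g2 g1 f2 f1 rfl f3 ?_ ?_
    · rw [mvv]; exact dbl_of ok g5 g6
    · rw [mvv]; exact dbl_of ok f5 f6

/-- the move case -/
lemma move_case {s : A.S} {c c' ε ε' : Bool} {γ : A.Q} {d : A.D s} (hl : (γ.app (d * A.v s c (!ε))).len ≤ N)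
    (hr : Red (γ.app (d * A.v s c (!ε)))) (hnc : NC (γ.app (d * A.v s c (!ε))) (A.p s c, ε))
    (h5 : A.dl (d * A.v s c (!ε)) < A.dl d) (h6 : A.dl (d * A.v s c' (!ε')) < A.dl d) :
    Red (γ.app (d * A.v s c' (!ε'))) ∧ NC (γ.app (d * A.v s c' (!ε'))) (A.p s c', ε') := by
  have hγ := red_app ok hr hl
  have hγl : γ.len ≤ N := by rw [len_app] at hl; omega
  obtain ⟨γ0, f, rfl, g1, g2⟩ := gate_exists ok s hγ hγl
  obtain ⟨h7, h8⟩ := add_red ok hr hl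
  rw [h7] at hnc hl
  have h9 : A.dl (f * d) = A.dl (f * (d * A.v s c (!ε))) + 1 := by
    have h10 : A.dl (f * (d * A.v s c (!ε)) * A.v s c ε) = A.dl (f * (d * A.v s c (!ε))) + 1 := by
      apply dl_nlt
      intro hlt
      have := app_step' γ0 (f * (d * A.v s c (!ε))) c (!ε) (by rwa [Bool.not_not])
      exact hnc _ this
    rw [← h10, mul_assoc, mvv]
  have e5 := dl_lt h5
  have e6 := dl_lt h6
  have h10 : A.dl (f * (d * A.v s c' (!ε'))) = A.dl f + A.dl (d * A.v s c' (!ε')) := by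
    have t1 := dl_mul f (d * A.v s c' (!ε'))
    have t2 := dl_mul (f * (d * A.v s c' (!ε'))) (A.v s c' ε')
    have t3 := dl_v_le (A := A) s c' ε'
    rw [mul_assoc, mvv] at t2
    omega
  have h11 : ∀ b : A.D s, A.dl (f * b) = A.dl f + A.dl b → (γ0.app f).app b = γ0.app (f * b) := by
    intro b hb
    induction hn : A.dl b generalizing b with
    | zero => rw [dl_eq_zero hn]; simp [app_one]
    | succ n ih =>
      obtain ⟨b', z, ζ, rfl, h'⟩ := dl_desc (d := b) (by omega)
      have t1 := dl_mul f b'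
      have t2 := dl_mul (f * b') (A.v s z ζ)
      have t3 := dl_v_le (A := A) s z ζ
      rw [mul_assoc] at t2
      rw [app_step _ _ _ _ h', ih b' (by omega) (by omega), ← mul_assoc, app_step]
      rw [mul_assoc]; omega
  rw [h11 _ h10]
  rw [len_app] at hl
  obtain ⟨k1, k2⟩ := ext_red ok g2 g1 (f * (d * A.v s c' (!ε'))) (by omega)
  refine ⟨k1, k2 c' ε' ?_⟩
  rw [mul_assoc, mvv]
  omega

end ok

lemma eqvGen_of_mk {u u' : List A.Letter} (h : Q.mk u = Q.mk u') : Relation.EqvGen Step u u' := Quot.eqvGen_exact h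

lemma ok_zero : A.Ok 0 := fun q x q' y h => absurd h (by omega)

lemma ok_step {N : ℕ} (ok : A.Ok N) {u u' : List A.Letter} (h : Step u u') :
    ∀ x q, u = x :: q → ∃ y q', u' = y :: q' ∧ ((Q.mk q).len ≤ N → Red (Q.mk q) → NC (Q.mk q) x →
      Red (Q.mk q') ∧ NC (Q.mk q') y ∧ KR x (Q.mk q) y (Q.mk q')) := by
  intro x q hu
  cases h with
  | cons x' h =>
    rename_i u1 u1'
    obtain ⟨rfl, rfl⟩ := List.cons.inj hu
    have : Q.mk u1 = Q.mk u1' := Quot.sound h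
    exact ⟨x', u1', rfl, fun _ h1 h2 => this ▸ ⟨h1, h2, Or.inl ⟨rfl, rfl⟩⟩⟩
  | move s w w' u0 h h' he =>
    cases w with
    | nil =>
      have : w' = [] := by
        unfold Geo at h h'
        rw [← he, h] at h'
        exact List.length_eq_zero_iff.1 h'.symm
      subst this
      simp only [List.map_nil, List.nil_append] at hu ⊢
      exact ⟨x, q, hu, fun _ h1 h2 => ⟨h1, h2, Or.inl ⟨rfl, rfl⟩⟩⟩
    | cons a w =>
      cases w' with
      | nil =>
        exfalso
        unfold Geo at h h'
        rw [he, h'] at h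
        simp at h
      | cons a' w' =>
        simp only [List.map_cons, List.cons_append] at hu ⊢
        obtain ⟨rfl, rfl⟩ := List.cons.inj hu
        refine ⟨_, _, rfl, ?_⟩
        have sub : ∀ (b : Bool × Bool) (t : List (Bool × Bool)), Geo s (b :: t) → Geo s t := by
          intro b t hb
          unfold Geo at hb ⊢
          simp only [ev, List.length_cons] at hb
          have := A.par s (ev s t) b.1 b.2
          have h2 : A.dl (ev s t) ≤ t.length := by
            clear hb this
            induction t with
            | nil => simp only [ev]; rw [dl_one]; simp
            | cons b' t ih =>
              simp only [ev, List.length_cons]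
              have := dl_mul (ev s t) (A.v s b'.1 b'.2)
              have := dl_v_le (A := A) s b'.1 b'.2
              omega
          simp only [dl, v] at *
          omega
        have g1 := sub _ _ h
        have g2 := sub _ _ h'
        have e1 : Q.mk (w.map (emb s) ++ u0) = (Q.mk u0).app (ev s (a :: w) * A.v s a.1 (!a.2)) := by
          rw [← appw_mk, appw_eq s g1]; simp only [ev]; rw [mvv']
        have e2 : Q.mk (w'.map (emb s) ++ u0) = (Q.mk u0).app (ev s (a :: w) * A.v s a'.1 (!a'.2)) := by
          rw [← appw_mk, appw_eq s g2, he]; simp only [ev]; rw [mvv']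
        have l1 : A.dl (ev s (a :: w) * A.v s a.1 (!a.2)) < A.dl (ev s (a :: w)) := by
          unfold Geo at h g1
          simp only [ev, List.length_cons] at h ⊢
          rw [mvv', g1, h]; omega
        have l2 : A.dl (ev s (a :: w) * A.v s a'.1 (!a'.2)) < A.dl (ev s (a :: w)) := by
          rw [he]
          unfold Geo at h' g2
          simp only [ev, List.length_cons] at h' ⊢
          rw [mvv', g2, h']; omega
        rw [e1, e2]
        intro hl hr hnc
        obtain ⟨r1, r2⟩ := move_case ok hl hr hnc l1 l2
        refine ⟨r1, r2, ?_⟩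
        obtain ⟨c, ε⟩ := a
        obtain ⟨c', ε'⟩ := a'
        simp only at l1 l2 ⊢
        by_cases hc : c = c'
        · subst hc
          by_cases hε : ε = ε'
          · subst hε
            exact Or.inl ⟨rfl, rfl⟩
          · exfalso
            rw [not_eq_bool ok hε, Bool.not_not] at l2
            exact A.db _ _ _ _ l2 l1
        · rw [not_eq_bool ok hc] at l2 ⊢
          exact Or.inr ⟨s, c, ε, ε', Q.mk u0, _, rfl, rfl, rfl, rfl, l1, l2⟩

lemma Step.symm {u u' : List A.Letter} (h : Step u u') : Step u' u := by
  induction h with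
  | move s w w' u h h' he => exact Step.move s w' w u h' h he.symm
  | cons x h ih => exact Step.cons x ih

lemma ok_succ {N : ℕ} (ok : A.Ok N) : A.Ok (N + 1) := by
  intro q x q' y hl hr hnc he
  induction q using Quot.ind with
  | _ u =>
  induction q' using Quot.ind with
  | _ u' =>
  have hg : Relation.EqvGen Step (x :: u) (y :: u') := eqvGen_of_mk he
  have hg2 : Relation.ReflTransGen Step (x :: u) (y :: u') := by
    clear he hl hr hnc
    generalize x :: u = a at hg
    generalize y :: u' = b at hg
    have : ∀ a b : List A.Letter, Relation.EqvGen Step a b → Relation.ReflTransGen Step a b ∧ Relation.ReflTransGen Step b a := by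
      intro a b h
      induction h with
      | rel a b h => exact ⟨.single h, .single h.symm⟩
      | refl a => exact ⟨.refl, .refl⟩
      | symm a b h ih => exact ⟨ih.2, ih.1⟩
      | trans a b c h1 h2 ih1 ih2 => exact ⟨ih1.1.trans ih2.1, ih2.2.trans ih1.2⟩
    exact (this a b hg).1
  have key : ∀ b, Relation.ReflTransGen Step (x :: u) b → ∃ y q', b = y :: q' ∧ (Q.mk q').len = (Q.mk u).len ∧
      Red (Q.mk q') ∧ NC (Q.mk q') y ∧ KR x (Q.mk u) y (Q.mk q') := by
    intro b hb
    induction hb with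
    | refl => exact ⟨x, u, rfl, rfl, hr, hnc, Or.inl ⟨rfl, rfl⟩⟩
    | tail h1 h2 ih =>
      obtain ⟨y, q', rfl, hlen, hr', hnc', hkr⟩ := ih
      obtain ⟨z, q'', rfl, h3⟩ := ok_step ok h2 y q' rfl
      have hll : (Q.mk u).len ≤ N := by
        have : (Q.mk u).len < N + 1 := hl
        omega
      obtain ⟨r1, r2, r3⟩ := h3 (by omega) hr' hnc'
      have hlen2 : (Q.mk q').len = (Q.mk q'').len := by
        have := h2.length; simp at this; simpa using this
      exact ⟨z, q'', rfl, by omega, r1, r2, KR.trans ok hkr r3 hr hr' r1 hnc hnc' hll hlen.symm hlen2⟩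
  obtain ⟨y', q', h1, _, h3, h4, h5⟩ := key _ hg2
  obtain ⟨rfl, rfl⟩ := List.cons.inj h1
  exact ⟨h3, h4, h5⟩

lemma ok_all (N : ℕ) : A.Ok N := by
  induction N with
  | zero => exact ok_zero
  | succ N ih => exact ok_succ ih

end Sys
end ArtinRD


set_option linter.all false

namespace ArtinRD
namespace Sys
variable {A : Sys}
open Q

lemma red_snoc' {q : A.Q} {x : A.Letter} (h : Red (snoc q x)) : Red q ∧ NC q x :=
  red_snoc (ok_all (q.len + 1)) h (by omega)
lemma kr_of' {q q' : A.Q} {x y : A.Letter} (h : Red (snoc q x)) (he : snoc q x = snoc q' y) : KR x q y q' :=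
  kr_of (ok_all (q.len + 1)) h (by omega) he
lemma red_app' {s : A.S} {q : A.Q} {d : A.D s} (h : Red (q.app d)) : Red q := red_app (ok_all _) h le_rfl
lemma gate_exists' (s : A.S) {q : A.Q} (h : Red q) : ∃ (γ : A.Q) (d : A.D s), q = γ.app d ∧ Red γ ∧ ND s γ :=
  gate_exists (ok_all _) s h le_rfl
lemma gate_unique' {s : A.S} {γ γ' : A.Q} {d d' : A.D s} (h : ND s γ) (h' : ND s γ') (hr : Red (γ.app d))
    (he : γ.app d = γ'.app d') : γ = γ' ∧ d = d' := gate_unique (ok_all _) h h' hr le_rfl he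
lemma ext_red' {s : A.S} {γ : A.Q} (h : ND s γ) (hr : Red γ) (d : A.D s) :
    Red (γ.app d) ∧ ∀ c ε, A.dl (d * A.v s c ε) = A.dl d + 1 → NC (γ.app d) (A.p s c, ε) :=
  ext_red (ok_all _) h hr d le_rfl

open Classical in
noncomputable def mv (q : A.Q) (x : A.Letter) : A.Q :=
  if h : ∃ q'', q = snoc q'' (inv' x) then h.choose else snoc q x

lemma mv_snoc {q : A.Q} {x : A.Letter} (h : Red (snoc q (inv' x))) : mv (snoc q (inv' x)) x = q := by
  have h0 : ∃ q'', snoc q (inv' x) = snoc q'' (inv' x) := ⟨q, rfl⟩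
  unfold mv
  rw [dif_pos h0]
  exact ((kr_of' h h0.choose_spec).eq rfl).2.symm

lemma mv_nc {q : A.Q} {x : A.Letter} (h : NC q x) : mv q x = snoc q x := by
  unfold mv
  rw [dif_neg]
  rintro ⟨q'', h'⟩
  exact h _ h'

lemma mv_cases {q : A.Q} (hq : Red q) (x : A.Letter) :
    (∃ q'', q = snoc q'' (inv' x) ∧ mv q x = q'' ∧ Red q'' ∧ NC q'' (inv' x)) ∨ (NC q x ∧ mv q x = snoc q x) := by
  by_cases h : ∃ q'', q = snoc q'' (inv' x)
  · obtain ⟨q'', rfl⟩ := h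
    exact Or.inl ⟨q'', rfl, mv_snoc hq, red_snoc' hq⟩
  · have : NC q x := fun q'' h' => h ⟨q'', h'⟩
    exact Or.inr ⟨this, mv_nc this⟩

lemma red_mv {q : A.Q} (hq : Red q) (x : A.Letter) : Red (mv q x) := by
  rcases mv_cases hq x with ⟨q'', _, h, h', _⟩ | ⟨h, h'⟩
  · rwa [h]
  · rw [h']; exact Red.snoc _ _ hq h

lemma mv_mv {q : A.Q} (hq : Red q) (x : A.Letter) : mv (mv q x) (inv' x) = q := by
  rcases mv_cases hq x with ⟨q'', h1, h, h', h2⟩ | ⟨h, h'⟩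
  · rw [h, h1, mv_nc h2]
  · rw [h']
    have := mv_snoc (q := q) (x := inv' x) (by rw [inv'_inv']; exact Red.snoc _ _ hq h)
    rwa [inv'_inv'] at this

lemma len_mv {q : A.Q} (hq : Red q) (x : A.Letter) : (mv q x).len = q.len + 1 ∨ (mv q x).len + 1 = q.len := by
  rcases mv_cases hq x with ⟨q'', h1, h, h', h2⟩ | ⟨h, h'⟩
  · right; rw [h, h1, len_snoc]
  · left; rw [h', len_snoc]

lemma mv_lt {q : A.Q} (hq : Red q) {x : A.Letter} (h : (mv q x).len < q.len) : ∃ q'', q = snoc q'' (inv' x) := by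
  rcases mv_cases hq x with ⟨q'', h1, _⟩ | ⟨h0, h'⟩
  · exact ⟨q'', h1⟩
  · rw [h', len_snoc] at h; omega

lemma mv_app {s : A.S} {γ : A.Q} (h : ND s γ) (hr : Red γ) (a : A.D s) (c ε : Bool) :
    mv (γ.app a) (A.p s c, ε) = γ.app (a * A.v s c ε) := by
  by_cases hlt : A.dl (a * A.v s c ε) < A.dl a
  · have h1 := app_step' γ a c (!ε) (by rwa [Bool.not_not])
    rw [Bool.not_not] at h1
    have h2 := (ext_red' h hr a).1
    rw [h1] at h2 ⊢
    exact mv_snoc (x := (A.p s c, ε)) h2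
  · have h1 := dl_nlt hlt
    rw [mv_nc ((ext_red' h hr a).2 c ε h1), app_step _ _ _ _ h1]

variable (A) in
abbrev NN := {q : A.Q // Red q}

section act
variable (s : A.S)
noncomputable def gt (q : A.NN) : A.Q := (gate_exists' s q.2).choose
noncomputable def gd (q : A.NN) : A.D s := (gate_exists' s q.2).choose_spec.choose
lemma gt_spec (q : A.NN) : q.1 = (gt s q).app (gd s q) ∧ Red (gt s q) ∧ ND s (gt s q) :=
  (gate_exists' s q.2).choose_spec.choose_spec
lemma gt_uniq {q : A.NN} {γ : A.Q} {a : A.D s} (h : ND s γ) (he : q.1 = γ.app a) : gt s q = γ ∧ gd s q = a := by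
  obtain ⟨h1, h2, h3⟩ := gt_spec s q
  exact gate_unique' h3 h (by rw [← h1]; exact q.2) (h1.symm.trans he)

@[reducible]
noncomputable def act : MulAction (A.D s) A.NN where
  smul d q := ⟨(gt s q).app (gd s q * d⁻¹), (ext_red' (gt_spec s q).2.2 (gt_spec s q).2.1 _).1⟩
  one_smul q := by
    apply Subtype.ext
    show (gt s q).app (gd s q * 1⁻¹) = q.1
    rw [inv_one, mul_one, ← (gt_spec s q).1]
  mul_smul d d' q := by
    apply Subtype.ext
    set q1 : A.NN := ⟨(gt s q).app (gd s q * d'⁻¹), (ext_red' (gt_spec s q).2.2 (gt_spec s q).2.1 _).1⟩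
    show (gt s q).app (gd s q * (d * d')⁻¹) = (gt s q1).app (gd s q1 * d⁻¹)
    obtain ⟨h1, h2⟩ := gt_uniq s (q := q1) (gt_spec s q).2.2 rfl
    rw [h1, h2, mul_inv_rev, mul_assoc]

noncomputable def psi : A.D s →* Equiv.Perm A.NN := @MulAction.toPermHom (A.D s) A.NN _ (act s)

lemma psi_apply (d : A.D s) (q : A.NN) : (psi s d q).1 = (gt s q).app (gd s q * d⁻¹) := rfl
end act

noncomputable def stp (i : A.I) : Equiv.Perm A.NN where
  toFun q := ⟨mv q.1 (i, false), red_mv q.2 _⟩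
  invFun q := ⟨mv q.1 (i, true), red_mv q.2 _⟩
  left_inv q := Subtype.ext (mv_mv q.2 (i, false))
  right_inv q := Subtype.ext (mv_mv q.2 (i, true))

lemma psi_e (s : A.S) (c : Bool) : psi s (A.e s c) = stp (A.p s c) := by
  ext q
  rw [psi_apply]
  show _ = mv q.1 (A.p s c, false)
  obtain ⟨h1, h2, h3⟩ := gt_spec s q
  rw [h1, mv_app h3 h2]
  obtain ⟨h4, h5⟩ := gt_uniq s (q := q) h3 h1
  simp [v]

/-- realisation of the system in a group -/
structure Rl (A : Sys) (G : Type) [Group G] where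
  X : A.I → G
  φ : ∀ s, A.D s →* G
  hφ : ∀ s c, φ s (A.e s c) = X (A.p s c)
  F : G →* Equiv.Perm A.NN
  hF : ∀ i, F (X i) = stp i
  sg : SymGen {g | ∃ i ε, g = sgn (X i) ε}

namespace Rl
variable {G : Type} [Group G] (B : Rl A G)
abbrev LS : Set G := {g | ∃ i ε, g = sgn (B.X i) ε}
noncomputable abbrev ell (g : G) : ℕ := wordLength B.LS g

noncomputable def cls (g : G) : A.NN := (B.F g)⁻¹ ⟨nil, Red.nil⟩
lemma cls_one : (B.cls 1).1 = nil := by simp [cls]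
lemma cls_mul (g : G) (i : A.I) (ε : Bool) : (B.cls (g * sgn (B.X i) ε)).1 = mv (B.cls g).1 (i, ε) := by
  unfold cls
  rw [map_mul, mul_inv_rev, Equiv.Perm.mul_apply]
  cases ε
  · rw [sgn_false, map_inv, inv_inv, B.hF]; rfl
  · rw [sgn_true, B.hF]; rfl
lemma F_φ (s : A.S) : (B.F.comp (B.φ s)) = psi s := by
  have : Subgroup.closure (dS (A.e s)) = ⊤ := by
    rw [eq_top_iff]
    intro d _
    obtain ⟨w, hw, rfl⟩ := (A.sg s).gen d
    exact Subgroup.list_prod_mem _ (fun a ha => Subgroup.subset_closure (hw a ha))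
  apply MonoidHom.eq_of_eqOn_dense this
  rintro d ⟨c, ε, rfl⟩
  simp only [MonoidHom.comp_apply, map_sgn, B.hφ, B.hF, psi_e]
lemma cls_φ (g : G) (s : A.S) (d : A.D s) : (B.cls (g * B.φ s d)).1 = (gt s (B.cls g)).app (gd s (B.cls g) * d) := by
  have h : B.F (B.φ s d) = psi s d := by rw [← B.F_φ]; rfl
  unfold cls
  rw [map_mul, mul_inv_rev, Equiv.Perm.mul_apply, h, ← map_inv, psi_apply, inv_inv]

def wp : List A.Letter → G
  | [] => 1
  | x :: u => wp u * sgn (B.X x.1) x.2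
lemma wp_emb (s : A.S) (w : List (Bool × Bool)) (u : List A.Letter) :
    B.wp (w.map (emb s) ++ u) = B.wp u * B.φ s (ev s w) := by
  induction w with
  | nil => simp [ev]
  | cons a w ih =>
    simp only [List.map_cons, List.cons_append, wp, ih, ev, map_mul, v, map_sgn, B.hφ, mul_assoc]; rfl
lemma wp_step {u u' : List A.Letter} (h : Step u u') : B.wp u = B.wp u' := by
  induction h with
  | move s w w' u h h' he => rw [wp_emb, wp_emb, he]
  | cons x h ih => simp [wp, ih]
def pr (q : A.Q) : G := Quot.lift B.wp (fun _ _ h => B.wp_step h) q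
lemma pr_nil : B.pr nil = 1 := rfl
lemma pr_snoc (q : A.Q) (x : A.Letter) : B.pr (snoc q x) = B.pr q * sgn (B.X x.1) x.2 := by
  induction q using Quot.ind; rfl
lemma pr_app {s : A.S} (q : A.Q) (d : A.D s) : B.pr (q.app d) = B.pr q * B.φ s d := by
  obtain ⟨w, rfl, hw⟩ := exists_geo s d
  rw [← appw_eq s hw]
  induction q using Quot.ind with
  | _ u =>
  have := appw_mk s w u
  unfold Q.mk at this
  rw [this]
  exact B.wp_emb s w u
lemma pr_mv {q : A.Q} (hq : Red q) (x : A.Letter) : B.pr (mv q x) = B.pr q * sgn (B.X x.1) x.2 := by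
  rcases mv_cases hq x with ⟨q'', h1, h, h', h2⟩ | ⟨h, h'⟩
  · rw [h, h1, pr_snoc]; simp [inv', sgn_not]
  · rw [h', pr_snoc]
lemma pr_cls (g : G) : B.pr (B.cls g).1 = g := by
  obtain ⟨w, hw, rfl⟩ := B.sg.gen g
  induction w using List.reverseRecOn with
  | nil => rw [List.prod_nil, cls_one, pr_nil]
  | append_singleton u x ih =>
    obtain ⟨i, ε, rfl⟩ := hw x (by simp)
    simp only [List.prod_append, List.prod_singleton]
    rw [cls_mul, pr_mv B (B.cls _).2, ih (fun a ha => hw a (by simp [ha]))]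
lemma cls_pr {q : A.Q} (hq : Red q) : (B.cls (B.pr q)).1 = q := by
  induction hq with
  | nil => rw [pr_nil, cls_one]
  | snoc q x h hx ih => rw [pr_snoc, cls_mul, ih, mv_nc hx]
lemma ell_eq (g : G) : B.ell g = (B.cls g).1.len := by
  apply wl_eq_of B.sg (fun g => (B.cls g).1.len)
  · show (B.cls 1).1.len = 0
    rw [cls_one]; rfl
  · rintro g x ⟨i, ε, rfl⟩
    simp only [cls_mul]
    have := len_mv (B.cls g).2 (i, ε)
    omega
  · intro g hg
    rcases cases' (B.cls g).1 with h | ⟨q, x, h⟩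
    · rw [← B.pr_cls g, h, pr_nil]
    · simp only [h, len_snoc] at hg; omega
  · intro g hg
    rcases cases' (B.cls g).1 with h | ⟨q, x, h⟩
    · simp only [h] at hg; exact absurd rfl hg
    · refine ⟨sgn (B.X (inv' x).1) (inv' x).2, ⟨_, _, rfl⟩, ?_⟩
      simp only [cls_mul]
      have h2 : Red (snoc q (inv' (inv' x))) := by rw [inv'_inv', ← h]; exact (B.cls g).2
      have h3 := mv_snoc h2
      rw [inv'_inv'] at h3
      rw [h]
      show (mv (snoc q x) (inv' x)).len < _
      rw [h3, len_snoc]; omega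
lemma ell_φ (s : A.S) (d : A.D s) : B.ell (B.φ s d) = A.dl d := by
  have h := B.cls_φ 1 s d
  rw [one_mul] at h
  have h1 : ND s (nil : A.Q) := fun c ε q => nil_ne_snoc _ _
  obtain ⟨h2, h3⟩ := gt_uniq s (q := B.cls 1) h1 (a := 1) (by rw [cls_one, app_one])
  rw [ell_eq, h, h2, h3, one_mul, len_app, len_nil, zero_add]
lemma par (g : G) (i : A.I) (ε : Bool) : B.ell (g * sgn (B.X i) ε) = B.ell g + 1 ∨
    B.ell (g * sgn (B.X i) ε) + 1 = B.ell g := by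
  rw [ell_eq, ell_eq, cls_mul]; exact len_mv (B.cls g).2 _
lemma ell_lt {g : G} {i : A.I} {ε : Bool} (h : B.ell (g * sgn (B.X i) ε) < B.ell g) :
    ∃ q, (B.cls g).1 = snoc q (i, !ε) := by
  rw [ell_eq, ell_eq, cls_mul] at h
  exact mv_lt (B.cls g).2 h
lemma i3 (g : G) (i : A.I) (ε : Bool) (h : B.ell (g * sgn (B.X i) ε) < B.ell g) :
    ¬ B.ell (g * sgn (B.X i) (!ε)) < B.ell g := by
  intro h'
  obtain ⟨q, hq⟩ := B.ell_lt h
  obtain ⟨q', hq'⟩ := B.ell_lt h'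
  have := (kr_of' (by rw [← hq]; exact (B.cls g).2) (hq.symm.trans hq')).eq rfl
  simp at this
lemma i4 (g : G) (i j : A.I) (ε δ : Bool) (hij : i ≠ j) (h : B.ell (g * sgn (B.X i) ε) < B.ell g)
    (h' : B.ell (g * sgn (B.X j) δ) < B.ell g) : ∃ (s : A.S) (c : Bool) (γ : G) (d : A.D s), A.p s c = i ∧ A.p s (!c) = j ∧
      g = γ * B.φ s d ∧ B.ell g = B.ell γ + A.dl d ∧ A.dl (d * A.v s c ε) < A.dl d ∧ A.dl (d * A.v s (!c) δ) < A.dl d := by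
  obtain ⟨q, hq⟩ := B.ell_lt h
  obtain ⟨q', hq'⟩ := B.ell_lt h'
  have hr : Red (snoc q (i, !ε)) := by rw [← hq]; exact (B.cls g).2
  rcases kr_of' hr (hq.symm.trans hq') with ⟨h1, _⟩ | ⟨s, c, ε1, δ1, γ, d, h1, h2, h3, h4, h5, h6⟩
  · simp only [Prod.mk.injEq] at h1; exact absurd h1.1 hij
  · simp only [Prod.mk.injEq] at h1 h2
    obtain ⟨rfl, rfl⟩ := h1
    obtain ⟨rfl, rfl⟩ := h2
    have h7 : (B.cls g).1 = γ.app d := by rw [hq, h3, ← app_step' γ d c _ h5]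
    have h8 : Red γ := red_app' (d := d) (by rw [← h7]; exact (B.cls g).2)
    refine ⟨s, c, B.pr γ, d, rfl, rfl, ?_, ?_, by simpa using h5, by simpa using h6⟩
    · rw [← B.pr_app, ← h7, B.pr_cls]
    · rw [ell_eq, ell_eq, h7, B.cls_pr h8, len_app]
end Rl

end Sys
end ArtinRD


set_option linter.all false

namespace ArtinRD

/-- all the facts about the Artin group that the geometric part uses -/
structure Art (I : Type) (G : Type) [Group G] where
  X : I → G
  M : I → I → ℕ∞
  ℓ : G → ℕ
  ℓone : ℓ 1 = 0
  ℓzero : ∀ g, ℓ g = 0 → g = 1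
  ℓmul : ∀ g h, ℓ (g * h) ≤ ℓ g + ℓ h
  ℓinv : ∀ g, ℓ g⁻¹ = ℓ g
  ℓX : ∀ i ε, ℓ (sgn (X i) ε) ≤ 1
  desc : ∀ g, ℓ g ≠ 0 → ∃ i ε, ℓ (g * sgn (X i) ε) < ℓ g
  par : ∀ g i ε, ℓ (g * sgn (X i) ε) = ℓ g + 1 ∨ ℓ (g * sgn (X i) ε) + 1 = ℓ g
  i3 : ∀ g i ε, ℓ (g * sgn (X i) ε) < ℓ g → ¬ ℓ (g * sgn (X i) (!ε)) < ℓ g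
  i4 : ∀ g i j ε δ, i ≠ j → ℓ (g * sgn (X i) ε) < ℓ g → ℓ (g * sgn (X j) δ) < ℓ g →
    ∃ γ d, d ∈ Subgroup.closure {X i, X j} ∧ g = γ * d ∧ ℓ g = ℓ γ + ℓ d ∧ ℓ (d * sgn (X i) ε) < ℓ d ∧
      ℓ (d * sgn (X j) δ) < ℓ d
  pdesc : ∀ i j, i ≠ j → ∀ d ∈ Subgroup.closure {X i, X j}, ℓ d ≠ 0 →
    (∃ ε, ℓ (d * sgn (X i) ε) < ℓ d) ∨ (∃ ε, ℓ (d * sgn (X j) ε) < ℓ d)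
  i5 : ∀ i j (a b : ℤ) ε δ, i ≠ j → ℓ (X i ^ a * X j ^ b * sgn (X i) ε) < ℓ (X i ^ a * X j ^ b) →
    ℓ (X i ^ a * X j ^ b * sgn (X j) δ) < ℓ (X i ^ a * X j ^ b) → False
  i6 : ∀ i j (a b c : ℤ) ε δ, i ≠ j → M i j ≠ 3 →
    ℓ (X i ^ a * X j ^ b * X i ^ c * sgn (X i) ε) < ℓ (X i ^ a * X j ^ b * X i ^ c) →
    ℓ (X i ^ a * X j ^ b * X i ^ c * sgn (X j) δ) < ℓ (X i ^ a * X j ^ b * X i ^ c) → False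
  i6' : ∀ i j ε δ, i ≠ j → M i j = ⊤ → ∀ d ∈ Subgroup.closure {X i, X j}, ℓ (d * sgn (X i) ε) < ℓ d →
    ℓ (d * sgn (X j) δ) < ℓ d → False
  i7 : ∀ i j, i ≠ j → ∃ K N : ℕ, ∀ R : ℕ, ∃ C : G → Finset G, (∀ u, (C u).card ≤ K * (R + 1) ^ N) ∧
    ∀ a ∈ Subgroup.closure {X i, X j}, ∀ b ∈ Subgroup.closure {X i, X j}, ℓ a ≤ R → ℓ b ≤ R →
      ∃ c ∈ C a, a⁻¹ * c ∈ C b ∧ c ∈ C (a * b)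

namespace Sys.Rl
variable {A : Sys} {G : Type} [Group G] (B : Rl A G)

lemma range_φ (s : A.S) (c : Bool) : (B.φ s).range = Subgroup.closure {B.X (A.p s c), B.X (A.p s (!c))} := by
  apply le_antisymm
  · rintro _ ⟨d, rfl⟩
    obtain ⟨w, hw, rfl⟩ := (A.sg s).gen d
    rw [map_list_prod]
    apply Subgroup.list_prod_mem
    intro x hx
    obtain ⟨y, hy, rfl⟩ := List.mem_map.1 hx
    obtain ⟨c', ε, rfl⟩ := hw y hy
    have h1 : B.φ s (A.e s c') ∈ Subgroup.closure {B.X (A.p s c), B.X (A.p s (!c))} := by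
      rw [B.hφ]
      apply Subgroup.subset_closure
      cases c <;> cases c' <;> simp
    rw [map_sgn]
    cases ε
    · exact Subgroup.inv_mem _ h1
    · exact h1
  · rw [Subgroup.closure_le]
    rintro x (rfl | rfl)
    · exact ⟨A.e s c, B.hφ s c⟩
    · exact ⟨A.e s (!c), B.hφ s (!c)⟩

lemma ell_φv (s : A.S) (d : A.D s) (c ε : Bool) : B.ell (B.φ s d * sgn (B.X (A.p s c)) ε) = A.dl (d * A.v s c ε) := by
  rw [← B.ell_φ, map_mul, ← B.hφ, ← map_sgn]

lemma φ_inj (s : A.S) : Function.Injective (B.φ s) := by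
  rw [injective_iff_map_eq_one]
  intro d hd
  apply dl_eq_zero
  rw [← B.ell_φ, hd]; exact wl_one

end Sys.Rl

section inst
variable (n : ℕ) (M : Fin n → Fin n → ℕ∞) (hlarge : ∀ i j, i ≠ j → 3 ≤ M i j)

noncomputable def artSys : Sys where
  I := Fin n
  S := {pr : Fin n × Fin n // pr.1 < pr.2}
  p s c := if c then s.1.2 else s.1.1
  D s := Dih (M s.1.1 s.1.2)
  grp s := inferInstance
  e s := dg (M s.1.1 s.1.2)
  inj s c := by
    have := s.2
    cases c <;> simp <;> omega
  uniq s s' c c' d' h1 h2 := by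
    obtain ⟨⟨a, b⟩, h⟩ := s
    obtain ⟨⟨a', b'⟩, h'⟩ := s'
    simp only at h h'
    apply Subtype.ext
    cases c <;> cases c' <;> cases d' <;> simp at h1 h2 ⊢ <;> omega
  sg s := dih_sg _
  par s := (dihFacts _ (hlarge _ _ s.2.ne)).par
  db s := (dihFacts _ (hlarge _ _ s.2.ne)).db
  dc s := (dihFacts _ (hlarge _ _ s.2.ne)).dc

lemma gen_rel (i j : Fin n) (hij : i ≠ j) (k : ℕ) (h : M i j = k) :
    altProd k (gen n M i) (gen n M j) = altProd k (gen n M j) (gen n M i) := by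
  have := PresentedGroup.one_of_mem (rels := artinRels n M) ⟨i, j, hij, k, h, rfl⟩
  rw [map_mul, map_inv, map_altProd, map_altProd, mul_inv_eq_one] at this
  exact this

lemma gen_sg : SymGen {g | ∃ i ε, g = sgn (gen n M i) ε} := by
  apply SymGen.of_closure
  · rintro x ⟨c, ε, rfl⟩
    exact ⟨c, !ε, (sgn_not _ _).symm⟩
  · rw [eq_top_iff, ← PresentedGroup.closure_range_of (artinRels n M)]
    apply Subgroup.closure_mono
    rintro x ⟨c, rfl⟩
    exact ⟨c, true, rfl⟩

lemma genSet_eq : genSet n M = {g | ∃ i ε, g = sgn (gen n M i) ε} := by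
  ext g
  constructor
  · rintro ⟨i, h | h⟩
    · exact ⟨i, true, h⟩
    · exact ⟨i, false, h⟩
  · rintro ⟨i, ε, h⟩
    cases ε
    · exact ⟨i, Or.inr h⟩
    · exact ⟨i, Or.inl h⟩

lemma stp_rel (hsymm : ∀ i j, M i j = M j i) (i j : Fin n) (hij : i ≠ j) (k : ℕ) (h : M i j = k) :
    altProd k (Sys.stp (A := artSys n M hlarge) i) (Sys.stp (A := artSys n M hlarge) j) = altProd k (Sys.stp j) (Sys.stp i) := by
  have key : ∀ i j : Fin n, i < j → M i j = k →
     altProd k (Sys.stp (A := artSys n M hlarge) i) (Sys.stp (A := artSys n M hlarge) j) = altProd k (Sys.stp j) (Sys.stp i) := by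
    intro i j hij h
    have h0 := dg_rel (M i j) k h
    let s : (artSys n M hlarge).S := ⟨(i, j), hij⟩
    let f : Dih (M i j) →* Equiv.Perm (Sys.NN (artSys n M hlarge)) := Sys.psi (A := artSys n M hlarge) s
    have h1 := congrArg f h0
    rw [map_altProd, map_altProd] at h1
    have e1 : f (dg (M i j) false) = Sys.stp i := Sys.psi_e (A := artSys n M hlarge) s false
    have e2 : f (dg (M i j) true) = Sys.stp j := Sys.psi_e (A := artSys n M hlarge) s true
    rw [e1, e2] at h1
    exact h1
  rcases lt_or_gt_of_ne hij with h1 | h1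
  · exact key i j h1 h
  · exact (key j i h1 (by rw [hsymm]; exact h)).symm

lemma exists_rl (hsymm : ∀ i j, M i j = M j i) :
    ∃ B : Sys.Rl (artSys n M hlarge) (ArtinGroup n M), B.X = gen n M := by
  have hφ : ∀ s : (artSys n M hlarge).S, ∃ f : Dih (M s.1.1 s.1.2) →* ArtinGroup n M,
      ∀ c, f (dg _ c) = gen n M ((artSys n M hlarge).p s c) := by
    intro s
    apply dih_lift
    intro k hk
    exact gen_rel n M _ _ s.2.ne k hk
  choose φ hφ using hφ
  have hF : ∃ F : ArtinGroup n M →* Equiv.Perm (Sys.NN (artSys n M hlarge)), ∀ i, F (gen n M i) = Sys.stp (A := artSys n M hlarge) i := by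
    have hr : ∀ r ∈ artinRels n M, FreeGroup.lift (fun i : Fin n => Sys.stp (A := artSys n M hlarge) i) r = 1 := by
      rintro r ⟨i, j, hij, k, hk, rfl⟩
      rw [map_mul, map_inv, map_altProd, map_altProd, mul_inv_eq_one]
      simpa using stp_rel n M hlarge hsymm i j hij k hk
    exact ⟨PresentedGroup.toGroup hr, fun c => PresentedGroup.toGroup.of hr⟩
  obtain ⟨F, hF⟩ := hF
  exact ⟨⟨gen n M, φ, hφ, F, hF, gen_sg n M⟩, rfl⟩

lemma artSys_pair (hsymm : ∀ i j, M i j = M j i) (i j : Fin n) (hij : i ≠ j) :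
    ∃ (s : (artSys n M hlarge).S) (c : Bool), (artSys n M hlarge).p s c = i ∧ (artSys n M hlarge).p s (!c) = j ∧
      M s.1.1 s.1.2 = M i j := by
  rcases lt_or_gt_of_ne hij with h1 | h1
  · exact ⟨⟨(i, j), h1⟩, false, rfl, rfl, rfl⟩
  · exact ⟨⟨(j, i), h1⟩, true, rfl, rfl, hsymm _ _⟩

theorem exists_art (n : ℕ) (M : Fin n → Fin n → ℕ∞) (hlarge : ∀ i j, i ≠ j → 3 ≤ M i j) (hsymm : ∀ i j, M i j = M j i) :
    ∃ T : Art (Fin n) (ArtinGroup n M), T.M = M ∧ T.ℓ = ℓA n M := by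
  obtain ⟨B, hB⟩ := exists_rl n M hlarge hsymm
  have hL : ∀ g, wordLength (genSet n M) g = B.ell g := by
    intro g; rw [genSet_eq, ← hB]; rfl
  have key : ∀ i j : Fin n, i ≠ j → ∃ (s : (artSys n M hlarge).S) (c : Bool), (artSys n M hlarge).p s c = i ∧
      (artSys n M hlarge).p s (!c) = j ∧ M s.1.1 s.1.2 = M i j ∧ (B.φ s).range = Subgroup.closure {B.X i, B.X j} := by
    intro i j hij
    obtain ⟨s, c, h1, h2, h3⟩ := artSys_pair n M hlarge hsymm i j hij
    exact ⟨s, c, h1, h2, h3, by rw [B.range_φ s c, h1, h2]⟩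
  have hf : ∀ s : (artSys n M hlarge).S, DihFacts ((artSys n M hlarge).e s) (M s.1.1 s.1.2) := fun s =>
    dihFacts _ (hlarge _ _ s.2.ne)
  have notdbl : ∀ (s : (artSys n M hlarge).S) (c : Bool) (d : (artSys n M hlarge).D s) (ε δ : Bool),
     ¬ Dbl ((artSys n M hlarge).e s) d → 
     B.ell (B.φ s d * sgn (B.X ((artSys n M hlarge).p s c)) ε) < B.ell (B.φ s d) →
     B.ell (B.φ s d * sgn (B.X ((artSys n M hlarge).p s (!c))) δ) < B.ell (B.φ s d) → False := by
    intro s c d ε δ hd h1 h2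
    rw [B.ell_φv, B.ell_φ] at h1 h2
    exact hd (Sys.dbl_of (Sys.ok_all 0) h1 h2)
  refine ⟨{ X := B.X, M := M, ℓ := B.ell, ℓone := wl_one, ℓzero := fun g h => wl_eq_zero B.sg h, 
            ℓmul := wl_mul B.sg, ℓinv := wl_inv B.sg, ℓX := fun i ε => wl_mem_le ⟨i, ε, rfl⟩
            desc := ?_, par := B.par, i3 := B.i3, i4 := ?_, pdesc := ?_, i5 := ?_, i6 := ?_, i6' := ?_, i7 := ?_ }, rfl, ?_⟩
  · intro g hg
    obtain ⟨x, ⟨i, ε, rfl⟩, h⟩ := wl_desc B.sg (N := B.ell g - 1) (g := g) (by show B.ell g = _; omega)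
    refine ⟨i, ε, ?_⟩
    have : B.ell (g * sgn (B.X i) ε) = B.ell g - 1 := h
    omega
  · intro g i j ε δ hij h1 h2
    obtain ⟨s, c, γ, d, h3, h4, h5, h6, h7, h8⟩ := B.i4 g i j ε δ hij h1 h2
    refine ⟨γ, B.φ s d, ?_, h5, ?_, ?_, ?_⟩
    · rw [← h3, ← h4, ← B.range_φ s c]; exact ⟨d, rfl⟩
    · rw [B.ell_φ]; exact h6
    · rw [← h3, B.ell_φv, B.ell_φ]; exact h7
    · rw [← h4, B.ell_φv, B.ell_φ]; exact h8
  · intro i j hij d hd h0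
    obtain ⟨s, c, h1, h2, h3, h4⟩ := key i j hij
    rw [← h4] at hd
    obtain ⟨d, rfl⟩ := hd
    rw [B.ell_φ] at h0
    obtain ⟨d', c', ε, h5, h6⟩ := Sys.dl_desc h0
    have h7 : B.ell (B.φ s d * sgn (B.X ((artSys n M hlarge).p s c')) (!ε)) < B.ell (B.φ s d) := by
      rw [B.ell_φv, B.ell_φ]
      rw [h5] at h6 ⊢
      rw [Sys.mvv']; omega
    by_cases hc : c' = c
    · subst hc; left; exact ⟨_, h1 ▸ h7⟩
    · right
      have : c' = !c := by cases c <;> cases c' <;> simp_all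
      subst this
      exact ⟨_, h2 ▸ h7⟩
  · intro i j a b ε δ hij h1 h2
    obtain ⟨s, c, rfl, rfl, h3, h4⟩ := key i j hij
    have := notdbl s c (((artSys n M hlarge).e s c) ^ a * ((artSys n M hlarge).e s (!c)) ^ b) ε δ ((hf s).dc c a b)
    simp only [map_mul, map_zpow, B.hφ] at this
    exact this h1 h2
  · intro i j a b c' ε δ hij hM h1 h2
    obtain ⟨s, c, rfl, rfl, h3, h4⟩ := key i j hij
    have := notdbl s c (((artSys n M hlarge).e s c) ^ a * ((artSys n M hlarge).e s (!c)) ^ b * ((artSys n M hlarge).e s c) ^ c') ε δ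
      ((hf s).dd (by rw [h3]; exact hM) c a b c')
    simp only [map_mul, map_zpow, B.hφ] at this
    exact this h1 h2
  · intro i j ε δ hij hM d hd h1 h2
    obtain ⟨s, c, rfl, rfl, h3, h4⟩ := key i j hij
    rw [← h4] at hd
    obtain ⟨d, rfl⟩ := hd
    exact notdbl s c d ε δ ((hf s).dinf (by rw [h3]; exact hM) d) h1 h2
  · intro i j hij
    obtain ⟨s, c, rfl, rfl, h3, h4⟩ := key i j hij
    obtain ⟨K, N, h⟩ := (hf s).cent
    refine ⟨K, N, fun R => ?_⟩
    obtain ⟨C, hC1, hC2⟩ := h R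
    classical
    refine ⟨fun u => (C (Function.invFun (B.φ s) u)).image (B.φ s), fun u => Finset.card_image_le.trans (hC1 _), ?_⟩
    rw [← h4]
    rintro _ ⟨a, rfl⟩ _ ⟨b, rfl⟩ ha hb
    rw [B.ell_φ] at ha hb
    obtain ⟨x, h5, h6, h7⟩ := hC2 a b ha hb
    have hinv := Function.leftInverse_invFun (B.φ_inj s)
    refine ⟨B.φ s x, ?_, ?_, ?_⟩
    · beta_reduce; rw [hinv a]; exact Finset.mem_image_of_mem _ h5
    · beta_reduce; rw [hinv b, ← map_inv, ← map_mul]; exact Finset.mem_image_of_mem _ h6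
    · beta_reduce; rw [← map_mul, hinv]; exact Finset.mem_image_of_mem _ h7
  · funext g; exact (hL g).symm
end inst
end ArtinRD


set_option linter.all false

namespace ArtinRD
namespace Art
variable {I G : Type} [Group G] (T : Art I G)

abbrev x (i : I) (ε : Bool) : G := sgn (T.X i) ε
def D (a b : G) : ℕ := T.ℓ (a⁻¹ * b)
def Z (i : I) : Subgroup G := Subgroup.zpowers (T.X i)
def P (i j : I) : Subgroup G := Subgroup.closure {T.X i, T.X j}
def Ds (b w : G) (i : I) : Prop := ∃ ε, T.D b (w * T.x i ε) < T.D b w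
def IsG (H : Subgroup G) (b p : G) : Prop := ∀ d ∈ H, T.D b (p * d) = T.D b p + T.ℓ d
def Gtd (H : Subgroup G) : Prop := ∀ b w, ∃ p, w⁻¹ * p ∈ H ∧ T.IsG H b p

lemma D_self (a : G) : T.D a a = 0 := by simp [D, T.ℓone]
lemma D_comm (a b : G) : T.D a b = T.D b a := by unfold D; rw [← T.ℓinv]; simp
lemma D_tri (a b c : G) : T.D a c ≤ T.D a b + T.D b c := by
  unfold D; have := T.ℓmul (a⁻¹ * b) (b⁻¹ * c); simpa [mul_assoc] using this
lemma D_left (g a b : G) : T.D (g * a) (g * b) = T.D a b := by unfold D; simp [mul_assoc]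
lemma D_eq {a b : G} (h : T.D a b = 0) : a = b := (inv_mul_eq_one.1 (T.ℓzero _ h))
lemma D_mul (a d : G) : T.D a (a * d) = T.ℓ d := by simp [D]
lemma x_not (i : I) (ε : Bool) : T.x i (!ε) = (T.x i ε)⁻¹ := sgn_not _ _
lemma x_mem_Z (i : I) (ε : Bool) : T.x i ε ∈ T.Z i := by
  cases ε
  · exact Subgroup.inv_mem _ (Subgroup.mem_zpowers _)
  · exact Subgroup.mem_zpowers _
lemma Z_le (i j : I) : T.Z i ≤ T.P i j := by
  unfold Z P; rw [Subgroup.zpowers_le]; exact Subgroup.subset_closure (by simp)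
lemma P_comm (i j : I) : T.P i j = T.P j i := by unfold P; rw [Set.pair_comm]
lemma Z_le' (i j : I) : T.Z j ≤ T.P i j := by rw [T.P_comm]; exact T.Z_le j i
lemma mem_Z {i : I} {g : G} : g ∈ T.Z i ↔ ∃ k : ℤ, T.X i ^ k = g := Subgroup.mem_zpowers_iff
lemma pow_mem_Z (i : I) (k : ℤ) : T.X i ^ k ∈ T.Z i := T.mem_Z.2 ⟨k, rfl⟩

lemma D_par (b w : G) (i : I) (ε : Bool) : T.D b (w * T.x i ε) = T.D b w + 1 ∨ T.D b (w * T.x i ε) + 1 = T.D b w := by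
  unfold D; rw [← mul_assoc]; exact T.par _ _ _
lemma D_i3 {b w : G} {i : I} {ε : Bool} (h : T.D b (w * T.x i ε) < T.D b w) : ¬ T.D b (w * T.x i (!ε)) < T.D b w := by
  unfold D at *; rw [← mul_assoc] at *; exact T.i3 _ _ _ h
lemma D_desc {b w : G} (h : b ≠ w) : ∃ i, T.Ds b w i := by
  have : T.ℓ (b⁻¹ * w) ≠ 0 := fun h0 => h (T.D_eq h0)
  obtain ⟨i, ε, h⟩ := T.desc _ this
  exact ⟨i, ε, by unfold D; rwa [← mul_assoc]⟩
lemma Ds_ne {b w : G} {i : I} (h : T.Ds b w i) : b ≠ w := by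
  rintro rfl
  obtain ⟨ε, h⟩ := h
  rw [T.D_self] at h; omega
lemma Ds_left (g b w : G) (i : I) : T.Ds (g * b) (g * w) i ↔ T.Ds b w i := by
  unfold Ds; simp only [mul_assoc, D_left]
lemma nDs {b w : G} {i : I} (h : ¬ T.Ds b w i) (ε : Bool) : T.D b (w * T.x i ε) = T.D b w + 1 := by
  have := T.D_par b w i ε
  have h2 : ¬ T.D b (w * T.x i ε) < T.D b w := fun h' => h ⟨ε, h'⟩
  omega

/-! ### lines -/
lemma line_up {b w : G} {i : I} {ε : Bool} (h : T.D b (w * T.x i ε) = T.D b w + 1) (k : ℕ) :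
    T.D b (w * T.x i ε ^ k) = T.D b w + k ∧ T.D b (w * T.x i ε ^ (k + 1)) = T.D b w + (k + 1) := by
  induction k with
  | zero => simpa using h
  | succ k ih =>
    refine ⟨ih.2, ?_⟩
    have h1 : T.D b (w * T.x i ε ^ (k + 1) * T.x i (!ε)) < T.D b (w * T.x i ε ^ (k + 1)) := by
      rw [x_not, pow_succ, ← mul_assoc, mul_inv_cancel_right, mul_assoc, ← pow_succ]; omega
    have h2 := T.D_i3 h1
    rw [Bool.not_not, mul_assoc, ← pow_succ] at h2
    have h3 := T.D_par b (w * T.x i ε ^ (k + 1)) i ε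
    rw [mul_assoc, ← pow_succ] at h3
    omega

lemma line {b w : G} {i : I} (h : ¬ T.Ds b w i) (k : ℤ) : T.D b (w * T.X i ^ k) = T.D b w + k.natAbs := by
  obtain ⟨n, rfl | rfl⟩ := k.eq_nat_or_neg
  · have := (T.line_up (T.nDs h true) n).1
    simpa using this
  · have := (T.line_up (T.nDs h false) n).1
    simpa using this

lemma ℓpow (i : I) (k : ℤ) : T.ℓ (T.X i ^ k) = k.natAbs := by
  have := T.line (b := 1) (w := 1) (i := i) (fun h => T.Ds_ne h rfl) k
  rwa [D_self, one_mul, zero_add, D, inv_one, one_mul] at this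

lemma pow_inj {i : I} {k l : ℤ} (h : T.X i ^ k = T.X i ^ l) : k = l := by
  have h1 : T.X i ^ (k - l) = 1 := by rw [zpow_sub, h]; simp
  have := T.ℓpow i (k - l)
  rw [h1, T.ℓone] at this
  omega

lemma ℓx (i : I) (ε : Bool) : T.ℓ (T.x i ε) = 1 := by
  cases ε
  · have := T.ℓpow i (-1); simpa using this
  · have := T.ℓpow i 1; simpa using this

lemma isG_Z {b w : G} {i : I} (h : ¬ T.Ds b w i) : T.IsG (T.Z i) b w := by
  intro d hd
  obtain ⟨k, rfl⟩ := T.mem_Z.1 hd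
  rw [T.line h, T.ℓpow]

lemma IsG.nDs {H : Subgroup G} {b p : G} (h : T.IsG H b p) {i : I} (hi : T.Z i ≤ H) : ¬ T.Ds b p i := by
  rintro ⟨ε, hε⟩
  have := h _ (hi (T.x_mem_Z i ε))
  omega

lemma IsG.mono {H K : Subgroup G} {b p : G} (h : T.IsG H b p) (hK : K ≤ H) : T.IsG K b p := fun d hd => h d (hK hd)

/-- a coset contains a point without descents for the given generators -/
lemma exists_min (H : Subgroup G) (b w : G) : ∃ p, w⁻¹ * p ∈ H ∧ ∀ i, T.Z i ≤ H → ¬ T.Ds b p i := by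
  induction hn : T.D b w using Nat.strong_induction_on generalizing w with
  | _ n ih =>
  by_cases h : ∃ i, T.Z i ≤ H ∧ T.Ds b w i
  · obtain ⟨i, hi, ε, hε⟩ := h
    obtain ⟨p, h1, h2⟩ := ih _ (hn ▸ hε) (w * T.x i ε) rfl
    refine ⟨p, ?_, h2⟩
    have := H.mul_mem (hi (T.x_mem_Z i ε)) h1
    simpa [mul_assoc] using this
  · exact ⟨w, by simp, fun i hi h' => h ⟨i, hi, h'⟩⟩

lemma gZ (i : I) : T.Gtd (T.Z i) := by
  intro b w
  obtain ⟨p, h1, h2⟩ := T.exists_min (T.Z i) b w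
  exact ⟨p, h1, T.isG_Z (h2 i le_rfl)⟩

/-! ### dihedral cosets -/
lemma D_i4 {b w : G} {i j : I} {ε δ : Bool} (hij : i ≠ j) (h1 : T.D b (w * T.x i ε) < T.D b w)
    (h2 : T.D b (w * T.x j δ) < T.D b w) : ∃ γ d, d ∈ T.P i j ∧ w = γ * d ∧ T.D b w = T.D b γ + T.ℓ d ∧
      T.ℓ (d * T.x i ε) < T.ℓ d ∧ T.ℓ (d * T.x j δ) < T.ℓ d ∧ ¬ T.Ds b γ i ∧ ¬ T.Ds b γ j := by
  have h0 : ∃ γ d, d ∈ T.P i j ∧ w = γ * d ∧ T.D b w = T.D b γ + T.ℓ d ∧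
      T.ℓ (d * T.x i ε) < T.ℓ d ∧ T.ℓ (d * T.x j δ) < T.ℓ d := by
    unfold D at *
    rw [← mul_assoc] at h1 h2
    obtain ⟨γ, d, h3, h4, h5, h6⟩ := T.i4 _ i j ε δ hij h1 h2
    refine ⟨b * γ, d, h3, ?_, by simpa using h5, h6⟩
    rw [mul_assoc, ← h4]; simp
  obtain ⟨γ, d, h3, h4, h5, h6, h7⟩ := h0
  clear h1 h2
  induction hn : T.D b γ using Nat.strong_induction_on generalizing γ d with
  | _ n ih =>
  by_cases h : ∃ k, (k = i ∨ k = j) ∧ T.Ds b γ k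
  · obtain ⟨k, hk, η, hη⟩ := h
    have hz : T.x k η ∈ T.P i j := by
      rcases hk with rfl | rfl
      · exact T.Z_le _ _ (T.x_mem_Z _ _)
      · exact T.Z_le' _ _ (T.x_mem_Z _ _)
    have e1 : T.ℓ ((T.x k η)⁻¹ * d) ≤ 1 + T.ℓ d := by
      have := T.ℓmul (T.x k η)⁻¹ d
      rwa [T.ℓinv, T.ℓx] at this
    have e2 := T.D_tri b (γ * T.x k η) (γ * d)
    have e3 : T.D (γ * T.x k η) (γ * d) = T.ℓ ((T.x k η)⁻¹ * d) := by unfold D; congr 1; group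
    have e4 : ∀ l ζ, T.ℓ ((T.x k η)⁻¹ * d * T.x l ζ) ≤ 1 + T.ℓ (d * T.x l ζ) := by
      intro l ζ
      have := T.ℓmul (T.x k η)⁻¹ (d * T.x l ζ)
      rwa [T.ℓinv, T.ℓx, ← mul_assoc] at this
    have e5 := e4 i ε
    have e6 := e4 j δ
    rw [← h4] at e2 e3
    exact ih _ (hn ▸ hη) (γ * T.x k η) ((T.x k η)⁻¹ * d) (Subgroup.mul_mem _ (Subgroup.inv_mem _ hz) h3)
      (by rw [h4]; group) (by omega) (by omega) (by omega) rfl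
  · exact ⟨γ, d, h3, h4, h5, h6, h7, fun h' => h ⟨i, Or.inl rfl, h'⟩, fun h' => h ⟨j, Or.inr rfl, h'⟩⟩

lemma desc_add {b γ d : G} {i : I} {ε : Bool} (h : T.D b (γ * d) = T.D b γ + T.ℓ d) (hx : T.ℓ (d * T.x i ε) < T.ℓ d) :
    T.D b (γ * d * T.x i ε) < T.D b (γ * d) ∧ T.D b (γ * (d * T.x i ε)) = T.D b γ + T.ℓ (d * T.x i ε) ∧
    T.ℓ (d * T.x i ε) + 1 = T.ℓ d := by
  have e1 := T.D_tri b γ (γ * (d * T.x i ε))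
  rw [D_mul] at e1
  have e2 := T.par d i ε
  have e3 := T.D_par b (γ * d) i ε
  rw [← mul_assoc] at e1 ⊢
  omega

lemma pdesc' {i j : I} (hij : i ≠ j) {d : G} (hd : d ∈ T.P i j) (h : d ≠ 1) :
    ∃ k ε, (k = i ∨ k = j) ∧ T.ℓ (d * T.x k ε) < T.ℓ d := by
  rcases T.pdesc i j hij d hd (fun h0 => h (T.ℓzero _ h0)) with ⟨ε, h⟩ | ⟨ε, h⟩
  · exact ⟨i, ε, Or.inl rfl, h⟩
  · exact ⟨j, ε, Or.inr rfl, h⟩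

lemma x_mem_P {i j k : I} (hk : k = i ∨ k = j) (ε : Bool) : T.x k ε ∈ T.P i j := by
  rcases hk with rfl | rfl
  · exact T.Z_le _ _ (T.x_mem_Z _ _)
  · exact T.Z_le' _ _ (T.x_mem_Z _ _)

lemma gate_uniq {i j : I} (hij : i ≠ j) {b γ γ' d d' : G} (h1 : ∀ k, k = i ∨ k = j → ¬ T.Ds b γ k)
    (h2 : ∀ k, k = i ∨ k = j → ¬ T.Ds b γ' k) (hd : d ∈ T.P i j) (hd' : d' ∈ T.P i j)
    (he : γ * d = γ' * d') (ha : T.D b (γ * d) = T.D b γ + T.ℓ d) (ha' : T.D b (γ' * d') = T.D b γ' + T.ℓ d') : γ = γ' := by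
  induction hn : T.D b (γ * d) using Nat.strong_induction_on generalizing γ γ' d d' with
  | _ n ih =>
  by_cases hd1 : d = 1
  · by_cases hd2 : d' = 1
    · subst hd1; subst hd2; simpa using he
    · obtain ⟨k, ε, hk, h⟩ := T.pdesc' hij hd' hd2
      have := (T.desc_add ha' h).1
      rw [← he, hd1, mul_one] at this
      exact absurd ⟨ε, this⟩ (h1 k hk)
  · obtain ⟨k, ε, hk, h⟩ := T.pdesc' hij hd hd1
    obtain ⟨g1, g2, g3⟩ := T.desc_add ha h
    by_cases hd2 : d' = 1
    · rw [he, hd2, mul_one] at g1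
      exact absurd ⟨ε, g1⟩ (h2 k hk)
    · obtain ⟨k', ε', hk', h'⟩ := T.pdesc' hij hd' hd2
      obtain ⟨g1', g2', g3'⟩ := T.desc_add ha' h'
      have hx := T.x_mem_P hk ε
      have hx' := T.x_mem_P hk' ε'
      have e0 := congrArg (T.D b) he
      by_cases hkk : k = k'
      · subst hkk
        have : ε = ε' := by
          by_contra hne
          have hne' : ε' = !ε := by cases ε <;> cases ε' <;> simp_all
          subst hne'
          rw [← he] at g1'
          exact T.D_i3 g1 g1'
        subst this
        exact ih (T.D b (γ * (d * T.x k ε))) (by omega) h1 h2 (mul_mem hd hx) (mul_mem hd' hx')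
          (by rw [← mul_assoc, ← mul_assoc, he]) g2 g2' rfl
      · rw [← he] at g1'
        obtain ⟨γ0, d0, c1, c2, c3, c4, c5, c6, c7⟩ := T.D_i4 hkk g1 g1'
        have hP : T.P k k' = T.P i j := by
          rcases hk with rfl | rfl <;> rcases hk' with rfl | rfl
          · exact absurd rfl hkk
          · rfl
          · exact T.P_comm _ _
          · exact absurd rfl hkk
        have h0 : ∀ l, l = i ∨ l = j → ¬ T.Ds b γ0 l := by
          intro l hl
          rcases hk with rfl | rfl <;> rcases hk' with rfl | rfl <;> rcases hl with rfl | rfl <;> first | assumption | exact absurd rfl hkk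
        rw [hP] at c1
        have c3' := c3
        rw [c2] at c3'
        obtain ⟨b1, b2, b3⟩ := T.desc_add c3' c4
        obtain ⟨b1', b2', b3'⟩ := T.desc_add c3' c5
        have r1 : γ = γ0 := ih (T.D b (γ * (d * T.x k ε))) (by omega) h1 h0 (mul_mem hd hx) (mul_mem c1 hx)
          (by rw [← mul_assoc, ← mul_assoc, c2]) g2 b2 rfl
        have r2 : γ0 = γ' := by
          have e9 : γ0 * (d0 * T.x k' ε') = γ' * (d' * T.x k' ε') := by rw [← mul_assoc, ← mul_assoc, ← c2, he]
          exact ih (T.D b (γ0 * (d0 * T.x k' ε'))) (by rw [e9]; omega) h0 h2 (mul_mem c1 hx') (mul_mem hd' hx') e9 b2' g2' rfl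
        rw [r1, r2]

lemma isG_P {i j : I} (hij : i ≠ j) {b γ : G} (h1 : ¬ T.Ds b γ i) (h2 : ¬ T.Ds b γ j) : T.IsG (T.P i j) b γ := by
  have h12 : ∀ k, k = i ∨ k = j → ¬ T.Ds b γ k := by rintro k (rfl | rfl) <;> assumption
  intro d hd
  induction hn : T.ℓ d using Nat.strong_induction_on generalizing d with
  | _ n ih =>
  by_cases hd1 : d = 1
  · rw [← hn, hd1, mul_one, T.ℓone]; rfl
  obtain ⟨k, ε, hk, h⟩ := T.pdesc' hij hd hd1
  have hx := T.x_mem_P hk ε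
  set d1 := d * T.x k ε with hd1'
  have hdd : d = d1 * T.x k (!ε) := by rw [hd1', x_not]; group
  have p1 := T.par d k ε
  have hd1m : d1 ∈ T.P i j := mul_mem hd hx
  have ih1 := ih (T.ℓ d1) (by omega) d1 hd1m rfl
  have hl : T.ℓ d1 + 1 = T.ℓ d := by simp only [← hd1'] at p1; omega
  rcases T.D_par b (γ * d1) k (!ε) with h3 | h3
  · rw [mul_assoc, ← hdd] at h3; omega
  exfalso
  have h3' : T.D b (γ * d1 * T.x k (!ε)) < T.D b (γ * d1) := by omega
  by_cases hd2 : d1 = 1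
  · rw [hd2, mul_one] at h3'
    exact h12 k hk ⟨_, h3'⟩
  obtain ⟨k', ε', hk', h'⟩ := T.pdesc' hij hd1m hd2
  have h4 := (T.desc_add ih1 h').1
  by_cases hkk : k = k'
  · subst hkk
    by_cases hε : ε' = ε
    · subst hε; exact T.D_i3 h4 h3'
    · have hε' : ε' = !ε := by
        clear * - hε
        cases ε <;> cases ε' <;> simp_all
      subst hε'
      rw [← hdd] at h'; omega
  · obtain ⟨γ0, d0, c1, c2, c3, c4, c5, c6, c7⟩ := T.D_i4 hkk h3' h4
    have hP : T.P k k' = T.P i j := by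
      rcases hk with rfl | rfl <;> rcases hk' with rfl | rfl
      · exact absurd rfl hkk
      · rfl
      · exact T.P_comm _ _
      · exact absurd rfl hkk
    have h0 : ∀ l, l = i ∨ l = j → ¬ T.Ds b γ0 l := by
      intro l hl
      rcases hk with rfl | rfl <;> rcases hk' with rfl | rfl <;> rcases hl with rfl | rfl <;> first | assumption | exact absurd rfl hkk
    rw [hP] at c1
    have : γ = γ0 := T.gate_uniq hij h12 h0 hd1m c1 c2 ih1 (by rw [← c2]; exact c3)
    subst this
    have : d1 = d0 := mul_left_cancel c2
    subst this
    rw [← hdd] at c4; omega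

lemma gP {i j : I} (hij : i ≠ j) : T.Gtd (T.P i j) := by
  intro b w
  obtain ⟨p, h1, h2⟩ := T.exists_min (T.P i j) b w
  exact ⟨p, h1, T.isG_P hij (h2 i (T.Z_le _ _)) (h2 j (T.Z_le' _ _))⟩

end Art
end ArtinRD


set_option linter.all false

namespace ArtinRD
namespace Art
variable {I G : Type} [Group G] (T : Art I G)

open Classical in
noncomputable def prj (H : Subgroup G) (b w : G) : G :=
  if h : ∃ p, w⁻¹ * p ∈ H ∧ T.IsG H b p then h.choose else w

variable {H : Subgroup G}

lemma prj_spec (hH : T.Gtd H) (b w : G) : w⁻¹ * T.prj H b w ∈ H ∧ T.IsG H b (T.prj H b w) := by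
  unfold prj
  rw [dif_pos (hH b w)]
  exact (hH b w).choose_spec

lemma IsG.D {b p w : G} (h : T.IsG H b p) (hw : p⁻¹ * w ∈ H) : T.D b w = T.D b p + T.D p w := by
  have := h _ hw
  rw [mul_inv_cancel_left] at this
  exact this

lemma mem_symm {a b : G} (h : a⁻¹ * b ∈ H) : b⁻¹ * a ∈ H := by
  have := H.inv_mem h
  simpa using this

lemma mem_trans {a b c : G} (h : a⁻¹ * b ∈ H) (h' : b⁻¹ * c ∈ H) : a⁻¹ * c ∈ H := by
  have := H.mul_mem h h'
  simpa [mul_assoc] using this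

lemma IsG.uniq {b p q : G} (h : T.IsG H b p) (h' : T.IsG H b q) (hpq : p⁻¹ * q ∈ H) : p = q := by
  have h1 := IsG.D T h hpq
  have h2 := IsG.D T h' (mem_symm hpq)
  exact T.D_eq (by omega)

lemma isG_self (b : G) : T.IsG H b b := by
  intro d hd
  rw [D_mul, D_self, zero_add]

lemma IsG.left {b p : G} (h : T.IsG H b p) (g : G) : T.IsG H (g * b) (g * p) := by
  intro d hd
  rw [mul_assoc, D_left, D_left]; exact h d hd

lemma prj_eq {b w p : G} (h : w⁻¹ * p ∈ H) (hp : T.IsG H b p) : T.prj H b w = p := by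
  have hex : ∃ p, w⁻¹ * p ∈ H ∧ T.IsG H b p := ⟨p, h, hp⟩
  unfold prj
  rw [dif_pos hex]
  exact IsG.uniq T hex.choose_spec.2 hp (mem_trans (mem_symm hex.choose_spec.1) h)

lemma prj_congr (hH : T.Gtd H) {b w w' : G} (h : w⁻¹ * w' ∈ H) : T.prj H b w = T.prj H b w' := by
  have := T.prj_spec hH b w'
  exact T.prj_eq (mem_trans h this.1) this.2

lemma prj_left (hH : T.Gtd H) (g b w : G) : T.prj H (g * b) (g * w) = g * T.prj H b w := by
  have := T.prj_spec hH b w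
  exact T.prj_eq (by simpa [mul_assoc] using this.1) (IsG.left T this.2 g)

lemma prj_self {b w : G} (h : w⁻¹ * b ∈ H) : T.prj H b w = b := T.prj_eq h (T.isG_self b)

lemma IsG.Ds {b p w : G} (h : T.IsG H b p) (hw : p⁻¹ * w ∈ H) {i : I} (hi : T.Z i ≤ H) : T.Ds b w i ↔ T.Ds p w i := by
  have h1 := IsG.D T h hw
  have h2 : ∀ ε, T.D b (w * T.x i ε) = T.D b p + T.D p (w * T.x i ε) := fun ε =>
    IsG.D T h (by rw [← mul_assoc]; exact H.mul_mem hw (hi (T.x_mem_Z i ε)))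
  unfold Art.Ds
  simp only [h1, h2, Nat.add_lt_add_iff_left]

/-- projections are Lipschitz -/
lemma lip {b e p q : G} (hp : T.IsG H b p) (hq : T.IsG H e q) (h : p⁻¹ * q ∈ H) : T.D p q ≤ T.D b e := by
  have h1 := IsG.D T hp h
  have h2 := IsG.D T hq (mem_symm h)
  have h3 := T.D_tri b e q
  have h4 := T.D_tri e b p
  have h5 := T.D_comm p q
  have h6 := T.D_comm e b
  omega

lemma L5 {b e p q : G} (hp : T.IsG H b p) (hq : T.IsG H e q) (h : p⁻¹ * q ∈ H) (hbe : T.D b e ≤ 1) (hne : p ≠ q) :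
    T.D p q = 1 ∧ T.D e q = T.D b p ∧ T.D e p = T.D b p + 1 ∧ T.D b q = T.D b p + 1 := by
  have h0 : T.D p q ≠ 0 := fun h => hne (T.D_eq h)
  have h1 := IsG.D T hp h
  have h2 := IsG.D T hq (mem_symm h)
  have h3 := T.D_tri b e q
  have h4 := T.D_tri e b p
  have h5 := T.D_comm p q
  have h6 := T.D_comm e b
  omega

lemma one_P {i j : I} (hij : i ≠ j) {p q : G} (h : p⁻¹ * q ∈ T.P i j) (h1 : T.D p q = 1) :
    ∃ k ε, (k = i ∨ k = j) ∧ q = p * T.x k ε := by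
  obtain ⟨k, ε, hk, hl⟩ := T.pdesc' hij h (by intro h0; unfold D at h1; rw [h0, T.ℓone] at h1; omega)
  refine ⟨k, !ε, hk, ?_⟩
  have : T.ℓ (p⁻¹ * q * T.x k ε) = 0 := by unfold D at h1; omega
  have := T.ℓzero _ this
  rw [T.x_not, eq_mul_inv_iff_mul_eq]
  rw [mul_assoc] at this
  exact (inv_mul_eq_one.1 this).symm

lemma one_Z {i : I} {p q : G} (h : p⁻¹ * q ∈ T.Z i) (h1 : T.D p q = 1) :
    ∃ ε, q = p * T.x i ε := by
  obtain ⟨k, hk⟩ := T.mem_Z.1 h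
  have : k.natAbs = 1 := by rw [← T.ℓpow i k, hk]; exact h1
  rcases Int.natAbs_eq k with h2 | h2 <;> rw [this] at h2
  · refine ⟨true, ?_⟩
    show q = p * T.X i
    rw [h2] at hk; simp at hk; rw [hk]; group
  · refine ⟨false, ?_⟩
    show q = p * (T.X i)⁻¹
    rw [h2] at hk; simp at hk; rw [hk]; group

/-! ### dihedral helpers -/
lemma line_Ds {b w : G} {j : I} (h : ¬ T.Ds b w j) {k : ℤ} (hk : k ≠ 0) : T.Ds b (w * T.X j ^ k) j := by
  have e0 := T.line h k
  by_cases h0 : 0 < k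
  · refine ⟨false, ?_⟩
    have e1 := T.line h (k - 1)
    have : w * T.X j ^ k * T.x j false = w * T.X j ^ (k - 1) := by
      rw [zpow_sub_one, mul_assoc]; rfl
    rw [this]; omega
  · refine ⟨true, ?_⟩
    have e1 := T.line h (k + 1)
    have : w * T.X j ^ k * T.x j true = w * T.X j ^ (k + 1) := by
      rw [zpow_add_one, mul_assoc]; rfl
    rw [this]; omega

lemma pow_Ds {p : G} {j : I} {k : ℤ} (hk : k ≠ 0) : T.Ds p (p * T.X j ^ k) j :=
  T.line_Ds (fun h => T.Ds_ne h rfl) hk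

lemma d5 {i j : I} (hij : i ≠ j) {p : G} {s b : ℤ} (h1 : T.Ds p (p * (T.X i ^ s * T.X j ^ b)) i)
    (h2 : T.Ds p (p * (T.X i ^ s * T.X j ^ b)) j) : False := by
  obtain ⟨ε, h1⟩ := h1
  obtain ⟨δ, h2⟩ := h2
  rw [mul_assoc, T.D_mul, T.D_mul] at h1 h2
  exact T.i5 i j s b ε δ hij h1 h2

lemma pow_nDs {j k : I} (hjk : j ≠ k) (p : G) (b : ℤ) : ¬ T.Ds p (p * T.X k ^ b) j := by
  intro h
  by_cases hb : b = 0
  · subst hb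
    rw [zpow_zero, mul_one] at h
    exact T.Ds_ne h rfl
  · refine T.d5 hjk (p := p) (s := 0) (b := b) ?_ ?_
    · simpa using h
    · have := T.pow_Ds (p := p) (j := k) hb
      simpa using this

lemma two_len {i j : I} (hij : i ≠ j) (p : G) (s b : ℤ) : T.D p (p * (T.X i ^ s * T.X j ^ b)) = s.natAbs + b.natAbs := by
  rw [← mul_assoc, T.line (T.pow_nDs hij.symm p s), T.D_mul, T.ℓpow]

lemma two_Ds {i j : I} (hij : i ≠ j) (p : G) (s : ℤ) {b : ℤ} (hb : b ≠ 0) : T.Ds p (p * (T.X i ^ s * T.X j ^ b)) j := by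
  rw [← mul_assoc]; exact T.line_Ds (T.pow_nDs hij.symm p s) hb

lemma two_nDs {i j : I} (hij : i ≠ j) (p : G) (s : ℤ) {b : ℤ} (hb : b ≠ 0) : ¬ T.Ds p (p * (T.X i ^ s * T.X j ^ b)) i :=
  fun h => T.d5 hij h (T.two_Ds hij p s hb)

lemma Z_inter {i j : I} (hij : i ≠ j) {s b : ℤ} (h : T.X i ^ s = T.X j ^ b) : s = 0 ∧ b = 0 := by
  have := T.two_len hij 1 s (-b)
  rw [h, ← zpow_add, add_neg_cancel, zpow_zero, mul_one, T.D_self] at this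
  omega

lemma Sw {i j : I} (hij : i ≠ j) {s b c d : ℤ} (hs : s ≠ 0) (hb : b ≠ 0) (h : T.X i ^ s * T.X j ^ b = T.X j ^ c * T.X i ^ d) : False := by
  by_cases hd : d = 0
  · subst hd
    rw [zpow_zero, mul_one, ← eq_mul_inv_iff_mul_eq, ← zpow_neg, ← zpow_add] at h
    exact hs (T.Z_inter hij h).1
  · have h1 := T.two_nDs hij 1 s hb
    rw [h] at h1
    exact h1 (T.two_Ds hij.symm 1 c hd)

lemma P_Ds {i j : I} (hij : i ≠ j) {p w : G} (h : p⁻¹ * w ∈ T.P i j) (hne : p ≠ w) : T.Ds p w i ∨ T.Ds p w j := by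
  obtain ⟨k, ε, hk, h⟩ := T.pdesc' hij h (fun h => hne (inv_mul_eq_one.1 h))
  have : T.Ds p w k := ⟨ε, by unfold D; rwa [← mul_assoc]⟩
  rcases hk with rfl | rfl
  · exact Or.inl this
  · exact Or.inr this

/-! ### Claim R -/
lemma prj_Z_facts {b w : G} {i : I} (h : T.Ds b w i) : ∃ s : ℤ, s ≠ 0 ∧ w = T.prj (T.Z i) b w * T.X i ^ s ∧
    ¬ T.Ds b (T.prj (T.Z i) b w) i ∧ T.D b w = T.D b (T.prj (T.Z i) b w) + s.natAbs := by
  obtain ⟨h1, h2⟩ := T.prj_spec (T.gZ i) b w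
  obtain ⟨s, hs⟩ := T.mem_Z.1 (mem_symm h1)
  have hn := IsG.nDs T h2 le_rfl
  have hw : w = T.prj (T.Z i) b w * T.X i ^ s := by rw [hs]; group
  refine ⟨s, ?_, hw, hn, ?_⟩
  · rintro rfl
    rw [zpow_zero, mul_one] at hw
    rw [← hw] at hn
    exact hn h
  · have := T.line hn s
    rwa [← hw] at this

theorem claimR {b w p : G} {i j k : I} (hij : i ≠ j) (hik : i ≠ k) (hjk : j ≠ k) (hi : T.Ds b w i) (hk : T.Ds b w k)
    (hp : T.IsG (T.P i j) b p) (hpw : p⁻¹ * w ∈ T.P i j) (hz : p⁻¹ * w ∉ T.Z i) : False := by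
  induction hn : T.D b w using Nat.strong_induction_on generalizing w p i j k with
  | _ n ih =>
  obtain ⟨s, hs, hw, hnd, hD⟩ := T.prj_Z_facts hi
  set w1 := T.prj (T.Z i) b w
  obtain ⟨g1, g2⟩ := T.prj_spec (T.gP hik) b w
  set γ := T.prj (T.P i k) b w
  have zw : w⁻¹ * w1 ∈ T.Z i := by
    apply mem_symm; rw [hw, inv_mul_cancel_left]; exact T.pow_mem_Z _ _
  have g1' := mem_symm g1
  have gw1 : γ⁻¹ * w1 ∈ T.P i k := mem_trans g1' (T.Z_le _ _ zw)
  have pw1 : p⁻¹ * w1 ∈ T.P i j := mem_trans hpw (T.Z_le _ _ zw)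
  have e1 : γ⁻¹ * w1 ∉ T.Z k := by
    intro h
    obtain ⟨c, hc⟩ := T.mem_Z.1 h
    have : w = γ * (T.X k ^ c * T.X i ^ s) := by rw [hc, hw]; group
    rw [IsG.Ds T g2 g1' (T.Z_le _ _)] at hi
    rw [IsG.Ds T g2 g1' (T.Z_le' _ _)] at hk
    rw [this] at hi hk
    exact T.d5 hik.symm hk hi
  have e2 : γ ≠ w1 := by rintro h; apply e1; rw [h, inv_mul_cancel]; exact one_mem _
  have e3 : p ≠ w1 := by rintro h; apply hz; rw [h]; exact mem_symm zw
  have k1 : T.Ds b w1 k := by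
    rcases T.P_Ds hik gw1 e2 with h | h
    · exact absurd ((IsG.Ds T g2 gw1 (T.Z_le _ _)).2 h) hnd
    · exact (IsG.Ds T g2 gw1 (T.Z_le' _ _)).2 h
  have j1 : T.Ds b w1 j := by
    rcases T.P_Ds hij pw1 e3 with h | h
    · exact absurd ((IsG.Ds T hp pw1 (T.Z_le _ _)).2 h) hnd
    · exact (IsG.Ds T hp pw1 (T.Z_le' _ _)).2 h
  exact ih (T.D b w1) (by omega) hik.symm hjk.symm hij k1 j1 (by rw [T.P_comm]; exact g2)
    (by rw [T.P_comm]; exact gw1) e1 rfl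

lemma E1 {b w p : G} {i j k : I} (hij : i ≠ j) (hik : i ≠ k) (hjk : j ≠ k) (hp : T.IsG (T.P i j) b p) (hpw : p⁻¹ * w ∈ T.P i j)
    (hz : p⁻¹ * w ∉ T.Z i) (hz' : p⁻¹ * w ∉ T.Z j) (hk : T.Ds b w k) : False := by
  have hne : p ≠ w := by rintro rfl; apply hz; simp
  rcases T.P_Ds hij hpw hne with h | h
  · exact T.claimR hij hik hjk ((IsG.Ds T hp hpw (T.Z_le _ _)).2 h) hk hp hpw hz
  · exact T.claimR hij.symm hjk hik ((IsG.Ds T hp hpw (T.Z_le' _ _)).2 h) hk (by rwa [T.P_comm]) (by rwa [T.P_comm]) hz'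

lemma double_nZ {p w : G} {i j : I} (hij : i ≠ j) (hi : T.Ds p w i) (hj : T.Ds p w j) : p⁻¹ * w ∉ T.Z i := by
  intro h
  obtain ⟨c, hc⟩ := T.mem_Z.1 h
  have : w = p * T.X i ^ c := by rw [hc]; group
  rw [this] at hj
  exact T.pow_nDs hij.symm p c hj

lemma E2 {b w : G} {i j k : I} (hij : i ≠ j) (hik : i ≠ k) (hjk : j ≠ k) (hi : T.Ds b w i) (hj : T.Ds b w j) (hk : T.Ds b w k) : False := by
  obtain ⟨g1, g2⟩ := T.prj_spec (T.gP hij) b w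
  have g1' := mem_symm g1
  refine T.claimR hij hik hjk hi hk g2 g1' ?_
  exact T.double_nZ hij ((IsG.Ds T g2 g1' (T.Z_le _ _)).1 hi) ((IsG.Ds T g2 g1' (T.Z_le' _ _)).1 hj)

end Art
end ArtinRD


set_option linter.all false

namespace ArtinRD
namespace Art
variable {I G : Type} [Group G] (T : Art I G)

def Crs (v v' w : G) (j : I) : Prop := ¬ T.Ds v w j ∧ ∃ ε, ¬ T.Ds v' (w * T.x j ε) j

lemma x_ne (w : G) (j : I) (ε : Bool) : w * T.x j ε ≠ w := by
  intro h
  have h1 := T.D_mul w (T.x j ε)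
  rw [h, T.D_self, T.ℓx] at h1
  omega

lemma mul_x_mem (w : G) (j : I) (ε : Bool) : w⁻¹ * (w * T.x j ε) ∈ T.Z j := by
  rw [inv_mul_cancel_left]; exact T.x_mem_Z j ε

lemma not_both {v' w : G} {j : I} {ε : Bool} (h : ¬ T.Ds v' (w * T.x j ε) j) : T.Ds v' w j := by
  by_contra h'
  have := IsG.uniq T (T.isG_Z h') (T.isG_Z h) (T.mul_x_mem w j ε)
  exact T.x_ne w j ε this.symm

theorem Up {v v' w : G} {j : I} (hvv : T.D v v' ≤ 1) (hc : T.Crs v v' w j) (hne : v ≠ w) :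
    ∃ k, k ≠ j ∧ T.Ds v w k ∧ (∀ l, T.Ds v w l → l = k) ∧
      (T.prj (T.P j k) v w)⁻¹ * w ∉ T.Z j ∧ (T.prj (T.P j k) v w)⁻¹ * w ∉ T.Z k ∧
      ∃ j1, (j1 = j ∨ j1 = k) ∧ T.Crs v v' (T.prj (T.P j k) v w) j1 ∧ ¬ T.Ds w (T.prj (T.P j k) v w) j1 := by
  obtain ⟨h1, ε, h2⟩ := hc
  have h2' := T.not_both h2
  obtain ⟨k, hk⟩ := T.D_desc hne
  have hkj : k ≠ j := by rintro rfl; exact h1 hk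
  obtain ⟨g1, g2⟩ := T.prj_spec (T.gP hkj.symm) v w
  obtain ⟨g1', g2'⟩ := T.prj_spec (T.gP hkj.symm) v' w
  set w1 := T.prj (T.P j k) v w with hw1
  set w1' := T.prj (T.P j k) v' w with hw1'
  have L1 := T.L5 (T.isG_Z h1) (T.isG_Z h2) (T.mul_x_mem w j ε) hvv (T.x_ne w j ε).symm
  have hm := mem_symm g1
  have hm' := mem_symm g1'
  have hmy : w⁻¹ * (w * T.x j ε) ∈ T.P j k := T.Z_le _ _ (T.mul_x_mem w j ε)
  have a1 := (IsG.Ds T g2 hm (T.Z_le j k)).not.1 h1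
  have a2 := (IsG.Ds T g2' hm' (T.Z_le j k)).1 h2'
  have hne' : w1 ≠ w1' := by rintro h; rw [← h] at a2; exact a1 a2
  have hww : w1⁻¹ * w1' ∈ T.P j k := mem_trans hm g1'
  have L2 := T.L5 g2 g2' hww hvv hne'
  obtain ⟨j1, η, hj1, he⟩ := T.one_P hkj.symm hww L2.1
  have hkw := (IsG.Ds T g2 hm (T.Z_le' j k)).1 hk
  have nj : w1⁻¹ * w ∉ T.Z j := by
    intro h
    obtain ⟨c, hc⟩ := T.mem_Z.1 h
    have hw : w = w1 * T.X j ^ c := by rw [hc]; group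
    rw [hw] at hkw
    exact T.pow_nDs hkj w1 c hkw
  have nk : w1⁻¹ * w ∉ T.Z k := by
    intro h
    obtain ⟨c, hc⟩ := T.mem_Z.1 h
    have hw : w = w1 * T.X k ^ c := by rw [hc]; group
    have hc0 : c ≠ 0 := by
      rintro rfl
      apply nj; rw [hw]; simp
    rcases hj1 with rfl | rfl
    · have : ∃ s : ℤ, w = w1' * (T.X j1 ^ s * T.X k ^ c) := by
        cases η
        · exact ⟨1, by rw [he, hw]; simp [Art.x, sgn]⟩
        · exact ⟨-1, by rw [he, hw]; simp [Art.x, sgn]⟩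
      obtain ⟨s, hs⟩ := this
      rw [hs] at a2
      exact T.two_nDs hkj.symm w1' s hc0 a2
    · have : ∃ s : ℤ, w = w1' * (T.X j1 ^ s) := by
        obtain ⟨s, hs⟩ := T.mem_Z.1 (mem_trans (mem_symm (T.mul_x_mem w1 j1 η)) h)
        exact ⟨s, by rw [he, hs]; group⟩
      obtain ⟨s, hs⟩ := this
      rw [hs] at a2
      exact T.pow_nDs hkj.symm w1' s a2
  refine ⟨k, hkj, hk, ?_, nj, nk, j1, hj1, ⟨?_, η, ?_⟩, ?_⟩
  · intro l hl
    by_contra hlk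
    have hlj : l ≠ j := by rintro rfl; exact h1 hl
    exact T.E1 hkj.symm hlj.symm (Ne.symm hlk) g2 hm nj nk hl
  · rcases hj1 with rfl | rfl
    · exact IsG.nDs T g2 (T.Z_le _ _)
    · exact IsG.nDs T g2 (T.Z_le' _ _)
  · rw [← he]
    rcases hj1 with rfl | rfl
    · exact IsG.nDs T g2' (T.Z_le _ _)
    · exact IsG.nDs T g2' (T.Z_le' _ _)
  · rintro ⟨δ, hδ⟩
    rw [← hw1] at hδ
    have q1 := IsG.D T g2 hm
    have q2 := IsG.D T g2 (mem_trans hm hmy)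
    have q3 := IsG.D T g2' hm'
    have q4 := IsG.D T g2' (mem_trans hm' hmy)
    have c1 := T.D_comm w w1
    have c2 := T.D_comm w w1'
    have c3 := T.D_comm (w * T.x j ε) w1
    have c4 := T.D_comm (w * T.x j ε) w1'
    have hδη : δ = !η := by
      by_contra hcon
      have : δ = η := by
        clear * - hcon
        cases δ <;> cases η <;> simp_all
      rw [this, ← he] at hδ
      omega
    have t1 := T.D_tri (w * T.x j ε) w (w1 * T.x j1 δ)
    have t2 : T.D (w * T.x j ε) w = 1 := by rw [T.D_comm, T.D_mul, T.ℓx]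
    have r1 : T.D (w * T.x j ε) (w1 * T.x j1 η) < T.D (w * T.x j ε) w1 := by rw [← he]; omega
    have r2 := T.D_i3 r1
    rw [← hδη] at r2
    omega

/-- the class J of crossings -/
def InJ (b v v' w : G) (j : I) : Prop :=
  T.Crs v v' w j ∧ ¬ T.Ds b w j ∧ ∀ l, T.Ds b w l → ¬ T.Ds v w l

open Classical in
noncomputable def dn (b v : G) (q : G × I) : G × I :=
  let a : I := if h : ∃ a, T.Ds b q.1 a then h.choose else q.2
  let w := T.prj (T.P a q.2) b q.1
  (w, if T.Ds v w a then q.2 else a)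

open Classical in
theorem J_step {b v v' w : G} {j : I} (hvv : T.D v v' ≤ 1) (hJ : T.InJ b v v' w j) (hne : v ≠ w) :
    ∃ k j1 w1, k ≠ j ∧ w1⁻¹ * w ∈ T.P j k ∧ T.IsG (T.P j k) b w ∧ T.InJ b v v' w1 j1 ∧
      T.D b w < T.D b w1 ∧ T.D v w1 < T.D v w ∧ T.dn b v (w1, j1) = (w, j) := by
  obtain ⟨k, hkj, hk, hu, nj, nk, j1, hj1, hc, hn⟩ := T.Up hvv hJ.1 hne
  obtain ⟨g1, g2⟩ := T.prj_spec (T.gP hkj.symm) v w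
  set w1 := T.prj (T.P j k) v w with hw1
  have hbk : ¬ T.Ds b w k := fun h => hJ.2.2 k h hk
  have hG := T.isG_P hkj.symm hJ.2.1 hbk
  have hww : w1 ≠ w := by rintro h; apply nj; rw [h]; simp
  have ex : ∃ a, a ≠ j1 ∧ (a = j ∧ j1 = k ∨ a = k ∧ j1 = j) := by
    rcases hj1 with h | h
    · exact ⟨k, by rw [h]; exact hkj, Or.inr ⟨rfl, h⟩⟩
    · exact ⟨j, by rw [h]; exact hkj.symm, Or.inl ⟨rfl, h⟩⟩
  obtain ⟨a, haj, ha⟩ := ex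
  have hPa : T.P a j1 = T.P j k := by
    rcases ha with ⟨rfl, rfl⟩ | ⟨rfl, rfl⟩
    · rfl
    · exact T.P_comm _ _
  have hZa : T.Z a ≤ T.P j k := by rw [← hPa]; exact T.Z_le _ _
  have hZj : T.Z j1 ≤ T.P j k := by rw [← hPa]; exact T.Z_le' _ _
  have hnb : ¬ T.Ds b w1 j1 := (IsG.Ds T hG g1 hZj).not.2 hn
  have hab : T.Ds b w1 a := by
    rcases T.P_Ds haj (by rw [hPa]; exact g1) hww.symm with h | h
    · exact (IsG.Ds T hG g1 hZa).2 h
    · exact absurd h hn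
  have hun : ∀ l, T.Ds b w1 l → l = a := by
    intro l hl
    by_contra hla
    have hlj1 : l ≠ j1 := by rintro rfl; exact hnb hl
    have : l ≠ j ∧ l ≠ k := by
      rcases ha with ⟨rfl, rfl⟩ | ⟨rfl, rfl⟩
      · exact ⟨hla, hlj1⟩
      · exact ⟨hlj1, hla⟩
    exact T.E1 hkj.symm this.1.symm this.2.symm hG g1 (fun h => nj (mem_symm h)) (fun h => nk (mem_symm h)) hl
  have pos : T.D w w1 ≠ 0 := fun h => hww (T.D_eq h).symm
  have d1 := IsG.D T hG g1
  have d2 := IsG.D T g2 (mem_symm g1)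
  have d3 := T.D_comm w w1
  refine ⟨k, j1, w1, hkj, mem_symm g1, hG, ⟨hc, hnb, ?_⟩, by omega, by omega, ?_⟩
  · intro l hl
    rw [hun l hl]
    exact IsG.nDs T g2 hZa
  · have hex : ∃ a, T.Ds b w1 a := ⟨a, hab⟩
    have e1 : (if h : ∃ a, T.Ds b w1 a then h.choose else j1) = a := by
      rw [dif_pos hex]; exact hun _ hex.choose_spec
    have e2 : T.prj (T.P a j1) b w1 = w := by
      rw [hPa]; exact T.prj_eq (mem_symm g1) hG
    unfold dn
    simp only [e1, e2]
    congr 1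
    split_ifs with h
    · have := hu a h
      rcases ha with ⟨h3, h4⟩ | ⟨h3, h4⟩
      · exact absurd (this.symm.trans h3) hkj
      · exact h4
    · rcases ha with ⟨h3, h4⟩ | ⟨h3, h4⟩
      · exact h3
      · rw [h3] at h; exact absurd hk h

theorem J_seq {b v v' w : G} {j : I} (hvv : T.D v v' ≤ 1) (hJ : T.InJ b v v' w j) (hne : v ≠ w) :
    ∃ a c j0, a ≠ c ∧ ∃ t : ℕ, t + T.D b w ≤ T.D b v ∧ (T.dn b v)^[t] (T.prj (T.P a c) b v, j0) = (w, j) := by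
  induction hn : T.D v w using Nat.strong_induction_on generalizing w j with
  | _ n ih =>
  obtain ⟨k, j1, w1, hkj, hm, hG, hJ1, hd1, hd2, he⟩ := T.J_step hvv hJ hne
  by_cases h : v = w1
  · subst h
    refine ⟨j, k, j, hkj.symm, 0, by omega, ?_⟩
    rw [T.prj_eq hm hG]; rfl
  · obtain ⟨a, c, j0, hac, t, ht, hq⟩ := ih (T.D v w1) (by omega) hJ1 h rfl
    refine ⟨a, c, j0, hac, t + 1, by omega, ?_⟩
    rw [Function.iterate_succ_apply', hq, he]

variable [Fintype I]

open Classical in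
noncomputable def Jset (R : ℕ) (b v : G) : Finset G :=
  insert v ((Finset.range (R + 1) ×ˢ (Finset.univ : Finset (I × I × I))).image
    (fun s => ((T.dn b v)^[s.1] (T.prj (T.P s.2.1 s.2.2.1) b v, s.2.2.2)).1))

open Classical in
lemma Jset_card (R : ℕ) (b v : G) : (T.Jset R b v).card ≤ 1 + (R + 1) * Fintype.card (I × I × I) := by
  unfold Jset
  refine (Finset.card_insert_le _ _).trans ?_
  rw [add_comm]
  gcongr
  refine Finset.card_image_le.trans ?_
  rw [Finset.card_product, Finset.card_range, Finset.card_univ]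

open Classical in
lemma J_mem {R : ℕ} {b v v' w : G} {j : I} (hvv : T.D v v' ≤ 1) (hJ : T.InJ b v v' w j) (hR : T.D b v ≤ R) :
    w ∈ T.Jset R b v := by
  unfold Jset
  by_cases h : v = w
  · rw [h]; exact Finset.mem_insert_self _ _
  · obtain ⟨a, c, j0, hac, t, ht, hq⟩ := T.J_seq hvv hJ h
    apply Finset.mem_insert_of_mem
    rw [Finset.mem_image]
    refine ⟨(t, a, c, j0), ?_, ?_⟩
    · simp; omega
    · simp [hq]

end Art
end ArtinRD


set_option linter.all false

namespace ArtinRD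
namespace Art
variable {I G : Type} [Group G] (T : Art I G)

lemma exists_path (b e : G) : ∃ f : ℕ → G, f 0 = b ∧ f (T.D b e) = e ∧ ∀ t, T.D (f t) (f (t + 1)) ≤ 1 := by
  induction hn : T.D b e using Nat.strong_induction_on generalizing e with
  | _ n ih =>
  by_cases h : b = e
  · subst h
    exact ⟨fun _ => b, rfl, rfl, fun t => by simp [T.D_self]⟩
  · obtain ⟨i, ε, hi⟩ := T.D_desc h
    obtain ⟨f, h0, h1, h2⟩ := ih _ (hn ▸ hi) _ rfl
    have hp := T.D_par b e i ε
    refine ⟨fun t => if t < n then f t else e, ?_, by simp, ?_⟩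
    · have : 0 < n := by omega
      simp [this, h0]
    · intro t
      by_cases a1 : t + 1 < n
      · have a2 : t < n := by omega
        simp only [a1, a2, if_true]; exact h2 t
      · by_cases a2 : t < n
        · have a3 : t = T.D b (e * T.x i ε) := by omega
          simp only [a1, a2, if_true, if_false]
          rw [a3, h1, T.D_comm, T.D_mul, T.ℓx]
        · simp only [a1, a2, if_false]
          rw [T.D_self]; omega

noncomputable def pth (b e : G) : ℕ → G := (T.exists_path b e).choose
lemma pth_zero (b e : G) : T.pth b e 0 = b := (T.exists_path b e).choose_spec.1
lemma pth_end (b e : G) : T.pth b e (T.D b e) = e := (T.exists_path b e).choose_spec.2.1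
lemma pth_step (b e : G) (t : ℕ) : T.D (T.pth b e t) (T.pth b e (t + 1)) ≤ 1 := (T.exists_path b e).choose_spec.2.2 t
lemma pth_D (b e : G) (t : ℕ) : T.D b (T.pth b e t) ≤ t := by
  induction t with
  | zero => rw [pth_zero, D_self]
  | succ t ih =>
    have h1 := T.D_tri b (T.pth b e t) (T.pth b e (t + 1))
    have h2 := T.pth_step b e t
    omega

def Two (i j : I) (g : G) : Prop := ∃ a b : ℤ, g = T.X i ^ a * T.X j ^ b

section
variable [Fintype I]

open Classical in
noncomputable def Q (N : ℕ) (b e : G) : Finset G :=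
  (Finset.range (N + 1)).biUnion (fun t => T.Jset N b (T.pth b e t))

open Classical in
lemma Q_card (N : ℕ) (b e : G) : (T.Q N b e).card ≤ (N + 1) * (1 + (N + 1) * Fintype.card (I × I × I)) := by
  unfold Q
  refine Finset.card_biUnion_le.trans ?_
  refine (Finset.sum_le_card_nsmul _ _ _ (fun t _ => T.Jset_card N b _)).trans ?_
  simp

open Classical in
lemma Q_mem {N : ℕ} {b e w : G} {t : ℕ} {j : I} (ht : t ≤ N) (hJ : T.InJ b (T.pth b e t) (T.pth b e (t + 1)) w j) :
    w ∈ T.Q N b e := by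
  unfold Q
  rw [Finset.mem_biUnion]
  exact ⟨t, by simp; omega, T.J_mem (T.pth_step b e t) hJ ((T.pth_D b e t).trans ht)⟩
end

lemma two_nZ {i j : I} (hij : i ≠ j) {a b : ℤ} (ha : a ≠ 0) (hb : b ≠ 0) :
    T.X i ^ a * T.X j ^ b ∉ T.Z i ∧ T.X i ^ a * T.X j ^ b ∉ T.Z j := by
  constructor
  · intro h
    obtain ⟨c, hc⟩ := T.mem_Z.1 h
    have : T.X j ^ b = T.X i ^ (c - a) := by
      rw [sub_eq_neg_add, zpow_add, hc]; simp
    exact hb (T.Z_inter hij.symm this).1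
  · intro h
    obtain ⟨c, hc⟩ := T.mem_Z.1 h
    have : T.X i ^ a = T.X j ^ (c - b) := by
      rw [zpow_sub, hc]; group
    exact ha (T.Z_inter hij this).1

lemma V3_step {i j : I} (hij : i ≠ j) {b v v' p w0 q : G} (hvv : T.D v v' ≤ 1) (hp : T.IsG (T.P i j) b p)
    (hw : T.IsG (T.P i j) v w0) (hq : T.IsG (T.P i j) v' q) (m1 : p⁻¹ * w0 ∈ T.P i j) (m2 : w0⁻¹ * q ∈ T.P i j)
    (h2 : T.Two i j (p⁻¹ * w0)) (hn : ¬ T.Two i j (p⁻¹ * q)) (hn' : ¬ T.Two j i (p⁻¹ * q)) : T.InJ b v v' w0 i := by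
  obtain ⟨a, c, h2⟩ := h2
  have hne : w0 ≠ q := by rintro rfl; exact hn ⟨a, c, h2⟩
  have L := T.L5 hw hq m2 hvv hne
  obtain ⟨k, ε, hk, he⟩ := T.one_P hij m2 L.1
  obtain ⟨s, hs⟩ := T.mem_Z.1 (T.x_mem_Z k ε)
  have hpq : p⁻¹ * q = T.X i ^ a * T.X j ^ c * T.X k ^ s := by rw [he, hs, ← h2]; group
  have hki : k = i := by
    rcases hk with rfl | rfl
    · rfl
    · exfalso; apply hn
      exact ⟨a, c + s, by rw [hpq, zpow_add, mul_assoc]⟩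
  subst hki
  have hc : c ≠ 0 := by
    rintro rfl
    apply hn
    exact ⟨a + s, 0, by rw [hpq]; simp [zpow_add]⟩
  have ha : a ≠ 0 := by
    rintro rfl
    apply hn'
    exact ⟨c, s, by rw [hpq]; simp⟩
  obtain ⟨z1, z2⟩ := T.two_nZ hij ha hc
  rw [← h2] at z1 z2
  have hw0 : w0 = p * (T.X k ^ a * T.X j ^ c) := by rw [← h2]; group
  have hni : ¬ T.Ds b w0 k := by
    rw [IsG.Ds T hp m1 (T.Z_le _ _), hw0]
    exact T.two_nDs hij p a hc
  refine ⟨⟨IsG.nDs T hw (T.Z_le _ _), ε, ?_⟩, hni, ?_⟩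
  · rw [← he]; exact IsG.nDs T hq (T.Z_le _ _)
  · intro l hl
    by_cases hlj : l = j
    · rw [hlj]; exact IsG.nDs T hw (T.Z_le' _ _)
    · exfalso
      have hlk : l ≠ k := by rintro rfl; exact hni hl
      exact T.E1 hij hlk.symm (Ne.symm hlj) hp m1 z1 z2 hl

variable [Fintype I]

/-- a coset in which some path point projects to a non-two-syllable position contains a point of Q -/
theorem V3t {i j : I} (hij : i ≠ j) {N : ℕ} {b e w : G} (t : ℕ) (ht : t ≤ N)
    (h1 : ¬ T.Two i j ((T.prj (T.P i j) b w)⁻¹ * T.prj (T.P i j) (T.pth b e t) w))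
    (h2 : ¬ T.Two j i ((T.prj (T.P i j) b w)⁻¹ * T.prj (T.P i j) (T.pth b e t) w)) :
    ∃ z ∈ T.Q N b e, w⁻¹ * z ∈ T.P i j := by
  induction t with
  | zero =>
    exfalso; apply h1
    rw [pth_zero]
    exact ⟨0, 0, by simp⟩
  | succ t ih =>
    set p := T.prj (T.P i j) b w with hp
    set q := T.prj (T.P i j) (T.pth b e t) w with hq
    have sp := T.prj_spec (T.gP hij) b w
    have sq := T.prj_spec (T.gP hij) (T.pth b e t) w
    have sq' := T.prj_spec (T.gP hij) (T.pth b e (t + 1)) w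
    rw [← hp] at sp
    rw [← hq] at sq
    by_cases a1 : T.Two i j (p⁻¹ * q)
    · have := T.V3_step hij (T.pth_step b e t) sp.2 sq.2 sq'.2 (mem_trans (mem_symm sp.1) sq.1)
        (mem_trans (mem_symm sq.1) sq'.1) a1 h1 h2
      exact ⟨q, T.Q_mem (by omega) this, sq.1⟩
    · by_cases a2 : T.Two j i (p⁻¹ * q)
      · have := T.V3_step hij.symm (T.pth_step b e t) (by rw [T.P_comm]; exact sp.2) (by rw [T.P_comm]; exact sq.2)
          (by rw [T.P_comm]; exact sq'.2) (by rw [T.P_comm]; exact mem_trans (mem_symm sp.1) sq.1)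
          (by rw [T.P_comm]; exact mem_trans (mem_symm sq.1) sq'.1) a2 h2 h1
        exact ⟨q, T.Q_mem (by omega) this, sq.1⟩
      · exact ih (by omega) a1 a2

theorem V3 {i j : I} (hij : i ≠ j) {N : ℕ} {b e w p q : G} (hN : T.D b e ≤ N)
    (hp : T.IsG (T.P i j) b p) (hq : T.IsG (T.P i j) e q) (mp : w⁻¹ * p ∈ T.P i j) (mq : w⁻¹ * q ∈ T.P i j)
    (h1 : ¬ T.Two i j (p⁻¹ * q)) (h2 : ¬ T.Two j i (p⁻¹ * q)) : ∃ z ∈ T.Q N b e, w⁻¹ * z ∈ T.P i j := by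
  have e1 := T.prj_eq mp hp
  have e2 := T.prj_eq mq hq
  refine T.V3t hij (T.D b e) hN ?_ ?_ <;> rw [T.pth_end, e1, e2] <;> assumption

theorem lemA {i j : I} (hij : i ≠ j) {N : ℕ} {b e w p q : G} {s t : ℤ} (hN : T.D b e ≤ N)
    (hp : T.IsG (T.P i j) b p) (hq : T.IsG (T.P i j) e q) (hs : s ≠ 0) (ht : t ≠ 0) (hw : w = p * T.X i ^ s)
    (hqw : q = w * T.X j ^ t) :
    (∃ z ∈ T.Q N b e, w⁻¹ * z ∈ T.P i j) ∨ (∃ k, k ≠ i ∧ k ≠ j ∧ T.Ds b w k) := by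
  have mp : w⁻¹ * p ∈ T.P i j := by
    apply mem_symm; rw [hw, inv_mul_cancel_left]; exact T.Z_le _ _ (T.pow_mem_Z _ _)
  have mq : w⁻¹ * q ∈ T.P i j := by
    rw [hqw, inv_mul_cancel_left]; exact T.Z_le' _ _ (T.pow_mem_Z _ _)
  have e1 := T.prj_eq mp hp
  have e2 := T.prj_eq mq hq
  by_cases hV : ∃ z ∈ T.Q N b e, w⁻¹ * z ∈ T.P i j
  · exact Or.inl hV
  right
  let f : ℕ → G := fun t => T.prj (T.P i j) (T.pth b e t) w
  have hf : ∀ t, w⁻¹ * f t ∈ T.P i j ∧ T.IsG (T.P i j) (T.pth b e t) (f t) := fun t => T.prj_spec (T.gP hij) _ _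
  have hTwo : ∀ t, t ≤ N → T.Two i j (p⁻¹ * f t) ∨ T.Two j i (p⁻¹ * f t) := by
    intro t ht
    by_contra hc
    push Not at hc
    apply hV
    refine T.V3t hij t ht ?_ ?_ <;> rw [e1]
    · exact hc.1
    · exact hc.2
  have f0 : f 0 = p := by show T.prj _ _ _ = _; rw [T.pth_zero, e1]
  have fe : f (T.D b e) = q := by show T.prj _ _ _ = _; rw [T.pth_end, e2]
  -- crossing time
  have hex : ∃ n, ∃ c : ℤ, c ≠ 0 ∧ f n = w * T.X j ^ c := ⟨T.D b e, t, ht, by rw [fe, hqw]⟩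
  classical
  obtain ⟨c, hc0, hc⟩ := Nat.find_spec hex
  have hmin := fun m => Nat.find_min hex (m := m)
  have hle : Nat.find hex ≤ T.D b e := Nat.find_min' hex ⟨t, ht, by rw [fe, hqw]⟩
  generalize hn : Nat.find hex = n at *
  have hpos : n ≠ 0 := by
    rintro rfl
    rw [f0] at hc
    have := T.two_len hij p s c
    rw [← mul_assoc, ← hw, ← hc, T.D_self] at this
    omega
  obtain ⟨m, rfl⟩ := Nat.exists_eq_succ_of_ne_zero hpos
  have hm := hmin m (Nat.lt_succ_self m)
  have hne : f m ≠ f (m + 1) := by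
    intro h
    exact hm ⟨c, hc0, by rw [h]; exact hc⟩
  have mm : (f (m + 1))⁻¹ * f m ∈ T.P i j := mem_trans (mem_symm (hf (m + 1)).1) (hf m).1
  have L := T.L5 (hf m).2 (hf (m + 1)).2 (mem_symm mm) (T.pth_step b e m) hne
  obtain ⟨k, ε, hk, he⟩ := T.one_P hij mm (by rw [T.D_comm]; exact L.1)
  obtain ⟨r, hr⟩ := T.mem_Z.1 (T.x_mem_Z k ε)
  have hr0 : r ≠ 0 := by
    rintro rfl
    rw [zpow_zero] at hr
    rw [← hr, mul_one] at he
    exact hne he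
  have hfm : f m = w * T.X j ^ c * T.X k ^ r := by rw [he, hr, ← hc]
  have hkj : k = j := by
    rcases hk with rfl | rfl
    · exfalso
      have hpf : p⁻¹ * f m = T.X k ^ s * T.X j ^ c * T.X k ^ r := by rw [hfm, hw]; group
      rcases hTwo m (by omega) with ⟨u, v, h⟩ | ⟨u, v, h⟩
      · rw [hpf] at h
        by_cases hsu : s = u
        · subst hsu
          rw [mul_assoc] at h
          have h3 := mul_left_cancel h
          have h4 : T.X k ^ r = T.X j ^ (v - c) := by
            rw [sub_eq_neg_add, zpow_add, ← h3]; simp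
          exact hr0 (T.Z_inter hij h4).1
        · have h4 : T.X k ^ (s - u) * T.X j ^ c = T.X j ^ v * T.X k ^ (-r) := by
            have h5 : T.X k ^ (-u) * (T.X k ^ s * T.X j ^ c * T.X k ^ r) * T.X k ^ (-r) = T.X k ^ (-u) * (T.X k ^ u * T.X j ^ v) * T.X k ^ (-r) := by rw [h]
            have h6 : T.X k ^ (s - u) * T.X j ^ c = T.X k ^ (-u) * (T.X k ^ s * T.X j ^ c * T.X k ^ r) * T.X k ^ (-r) := by group
            rw [h6, h5]; group
          exact T.Sw hij (by omega) hc0 h4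
      · rw [hpf] at h
        have h4 : T.X k ^ s * T.X j ^ c = T.X j ^ u * T.X k ^ (v - r) := by
          have h5 : T.X k ^ s * T.X j ^ c = T.X j ^ u * T.X k ^ v * T.X k ^ (-r) := by rw [← h]; group
          rw [h5]; group
        exact T.Sw hij hs hc0 h4
    · rfl
  subst hkj
  have hcr : c + r = 0 := by
    by_contra hcr
    exact hm ⟨c + r, hcr, by rw [hfm, zpow_add, mul_assoc]⟩
  have hfw : f m = w := by rw [hfm, mul_assoc, ← zpow_add, hcr, zpow_zero, mul_one]
  have hG := (hf m).2
  rw [hfw] at hG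
  by_cases hex2 : ∃ l, T.Ds b w l ∧ T.Ds (T.pth b e m) w l
  · obtain ⟨l, hl1, hl2⟩ := hex2
    refine ⟨l, ?_, ?_, hl1⟩
    · rintro rfl; exact IsG.nDs T hG (T.Z_le _ _) hl2
    · rintro rfl; exact IsG.nDs T hG (T.Z_le' _ _) hl2
  · exfalso
    apply hV
    refine ⟨w, T.Q_mem (t := m) (j := k) (by omega) ⟨⟨IsG.nDs T hG (T.Z_le' _ _), !ε, ?_⟩, ?_, ?_⟩, by simp⟩
    · rw [T.x_not]
      have : w * (T.x k ε)⁻¹ = f (m + 1) := by rw [← hfw, he]; group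
      rw [this]
      exact IsG.nDs T (hf (m + 1)).2 (T.Z_le' _ _)
    · rw [IsG.Ds T hp (mem_symm mp) (T.Z_le' _ _), hw]
      exact T.pow_nDs hij.symm p s
    · intro l h1 h2
      exact hex2 ⟨l, h1, h2⟩

end Art
end ArtinRD


set_option linter.all false

namespace ArtinRD
namespace Art
variable {I G : Type} [Group G] (T : Art I G) [Fintype I]

lemma d6 {i k : I} (hki : k ≠ i) (hM : T.M k i ≠ 3) {p : G} {α β r : ℤ}
    (h1 : T.Ds p (p * (T.X k ^ α * T.X i ^ β * T.X k ^ r)) k)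
    (h2 : T.Ds p (p * (T.X k ^ α * T.X i ^ β * T.X k ^ r)) i) : False := by
  obtain ⟨ε, h1⟩ := h1
  obtain ⟨δ, h2⟩ := h2
  rw [mul_assoc p, T.D_mul, T.D_mul] at h1 h2
  exact T.i6 k i α β r ε δ hki hM h1 h2

lemma double_not_two {p w : G} {i j : I} (hij : i ≠ j) (hi : T.Ds p w i) (hj : T.Ds p w j) : ¬ T.Two i j (p⁻¹ * w) := by
  rintro ⟨a, b, h⟩
  have : w = p * (T.X i ^ a * T.X j ^ b) := by rw [← h]; group
  rw [this] at hi hj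
  exact T.d5 hij hi hj

theorem lemB {i j k : I} (hij : i ≠ j) (hik : i ≠ k) (hjk : j ≠ k) {N : ℕ} {b e w : G} (hN : T.D b e ≤ N)
    (bi : T.Ds b w i) (bk : T.Ds b w k) (ej : T.Ds e w j) (ek : T.Ds e w k) :
    ∃ vs, ∃ r : ℤ, T.IsG (T.P i k) e vs ∧ w = vs * T.X k ^ r ∧ r.natAbs ≤ T.D e w ∧ (∀ l, T.Ds e vs l → l = j) ∧
      ((∃ z ∈ T.Q N b e, w⁻¹ * z ∈ T.P i k) ∨
        (T.M k i = 3 ∧ ∃ p, ∃ α β : ℤ, T.IsG (T.P i k) b p ∧ α ≠ 0 ∧ β ≠ 0 ∧ vs = p * (T.X k ^ α * T.X i ^ β))) := by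
  obtain ⟨v1, v2⟩ := T.prj_spec (T.gP hik) e w
  set vs := T.prj (T.P i k) e w
  have v1' := mem_symm v1
  have hz : vs⁻¹ * w ∈ T.Z k := by
    by_contra hz
    exact T.claimR hik.symm hjk.symm hij ek ej (by rw [T.P_comm]; exact v2) (by rw [T.P_comm]; exact v1') hz
  obtain ⟨r, hr⟩ := T.mem_Z.1 hz
  have hw : w = vs * T.X k ^ r := by rw [hr]; group
  have hl : r.natAbs ≤ T.D e w := by
    have := IsG.D T v2 v1'
    rw [← T.ℓpow k r, hr]
    unfold D at *
    omega
  have nk : ¬ T.Ds e vs k := IsG.nDs T v2 (T.Z_le' _ _)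
  refine ⟨vs, r, v2, hw, hl, ?_, ?_⟩
  · intro l hl
    by_contra hlj
    have hlk : l ≠ k := by rintro rfl; exact nk hl
    obtain ⟨g1, g2⟩ := T.prj_spec (T.gP hjk) e w
    set γ := T.prj (T.P j k) e w
    have g1' := mem_symm g1
    have dj := (IsG.Ds T g2 g1' (T.Z_le _ _)).1 ej
    have dk := (IsG.Ds T g2 g1' (T.Z_le' _ _)).1 ek
    have hm : γ⁻¹ * vs ∈ T.P j k := mem_trans g1' (T.Z_le' _ _ (mem_symm hz))
    refine T.E1 hjk (Ne.symm hlj) hlk.symm g2 hm ?_ ?_ hl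
    · intro h
      obtain ⟨c, hc⟩ := T.mem_Z.1 h
      apply T.double_not_two hjk dj dk
      exact ⟨c, r, by rw [hc, hr]; group⟩
    · intro h
      exact T.double_nZ hjk.symm dk dj (mem_trans h hz)
  · obtain ⟨g1, g2⟩ := T.prj_spec (T.gP hik) b w
    set p := T.prj (T.P i k) b w
    have g1' := mem_symm g1
    have di := (IsG.Ds T g2 g1' (T.Z_le _ _)).1 bi
    have dk := (IsG.Ds T g2 g1' (T.Z_le' _ _)).1 bk
    by_cases h1 : T.Two i k (p⁻¹ * vs)
    · exfalso
      obtain ⟨a, c, h1⟩ := h1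
      apply T.double_not_two hik di dk
      refine ⟨a, c + r, ?_⟩
      rw [zpow_add, ← mul_assoc, ← h1, hr]; group
    · by_cases h2 : T.Two k i (p⁻¹ * vs)
      · right
        obtain ⟨α, β, h2⟩ := h2
        have hvs : vs = p * (T.X k ^ α * T.X i ^ β) := by rw [← h2]; group
        have hwp : w = p * (T.X k ^ α * T.X i ^ β * T.X k ^ r) := by rw [hw, hvs]; group
        refine ⟨?_, p, α, β, g2, ?_, ?_, hvs⟩
        · by_contra hM
          rw [hwp] at di dk
          exact T.d6 hik.symm hM dk di
        · rintro rfl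
          apply T.double_not_two hik di dk
          exact ⟨β, r, by rw [hwp]; simp⟩
        · rintro rfl
          apply T.double_nZ hik.symm dk di
          rw [hwp]
          simp only [inv_mul_cancel_left, zpow_zero, mul_one]
          exact mul_mem (T.pow_mem_Z _ _) (T.pow_mem_Z _ _)
      · left
        exact T.V3 hik hN g2 v2 g1 v1 h1 h2

/-! ### thickening -/
open Classical in
noncomputable def S2 (b e : G) (S : Finset G) : Finset G :=
  S ∪ ((S ×ˢ (Finset.univ : Finset (I × I))).image (fun s => T.prj (T.P s.2.1 s.2.2) b s.1) ∪
    (S ×ˢ (Finset.univ : Finset (I × I))).image (fun s => T.prj (T.P s.2.1 s.2.2) e s.1))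

open Classical in
noncomputable def Th (N : ℕ) (b e : G) (S : Finset G) : Finset G :=
  (T.S2 b e S ×ˢ ((Finset.univ : Finset I) ×ˢ Finset.Icc (-(N : ℤ)) N)).image (fun s => s.1 * T.X s.2.1 ^ s.2.2)

open Classical in
lemma S2_card (b e : G) (S : Finset G) : (T.S2 b e S).card ≤ S.card * (1 + 2 * Fintype.card (I × I)) := by
  unfold S2
  refine (Finset.card_union_le _ _).trans ?_
  have h1 : ∀ c : G, ((S ×ˢ (Finset.univ : Finset (I × I))).image (fun s => T.prj (T.P s.2.1 s.2.2) c s.1)).card ≤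
      S.card * Fintype.card (I × I) := by
    intro c
    refine Finset.card_image_le.trans ?_
    rw [Finset.card_product, Finset.card_univ]
  have h2 := Finset.card_union_le ((S ×ˢ (Finset.univ : Finset (I × I))).image (fun s => T.prj (T.P s.2.1 s.2.2) b s.1))
    ((S ×ˢ (Finset.univ : Finset (I × I))).image (fun s => T.prj (T.P s.2.1 s.2.2) e s.1))
  have h3 := h1 b
  have h4 := h1 e
  nlinarith

open Classical in
lemma Th_card (N : ℕ) (b e : G) (S : Finset G) :
    (T.Th N b e S).card ≤ S.card * (1 + 2 * Fintype.card (I × I)) * (Fintype.card I * (2 * N + 1)) := by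
  unfold Th
  refine Finset.card_image_le.trans ?_
  rw [Finset.card_product, Finset.card_product, Finset.card_univ, Int.card_Icc]
  have : (((N : ℤ) + 1 - -(N : ℤ)).toNat) = 2 * N + 1 := by omega
  rw [this]
  gcongr
  exact T.S2_card b e S

open Classical in
lemma Th_pow0 {N : ℕ} {b e z : G} {S : Finset G} (hz : z ∈ T.S2 b e S) (k : I) {r : ℤ} (hr : r.natAbs ≤ N) :
    z * T.X k ^ r ∈ T.Th N b e S := by
  unfold Th
  rw [Finset.mem_image]
  refine ⟨(z, k, r), ?_, rfl⟩
  simp [hz]; omega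

open Classical in
lemma Th_pow {N : ℕ} {b e z : G} {S : Finset G} (hz : z ∈ S) (k : I) {r : ℤ} (hr : r.natAbs ≤ N) :
    z * T.X k ^ r ∈ T.Th N b e S := T.Th_pow0 (by unfold S2; simp [hz]) k hr

open Classical in
lemma Th_b {N : ℕ} {b e z : G} {S : Finset G} (hz : z ∈ S) (i j k : I) {r : ℤ} (hr : r.natAbs ≤ N) :
    T.prj (T.P i j) b z * T.X k ^ r ∈ T.Th N b e S := by
  refine T.Th_pow0 ?_ k hr
  unfold S2
  rw [Finset.mem_union, Finset.mem_union, Finset.mem_image]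
  exact Or.inr (Or.inl ⟨(z, i, j), by simp [hz], rfl⟩)

open Classical in
lemma Th_e {N : ℕ} {b e z : G} {S : Finset G} (hz : z ∈ S) (i j k : I) {r : ℤ} (hr : r.natAbs ≤ N) :
    T.prj (T.P i j) e z * T.X k ^ r ∈ T.Th N b e S := by
  refine T.Th_pow0 ?_ k hr
  unfold S2
  rw [Finset.mem_union, Finset.mem_union, Finset.mem_image, Finset.mem_image]
  exact Or.inr (Or.inr ⟨(z, i, j), by simp [hz], rfl⟩)

lemma Th_self {N : ℕ} {b e z : G} {S : Finset G} (hz : z ∈ S) (k : I) : z ∈ T.Th N b e S := by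
  have := T.Th_pow (N := N) (b := b) (e := e) hz k (r := 0) (by simp)
  simpa using this

open Classical in
noncomputable def Qs (N : ℕ) (b e : G) : Finset G := T.Q N b e ∪ T.Q N e b

open Classical in
lemma Qs_card (N : ℕ) (b e : G) : (T.Qs N b e).card ≤ 2 * ((N + 1) * (1 + (N + 1) * Fintype.card (I × I × I))) := by
  unfold Qs
  have h1 := T.Q_card N b e
  have h2 := T.Q_card N e b
  have h3 := Finset.card_union_le (T.Q N b e) (T.Q N e b)
  omega

open Classical in
lemma Qs_l {N : ℕ} {b e z : G} (h : z ∈ T.Q N b e) : z ∈ T.Qs N b e := by unfold Qs; simp [h]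
open Classical in
lemma Qs_r {N : ℕ} {b e z : G} (h : z ∈ T.Q N e b) : z ∈ T.Qs N b e := by unfold Qs; simp [h]

variable (h33 : ∀ i j k, i ≠ j → i ≠ k → j ≠ k → T.M i j = 3 → T.M i k = 3 → T.M j k = ⊤)
include h33

set_option maxHeartbeats 1000000 in
theorem vis2' {i j : I} (hij : i ≠ j) {N : ℕ} {b e p q : G} (hN : T.D b e ≤ N) (hp : T.IsG (T.P i j) b p)
    (hq : T.IsG (T.P i j) e q) (hbp : T.D b p ≤ N) (heq : T.D e q ≤ N) {s t : ℤ} (hs : s ≠ 0) (ht : t ≠ 0)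
    (hpq : q = p * (T.X i ^ s * T.X j ^ t)) : ∃ z ∈ T.Th (2 * N) b e (T.Qs N b e), p⁻¹ * z ∈ T.P i j := by
  have hpq' : q = p * T.X i ^ s * T.X j ^ t := by rw [hpq, mul_assoc]
  obtain ⟨w, hw⟩ : ∃ w, w = p * T.X i ^ s := ⟨_, rfl⟩
  rw [← hw] at hpq'
  have hwq : w = q * T.X j ^ (-t) := by rw [hpq']; group
  have hpw : p = w * T.X i ^ (-s) := by rw [hw]; group
  have mpw : p⁻¹ * w ∈ T.P i j := by rw [hw, inv_mul_cancel_left]; exact T.Z_le _ _ (T.pow_mem_Z _ _)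
  have mqw : q⁻¹ * w ∈ T.P i j := by rw [hwq, inv_mul_cancel_left]; exact T.Z_le' _ _ (T.pow_mem_Z _ _)
  by_contra hcon
  have nTh : w ∉ T.Th (2 * N) b e (T.Qs N b e) := fun h => hcon ⟨w, h, mpw⟩
  have nQ : ∀ z ∈ T.Qs N b e, w⁻¹ * z ∉ T.P i j := fun z hz h => hcon ⟨z, T.Th_self hz i, mem_trans mpw h⟩
  have hN' : T.D e b ≤ N := by rw [T.D_comm]; exact hN
  have hlen : T.D p q ≤ N := (T.lip hp hq (mem_trans mpw (mem_symm mqw))).trans hN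
  have hlen2 : T.D p q = s.natAbs + t.natAbs := by rw [hpq]; exact T.two_len hij p s t
  have Dbw : T.D b w ≤ 2 * N := by
    have h1 := IsG.D T hp mpw
    have h2 : T.D p w = s.natAbs := by rw [hw, T.D_mul, T.ℓpow]
    omega
  have Dew : T.D e w ≤ 2 * N := by
    have h1 := IsG.D T hq mqw
    have h2 : T.D q w = t.natAbs := by rw [hwq, T.D_mul, T.ℓpow]; simp
    omega
  obtain ⟨k, hki, hkj, hbk⟩ : ∃ k, k ≠ i ∧ k ≠ j ∧ T.Ds b w k := by
    rcases T.lemA hij hN hp hq hs ht hw hpq' with ⟨z, hz, hm⟩ | h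
    · exact absurd hm (nQ z (T.Qs_l hz))
    · exact h
  obtain ⟨k', hki', hkj', hek⟩ : ∃ k, k ≠ i ∧ k ≠ j ∧ T.Ds e w k := by
    rcases T.lemA hij.symm hN' (by rw [T.P_comm]; exact hq) (by rw [T.P_comm]; exact hp) (neg_ne_zero.2 ht) (neg_ne_zero.2 hs)
      hwq hpw with ⟨z, hz, hm⟩ | ⟨k, h1, h2, h3⟩
    · rw [T.P_comm] at hm
      exact absurd hm (nQ z (T.Qs_r hz))
    · exact ⟨k, h2, h1, h3⟩
  have hbi : T.Ds b w i := by
    rw [IsG.Ds T hp mpw (T.Z_le _ _), hw]; exact T.pow_Ds hs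
  have hej : T.Ds e w j := by
    rw [IsG.Ds T hq mqw (T.Z_le' _ _), hwq]; exact T.pow_Ds (neg_ne_zero.2 ht)
  by_cases hkk : k' = k
  · subst hkk
    obtain ⟨vs, r, v1, v2, v3, v4, v5⟩ := T.lemB hij hki.symm hkj.symm hN hbi hbk hej hek
    have mvw : vs⁻¹ * w ∈ T.P i k' := by rw [v2, inv_mul_cancel_left]; exact T.Z_le' _ _ (T.pow_mem_Z _ _)
    have key : ∀ z ∈ T.Qs N b e, w⁻¹ * z ∈ T.P i k' → False := by
      intro z hz hm
      have : T.prj (T.P i k') e z = vs := T.prj_eq (mem_symm (mem_trans mvw hm)) v1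
      apply nTh
      rw [v2, ← this]
      exact T.Th_e hz i k' k' (by omega)
    rcases v5 with ⟨z, hz, hm⟩ | ⟨hM1, p', α, β, c1, c2, c3, c4⟩
    · exact key z (T.Qs_l hz) hm
    · obtain ⟨us, r', u1, u2, u3, u4, u5⟩ := T.lemB hij.symm hkj.symm hki.symm hN' hej hek hbi hbk
      rcases u5 with ⟨z, hz, hm⟩ | ⟨hM2, _⟩
      · have muw : us⁻¹ * w ∈ T.P j k' := by rw [u2, inv_mul_cancel_left]; exact T.Z_le' _ _ (T.pow_mem_Z _ _)
        have : T.prj (T.P j k') b z = us := T.prj_eq (mem_symm (mem_trans muw hm)) u1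
        apply nTh
        rw [u2, ← this]
        exact T.Th_b (T.Qs_r hz) j k' k' (by omega)
      · have hM := h33 k' i j hki hkj hij hM1 hM2
        have e1 : vs * T.X i ^ (-β) = p' * T.X k' ^ α := by rw [c4]; group
        have mv2 : (vs * T.X i ^ (-β))⁻¹ * vs ∈ T.P i k' := by
          apply mem_symm; rw [inv_mul_cancel_left]; exact T.Z_le _ _ (T.pow_mem_Z _ _)
        rcases T.lemA hki.symm hN' v1 c1 (neg_ne_zero.2 c3) (neg_ne_zero.2 c2) rfl
          (by rw [e1]; group : p' = vs * T.X i ^ (-β) * T.X k' ^ (-α)) with ⟨z, hz, hm⟩ | ⟨k2, f1, f2, f3⟩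
        · exact key z (T.Qs_r hz) (mem_trans (mem_symm mvw) (mem_trans (mem_symm mv2) hm))
        · have di : T.Ds e (vs * T.X i ^ (-β)) i :=
            T.line_Ds (IsG.nDs T v1 (T.Z_le _ _)) (neg_ne_zero.2 c3)
          obtain ⟨g1, g2⟩ := T.prj_spec (T.gP f1.symm) e (vs * T.X i ^ (-β))
          have g1' := mem_symm g1
          have di' := (IsG.Ds T g2 g1' (T.Z_le _ _)).1 di
          have dk' := (IsG.Ds T g2 g1' (T.Z_le' _ _)).1 f3
          by_cases hk2 : k2 = j
          · subst hk2
            obtain ⟨ε, hε⟩ := di'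
            obtain ⟨δ, hδ⟩ := dk'
            unfold D at hε hδ
            rw [← mul_assoc] at hε hδ
            exact T.i6' i k2 ε δ hij hM _ g1' hε hδ
          · have zv : (vs * T.X i ^ (-β))⁻¹ * vs ∈ T.Z i := by
              apply mem_symm; rw [inv_mul_cancel_left]; exact T.pow_mem_Z _ _
            have hmv := mem_trans g1' (T.Z_le i k2 zv)
            have hne : T.prj (T.P i k2) e (vs * T.X i ^ (-β)) ≠ vs := by
              intro h
              apply T.double_nZ f1.symm di' dk'
              rw [h]
              exact mem_symm zv
            rcases T.P_Ds f1.symm hmv hne with h | h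
            · exact IsG.nDs T v1 (T.Z_le _ _) ((IsG.Ds T g2 hmv (T.Z_le _ _)).2 h)
            · exact hk2 (v4 k2 ((IsG.Ds T g2 hmv (T.Z_le' _ _)).2 h))
  · have n1 : ¬ T.Ds e w i := fun h => T.E2 hkj'.symm hij.symm hki' hej hek h
    have n2 : ¬ T.Ds e w k := fun h => T.E2 hkj'.symm hkj.symm hkk hej hek h
    have hG := T.isG_P hki.symm n1 n2
    obtain ⟨g1, g2⟩ := T.prj_spec (T.gP hki.symm) b w
    have g1' := mem_symm g1
    have di' := (IsG.Ds T g2 g1' (T.Z_le _ _)).1 hbi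
    have dk' := (IsG.Ds T g2 g1' (T.Z_le' _ _)).1 hbk
    obtain ⟨z, hz, hm⟩ := T.V3 hki.symm (w := w) hN g2 hG g1 (by simp) (T.double_not_two hki.symm di' dk')
      (T.double_not_two hki dk' di')
    apply nTh
    have : T.prj (T.P i k) e z = w := T.prj_eq (mem_symm hm) hG
    have h2 := T.Th_e (N := 2 * N) (b := b) (e := e) (T.Qs_l hz) i k k (r := 0) (by simp)
    rw [zpow_zero, mul_one, this] at h2
    exact h2

theorem vis2 {i j : I} (hij : i ≠ j) {N : ℕ} {b e p q : G} (hN : T.D b e ≤ N) (hp : T.IsG (T.P i j) b p)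
    (hq : T.IsG (T.P i j) e q) (hbp : T.D b p ≤ N) (heq : T.D e q ≤ N) (hm : p⁻¹ * q ∈ T.P i j)
    (h1 : p⁻¹ * q ∉ T.Z i) (h2 : p⁻¹ * q ∉ T.Z j) : ∃ z ∈ T.Th (2 * N) b e (T.Qs N b e), p⁻¹ * z ∈ T.P i j := by
  by_cases a1 : T.Two i j (p⁻¹ * q)
  · obtain ⟨s, t, h⟩ := a1
    refine T.vis2' h33 hij hN hp hq hbp heq (s := s) (t := t) ?_ ?_ (by rw [← h]; group)
    · rintro rfl
      apply h2; rw [h, zpow_zero, one_mul]; exact T.pow_mem_Z _ _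
    · rintro rfl
      apply h1; rw [h, zpow_zero, mul_one]; exact T.pow_mem_Z _ _
  · by_cases a2 : T.Two j i (p⁻¹ * q)
    · obtain ⟨s, t, h⟩ := a2
      rw [T.P_comm] at hp hq ⊢
      refine T.vis2' h33 hij.symm hN hp hq hbp heq (s := s) (t := t) ?_ ?_ (by rw [← h]; group)
      · rintro rfl
        apply h1; rw [h, zpow_zero, one_mul]; exact T.pow_mem_Z _ _
      · rintro rfl
        apply h2; rw [h, zpow_zero, mul_one]; exact T.pow_mem_Z _ _
    · obtain ⟨z, hz, h⟩ := T.V3 hij (w := p) hN hp hq (by simp) hm a1 a2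
      exact ⟨z, T.Th_self (T.Qs_l hz) i, h⟩

end Art
end ArtinRD


set_option linter.all false

namespace ArtinRD
namespace Art
variable {I G : Type} [Group G] (T : Art I G)

def V2 (b e : G) (i j : I) (w : G) : Prop :=
  (T.prj (T.P i j) b w)⁻¹ * T.prj (T.P i j) e w ∉ T.Z i ∧ (T.prj (T.P i j) b w)⁻¹ * T.prj (T.P i j) e w ∉ T.Z j

def Ptp (N : ℕ) (b e v : G) : Prop := ∃ k, ∃ r : ℤ, r.natAbs ≤ N ∧ (v = b * T.X k ^ r ∨ v = e * T.X k ^ r ∨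
  ∃ i j, i ≠ j ∧ T.V2 b e i j v ∧ (v = T.prj (T.P i j) b v * T.X k ^ r ∨ v = T.prj (T.P i j) e v * T.X k ^ r))

lemma V2_left (g b e : G) {i j : I} (hij : i ≠ j) (w : G) : T.V2 (g * b) (g * e) i j (g * w) ↔ T.V2 b e i j w := by
  unfold V2
  rw [T.prj_left (T.gP hij), T.prj_left (T.gP hij)]
  simp only [mul_inv_rev, mul_assoc, inv_mul_cancel_left]

lemma Ptp_left (N : ℕ) (g b e v : G) (h : T.Ptp N b e v) : T.Ptp N (g * b) (g * e) (g * v) := by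
  obtain ⟨k, r, hr, h⟩ := h
  refine ⟨k, r, hr, ?_⟩
  rcases h with h | h | ⟨i, j, hij, hV, h⟩
  · left; rw [h]; group
  · right; left; rw [h]; group
  · right; right
    refine ⟨i, j, hij, (T.V2_left g b e hij v).2 hV, ?_⟩
    rw [T.prj_left (T.gP hij), T.prj_left (T.gP hij)]
    rcases h with h | h
    · left; rw [mul_assoc, ← h]
    · right; rw [mul_assoc, ← h]

def NC (b e v : G) : Prop := ∀ i ε, T.D b (v * T.x i ε) < T.D b v → ¬ T.D e (v * T.x i ε) < T.D e v

lemma NC.symm {b e v : G} (h : T.NC b e v) : T.NC e b v := fun i ε h1 h2 => h i ε h2 h1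

lemma closer {b p u v y : G} (h1 : T.D b v = T.D b p + T.D p v) (h2 : T.D v p = T.D v u + T.D u p) (h : T.D u y < T.D u v) :
    T.D b y < T.D b v := by
  have t1 := T.D_tri b p y
  have t2 := T.D_tri p u y
  have c1 := T.D_comm p v
  have c2 := T.D_comm u v
  have c3 := T.D_comm u p
  omega

lemma claimF {b e v p q : G} {i j a : I} (hij : i ≠ j) (hNC : T.NC b e v) (hp : T.IsG (T.P i j) b p) (hq : T.IsG (T.P i j) e q)
    (mp : p⁻¹ * v ∈ T.P i j) (mq : q⁻¹ * v ∈ T.P i j) (ha : p⁻¹ * q ∈ T.Z a) : p⁻¹ * v ∈ T.Z a ∧ q⁻¹ * v ∈ T.Z a := by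
  have key : p⁻¹ * v ∈ T.Z a := by
    by_contra hcon
    obtain ⟨u1, u2⟩ := T.prj_spec (T.gZ a) v p
    set u := T.prj (T.Z a) v p
    have hne : u ≠ v := by
      intro h; rw [h] at u1; exact hcon u1
    obtain ⟨k, ε, hk⟩ := T.D_desc hne
    have d1 := IsG.D T u2 (mem_symm u1)
    have d2 := IsG.D T u2 (mem_trans (mem_symm u1) ha)
    exact hNC k ε (T.closer (IsG.D T hp mp) d1 hk) (T.closer (IsG.D T hq mq) d2 hk)
  exact ⟨key, mem_trans (mem_symm ha) key⟩

lemma prj_facts {i j : I} (hij : i ≠ j) (b v : G) : T.IsG (T.P i j) b (T.prj (T.P i j) b v) ∧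
    (T.prj (T.P i j) b v)⁻¹ * v ∈ T.P i j := ⟨(T.prj_spec (T.gP hij) b v).2, mem_symm (T.prj_spec (T.gP hij) b v).1⟩

def Sin (i j : I) (b v : G) : Prop := (T.prj (T.P i j) b v)⁻¹ * v ∈ T.Z i ∨ (T.prj (T.P i j) b v)⁻¹ * v ∈ T.Z j

lemma Sin_pow {i j : I} (hij : i ≠ j) {b v : G} {N : ℕ} (h : T.Sin i j b v) (hN : T.D b v ≤ N) :
    ∃ k, ∃ r : ℤ, r.natAbs ≤ N ∧ v = T.prj (T.P i j) b v * T.X k ^ r := by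
  have : ∃ k, (T.prj (T.P i j) b v)⁻¹ * v ∈ T.Z k := by
    rcases h with h | h
    · exact ⟨_, h⟩
    · exact ⟨_, h⟩
  obtain ⟨k, hk⟩ := this
  obtain ⟨r, hr⟩ := T.mem_Z.1 hk
  refine ⟨k, r, ?_, by rw [hr]; group⟩
  obtain ⟨f1, f2⟩ := T.prj_facts hij b v
  have := IsG.D T f1 f2
  rw [← T.ℓpow k r, hr]
  unfold D at *
  omega

lemma V2_of {b e v : G} {i j : I} (hij : i ≠ j) (hNC : T.NC b e v) (h : ¬ T.Sin i j b v) : T.V2 b e i j v := by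
  obtain ⟨f1, f2⟩ := T.prj_facts hij b v
  obtain ⟨g1, g2⟩ := T.prj_facts hij e v
  exact ⟨fun ha => h (Or.inl (T.claimF hij hNC f1 g1 f2 g2 ha).1), fun ha => h (Or.inr (T.claimF hij hNC f1 g1 f2 g2 ha).1)⟩

lemma V2_of' {b e v : G} {i j : I} (hij : i ≠ j) (hNC : T.NC b e v) (h : ¬ T.Sin i j e v) : T.V2 b e i j v := by
  obtain ⟨f1, f2⟩ := T.prj_facts hij b v
  obtain ⟨g1, g2⟩ := T.prj_facts hij e v
  exact ⟨fun ha => h (Or.inl (T.claimF hij hNC f1 g1 f2 g2 ha).2), fun ha => h (Or.inr (T.claimF hij hNC f1 g1 f2 g2 ha).2)⟩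

lemma Z_Ds {p w : G} {a c : I} (h : p⁻¹ * w ∈ T.Z c) (hd : T.Ds p w a) : a = c := by
  by_contra hac
  obtain ⟨r, hr⟩ := T.mem_Z.1 h
  have : w = p * T.X c ^ r := by rw [hr]; group
  rw [this] at hd
  exact T.pow_nDs hac p r hd

theorem ptp_of {N : ℕ} (i0 : I) {b e v : G} (hNC : T.NC b e v) (hS : ∀ i j, i ≠ j → T.Sin i j b v ∨ T.Sin i j e v)
    (hb : T.D b v ≤ N) (he : T.D e v ≤ N) : T.Ptp N b e v := by
  by_cases hbv : b = v
  · exact ⟨i0, 0, by simp, Or.inl (by simp [hbv])⟩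
  by_cases hev : e = v
  · exact ⟨i0, 0, by simp, Or.inr (Or.inl (by simp [hev]))⟩
  obtain ⟨a, ha⟩ := T.D_desc hbv
  obtain ⟨c, hc⟩ := T.D_desc hev
  have fin : ∀ i j, i ≠ j → T.V2 b e i j v → T.Ptp N b e v := by
    intro i j hij hV
    rcases hS i j hij with h | h
    · obtain ⟨k, r, h1, h2⟩ := T.Sin_pow hij h hb
      exact ⟨k, r, h1, Or.inr (Or.inr ⟨i, j, hij, hV, Or.inl h2⟩)⟩
    · obtain ⟨k, r, h1, h2⟩ := T.Sin_pow hij h he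
      exact ⟨k, r, h1, Or.inr (Or.inr ⟨i, j, hij, hV, Or.inr h2⟩)⟩
  have case1 : ∀ a c, a ≠ c → T.Ds b v a → T.Ds e v c → T.Ptp N b e v := by
    intro a c hac ha hc
    apply fin a c hac
    obtain ⟨f1, f2⟩ := T.prj_facts hac b v
    obtain ⟨g1, g2⟩ := T.prj_facts hac e v
    rw [IsG.Ds T f1 f2 (T.Z_le _ _)] at ha
    rw [IsG.Ds T g1 g2 (T.Z_le' _ _)] at hc
    constructor
    · intro h
      obtain ⟨h1, h2⟩ := T.claimF hac hNC f1 g1 f2 g2 h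
      exact hac (T.Z_Ds h2 hc).symm
    · intro h
      obtain ⟨h1, h2⟩ := T.claimF hac hNC f1 g1 f2 g2 h
      exact hac (T.Z_Ds h1 ha)
  by_cases hac : a = c
  swap
  · exact case1 a c hac ha hc
  subst hac
  obtain ⟨m, hm0, hm, hnw, hDw⟩ := T.prj_Z_facts ha
  set w := T.prj (T.Z a) b v
  by_cases hbw : b = w
  · refine ⟨a, m, by omega, Or.inl ?_⟩
    rw [hbw]; exact hm
  obtain ⟨k, hk⟩ := T.D_desc hbw
  have hka : k ≠ a := by rintro rfl; exact hnw hk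
  by_cases hkv : T.Ds b v k
  · exact case1 k a hka hkv hc
  apply fin a k hka.symm
  apply T.V2_of hka.symm hNC
  obtain ⟨f1, f2⟩ := T.prj_facts hka.symm b v
  have zv : v⁻¹ * w ∈ T.Z a := by
    apply mem_symm; rw [hm, inv_mul_cancel_left]; exact T.pow_mem_Z _ _
  have f3 := mem_trans f2 (T.Z_le a k zv)
  have ha' := (IsG.Ds T f1 f2 (T.Z_le _ _)).1 ha
  have hk' := (IsG.Ds T f1 f3 (T.Z_le' _ _)).1 hk
  rintro (h | h)
  · exact hka (T.Z_Ds (mem_trans h zv) hk')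
  · exact hka (T.Z_Ds h ha').symm

/-- triangles -/
theorem triangle {N : ℕ} (i0 j0 : I) (hij0 : i0 ≠ j0) (x1 x2 x3 : G) (h12 : T.D x1 x2 + T.D x3 x2 ≤ N) :
    ∃ v, T.D x1 v ≤ N ∧ T.D x2 v ≤ N ∧ T.D x3 v ≤ N ∧ ∃ i j, i ≠ j ∧
      (T.V2 x1 x2 i j v ∨ T.Ptp N x1 x2 v) ∧ (T.V2 x2 x3 i j v ∨ T.Ptp N x2 x3 v) ∧ (T.V2 x1 x3 i j v ∨ T.Ptp N x1 x3 v) := by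
  have hmin : ∃ v, ∀ v', T.D x1 v + T.D x2 v + T.D x3 v ≤ T.D x1 v' + T.D x2 v' + T.D x3 v' := by
    have := WellFounded.min_mem (wellFounded_lt (α := ℕ)) (Set.range (fun v => T.D x1 v + T.D x2 v + T.D x3 v)) ⟨_, x1, rfl⟩
    obtain ⟨v, hv⟩ := this
    refine ⟨v, fun v' => ?_⟩
    have h := WellFounded.min_le (wellFounded_lt (α := ℕ)) (s := Set.range (fun v => T.D x1 v + T.D x2 v + T.D x3 v)) ⟨v', rfl⟩
    simp only at hv h
    omega
  obtain ⟨v, hv⟩ := hmin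
  have h0 := hv x2
  rw [T.D_self] at h0
  have hx : ∀ i ε, T.D x1 v + T.D x2 v + T.D x3 v ≤ T.D x1 (v * T.x i ε) + T.D x2 (v * T.x i ε) + T.D x3 (v * T.x i ε) :=
    fun i ε => hv _
  have p1 := T.D_par x1 v
  have p2 := T.D_par x2 v
  have p3 := T.D_par x3 v
  have n12 : T.NC x1 x2 v := by
    intro i ε a b
    have := hx i ε; have := p1 i ε; have := p2 i ε; have := p3 i ε; omega
  have n23 : T.NC x2 x3 v := by
    intro i ε a b
    have := hx i ε; have := p1 i ε; have := p2 i ε; have := p3 i ε; omega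
  have n13 : T.NC x1 x3 v := by
    intro i ε a b
    have := hx i ε; have := p1 i ε; have := p2 i ε; have := p3 i ε; omega
  have b1 : T.D x1 v ≤ N := by omega
  have b2 : T.D x2 v ≤ N := by omega
  have b3 : T.D x3 v ≤ N := by omega
  refine ⟨v, b1, b2, b3, ?_⟩
  by_cases hA : ∃ i j, i ≠ j ∧ ((¬ T.Sin i j x1 v ∧ ¬ T.Sin i j x2 v) ∨ (¬ T.Sin i j x2 v ∧ ¬ T.Sin i j x3 v) ∨
      (¬ T.Sin i j x1 v ∧ ¬ T.Sin i j x3 v))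
  · obtain ⟨i, j, hij, h⟩ := hA
    refine ⟨i, j, hij, Or.inl ?_, Or.inl ?_, Or.inl ?_⟩
    · rcases h with ⟨a, b⟩ | ⟨a, b⟩ | ⟨a, b⟩
      · exact T.V2_of hij n12 a
      · exact T.V2_of' hij n12 a
      · exact T.V2_of hij n12 a
    · rcases h with ⟨a, b⟩ | ⟨a, b⟩ | ⟨a, b⟩
      · exact T.V2_of hij n23 b
      · exact T.V2_of hij n23 a
      · exact T.V2_of' hij n23 b
    · rcases h with ⟨a, b⟩ | ⟨a, b⟩ | ⟨a, b⟩
      · exact T.V2_of hij n13 a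
      · exact T.V2_of' hij n13 b
      · exact T.V2_of hij n13 a
  · refine ⟨i0, j0, hij0, Or.inr ?_, Or.inr ?_, Or.inr ?_⟩
    · refine T.ptp_of i0 n12 (fun i j hij => ?_) b1 b2
      by_contra hc
      push Not at hc
      exact hA ⟨i, j, hij, Or.inl hc⟩
    · refine T.ptp_of i0 n23 (fun i j hij => ?_) b2 b3
      by_contra hc
      push Not at hc
      exact hA ⟨i, j, hij, Or.inr (Or.inl hc)⟩
    · refine T.ptp_of i0 n13 (fun i j hij => ?_) b1 b3
      by_contra hc
      push Not at hc
      exact hA ⟨i, j, hij, Or.inr (Or.inr hc)⟩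

section
variable [Fintype I]

noncomputable def S1 (N : ℕ) (b e : G) : Finset G := T.Th (2 * N) b e (T.Th (2 * N) b e (T.Qs N b e))

lemma b_mem_Q (N : ℕ) (b e : G) : b ∈ T.Q N b e := by
  classical
  unfold Q
  rw [Finset.mem_biUnion]
  refine ⟨0, by simp, ?_⟩
  rw [T.pth_zero]
  unfold Jset
  exact Finset.mem_insert_self _ _

theorem pair_vis (h33 : ∀ i j k, i ≠ j → i ≠ k → j ≠ k → T.M i j = 3 → T.M i k = 3 → T.M j k = ⊤)
    {N : ℕ} {b e v : G} {i j : I} (hij : i ≠ j) (hN : T.D b e ≤ N) (hb : T.D b v ≤ N) (he : T.D e v ≤ N)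
    (h : T.V2 b e i j v ∨ T.Ptp N b e v) : ∃ z ∈ T.S1 N b e, v⁻¹ * z ∈ T.P i j := by
  have vis : ∀ i j, i ≠ j → T.V2 b e i j v → ∃ z ∈ T.Th (2 * N) b e (T.Qs N b e), v⁻¹ * z ∈ T.P i j := by
    intro i j hij hV
    obtain ⟨f1, f2⟩ := T.prj_facts hij b v
    obtain ⟨g1, g2⟩ := T.prj_facts hij e v
    have d1 := IsG.D T f1 f2
    have d2 := IsG.D T g1 g2
    obtain ⟨z, hz, hm⟩ := T.vis2 h33 hij hN f1 g1 (by omega) (by omega) (mem_trans f2 (mem_symm g2)) hV.1 hV.2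
    exact ⟨z, hz, mem_trans (mem_symm f2) hm⟩
  rcases h with h | ⟨k, r, hr, h⟩
  · obtain ⟨z, hz, hm⟩ := vis i j hij h
    exact ⟨z, T.Th_self hz i, hm⟩
  · refine ⟨v, ?_, by simp⟩
    rcases h with h | h | ⟨i', j', hij', hV, h⟩
    · apply T.Th_self _ i
      rw [h]
      exact T.Th_pow (T.Qs_l (T.b_mem_Q N b e)) k (by omega)
    · apply T.Th_self _ i
      rw [h]
      exact T.Th_pow (T.Qs_r (T.b_mem_Q N e b)) k (by omega)
    · obtain ⟨z, hz, hm⟩ := vis i' j' hij' hV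
      rcases h with h | h
      · have h2 := T.Th_b (N := 2 * N) (b := b) (e := e) hz i' j' k (r := r) (by omega)
        rw [← T.prj_congr (T.gP hij') hm, ← h] at h2
        exact h2
      · have h2 := T.Th_e (N := 2 * N) (b := b) (e := e) hz i' j' k (r := r) (by omega)
        rw [← T.prj_congr (T.gP hij') hm, ← h] at h2
        exact h2
end

end Art
end ArtinRD


set_option linter.all false

namespace ArtinRD
namespace Art
variable {I G : Type} [Group G] (T : Art I G) [Fintype I]

open Classical in
noncomputable def Cand (N : ℕ) (C : I → I → G → Finset G) (g : G) : Finset G :=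
  (T.S1 N 1 g ×ˢ (Finset.univ : Finset (I × I))).biUnion (fun s =>
    (C s.2.1 s.2.2 ((T.prj (T.P s.2.1 s.2.2) 1 s.1)⁻¹ * T.prj (T.P s.2.1 s.2.2) g s.1)).image
      (fun c => T.prj (T.P s.2.1 s.2.2) 1 s.1 * c))

open Classical in
lemma Cand_card {N B : ℕ} {C : I → I → G → Finset G} (hC : ∀ i j u, (C i j u).card ≤ B) (g : G) :
    (T.Cand N C g).card ≤ (T.S1 N 1 g).card * Fintype.card (I × I) * B := by
  unfold Cand
  refine Finset.card_biUnion_le.trans ?_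
  refine (Finset.sum_le_card_nsmul _ _ B (fun s _ => Finset.card_image_le.trans (hC _ _ _))).trans ?_
  rw [Finset.card_product, Finset.card_univ, smul_eq_mul]

open Classical in
lemma Cand_mem {N : ℕ} {C : I → I → G → Finset G} {g v z c p q : G} {i j : I} (hij : i ≠ j) (hz : z ∈ T.S1 N 1 g)
    (hm : v⁻¹ * z ∈ T.P i j) (hp : p = T.prj (T.P i j) 1 v) (hq : q = T.prj (T.P i j) g v)
    (hc : c ∈ C i j (p⁻¹ * q)) : p * c ∈ T.Cand N C g := by
  unfold Cand
  rw [Finset.mem_biUnion]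
  refine ⟨(z, i, j), by simp [hz], ?_⟩
  rw [Finset.mem_image]
  simp only
  rw [← T.prj_congr (T.gP hij) hm, ← T.prj_congr (T.gP hij) hm, ← hp, ← hq]
  exact ⟨c, hc, rfl⟩

lemma S1_card (R : ℕ) (b e : G) : ∃ K : ℕ, K = (8 * (1 + 2 * Fintype.card (I × I × I))) *
    ((1 + 2 * Fintype.card (I × I)) * (Fintype.card I * 8)) ^ 2 ∧ (T.S1 (2 * R) b e).card ≤ K * (R + 1) ^ 4 := by
  refine ⟨_, rfl, ?_⟩
  have h1 := T.Qs_card (2 * R) b e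
  have h2 := T.Th_card (2 * (2 * R)) b e (T.Qs (2 * R) b e)
  have h3 := T.Th_card (2 * (2 * R)) b e (T.Th (2 * (2 * R)) b e (T.Qs (2 * R) b e))
  unfold S1
  generalize Fintype.card (I × I × I) = n3 at *
  generalize Fintype.card (I × I) = n2 at *
  generalize Fintype.card I = n1 at *
  generalize (T.Qs (2 * R) b e) = S at *
  have e1 : 2 * (2 * (2 * R)) + 1 ≤ 8 * (R + 1) := by omega
  have e2 : 2 * R + 1 ≤ 2 * (R + 1) := by omega
  have e3 : 1 + (2 * R + 1) * n3 ≤ (R + 1) * (1 + 2 * n3) := by nlinarith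
  have q1 : S.card ≤ 8 * (1 + 2 * n3) * (R + 1) ^ 2 := by
    calc S.card ≤ 2 * ((2 * R + 1) * (1 + (2 * R + 1) * n3)) := h1
      _ ≤ 2 * ((2 * (R + 1)) * ((R + 1) * (1 + 2 * n3))) := by gcongr
      _ = 4 * (1 + 2 * n3) * (R + 1) ^ 2 := by ring
      _ ≤ 8 * (1 + 2 * n3) * (R + 1) ^ 2 := by gcongr; omega
  calc (T.Th (2 * (2 * R)) b e (T.Th (2 * (2 * R)) b e S)).card
      ≤ (T.Th (2 * (2 * R)) b e S).card * (1 + 2 * n2) * (n1 * (2 * (2 * (2 * R)) + 1)) := h3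
    _ ≤ (S.card * (1 + 2 * n2) * (n1 * (2 * (2 * (2 * R)) + 1))) * (1 + 2 * n2) * (n1 * (2 * (2 * (2 * R)) + 1)) := by gcongr
    _ ≤ ((8 * (1 + 2 * n3) * (R + 1) ^ 2) * (1 + 2 * n2) * (n1 * (8 * (R + 1)))) * (1 + 2 * n2) * (n1 * (8 * (R + 1))) := by gcongr
    _ = _ := by ring

theorem rd (h33 : ∀ i j k, i ≠ j → i ≠ k → j ≠ k → T.M i j = 3 → T.M i k = 3 → T.M j k = ⊤)
    (i0 j0 : I) (hij0 : i0 ≠ j0) : RapidDecay T.ℓ := by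
  classical
  have h7 : ∀ i j, ∃ K N : ℕ, ∀ R : ℕ, ∃ C : G → Finset G, (∀ u, (C u).card ≤ K * (R + 1) ^ N) ∧
      (i ≠ j → ∀ a ∈ T.P i j, ∀ b ∈ T.P i j, T.ℓ a ≤ R → T.ℓ b ≤ R → ∃ c ∈ C a, a⁻¹ * c ∈ C b ∧ c ∈ C (a * b)) := by
    intro i j
    by_cases hij : i = j
    · exact ⟨0, 0, fun R => ⟨fun _ => ∅, by simp, fun h => absurd hij h⟩⟩
    · obtain ⟨K, N, h⟩ := T.i7 i j hij
      refine ⟨K, N, fun R => ?_⟩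
      obtain ⟨C, h1, h2⟩ := h R
      exact ⟨C, h1, fun _ => h2⟩
  choose K N h7 using h7
  let KK := ∑ s : I × I, K s.1 s.2
  let NN := ∑ s : I × I, N s.1 s.2
  obtain ⟨K1, hK1⟩ : ∃ K1 : ℕ, K1 = (8 * (1 + 2 * Fintype.card (I × I × I))) *
    ((1 + 2 * Fintype.card (I × I)) * (Fintype.card I * 8)) ^ 2 := ⟨_, rfl⟩
  refine rd_criterion T.ℓ T.ℓmul T.ℓinv (K1 * Fintype.card (I × I) * KK) (4 + NN) ?_
  intro R
  choose C hC1 hC2 using fun i j => h7 i j R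
  have hC3 : ∀ i j u, (C i j u).card ≤ KK * (R + 1) ^ NN := by
    intro i j u
    refine (hC1 i j u).trans ?_
    have a1 : K i j ≤ KK := Finset.single_le_sum (f := fun s : I × I => K s.1 s.2) (fun _ _ => Nat.zero_le _) (Finset.mem_univ (i, j))
    have a2 : N i j ≤ NN := Finset.single_le_sum (f := fun s : I × I => N s.1 s.2) (fun _ _ => Nat.zero_le _) (Finset.mem_univ (i, j))
    exact Nat.mul_le_mul a1 (Nat.pow_le_pow_right (by omega) a2)
  refine ⟨T.Cand (2 * R) C, ?_, ?_⟩
  · intro u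
    refine (T.Cand_card hC3 u).trans ?_
    obtain ⟨K2, hK2, hc⟩ := T.S1_card R 1 u
    rw [← hK1] at hK2
    subst hK2
    calc (T.S1 (2 * R) 1 u).card * Fintype.card (I × I) * (KK * (R + 1) ^ NN)
        ≤ (K2 * (R + 1) ^ 4) * Fintype.card (I × I) * (KK * (R + 1) ^ NN) := by gcongr
      _ = K2 * Fintype.card (I × I) * KK * (R + 1) ^ (4 + NN) := by rw [pow_add]; ring
  · intro h u hh hu
    have D12 : T.D 1 h ≤ R := by simpa [D] using hh
    have D23 : T.D h (h * u) ≤ R := by rw [T.D_mul]; exact hu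
    have D13 : T.D 1 (h * u) ≤ 2 * R := by
      have := T.D_tri 1 h (h * u)
      omega
    have D1u : T.D 1 u ≤ 2 * R := by simp only [D, inv_one, one_mul]; omega
    obtain ⟨v, b1, b2, b3, i, j, hij, v12, v23, v13⟩ := T.triangle (N := 2 * R) i0 j0 hij0 1 h (h * u)
      (by rw [T.D_comm (h * u)]; omega)
    obtain ⟨f1, f2⟩ := T.prj_facts hij 1 v
    obtain ⟨g1, g2⟩ := T.prj_facts hij h v
    obtain ⟨k1, k2⟩ := T.prj_facts hij (h * u) v
    set a1 := T.prj (T.P i j) 1 v with ha1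
    set a2 := T.prj (T.P i j) h v with ha2
    set a3 := T.prj (T.P i j) (h * u) v with ha3
    have m12 : a1⁻¹ * a2 ∈ T.P i j := mem_trans f2 (mem_symm g2)
    have m23 : a2⁻¹ * a3 ∈ T.P i j := mem_trans g2 (mem_symm k2)
    have l12 : T.ℓ (a1⁻¹ * a2) ≤ R := (T.lip f1 g1 m12).trans D12
    have l23 : T.ℓ (a2⁻¹ * a3) ≤ R := (T.lip g1 k1 m23).trans D23
    obtain ⟨c, c1, c2, c3⟩ := hC2 i j hij _ m12 _ m23 l12 l23
    have e13 : a1⁻¹ * a2 * (a2⁻¹ * a3) = a1⁻¹ * a3 := by group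
    rw [e13] at c3
    refine ⟨a1 * c, ?_, ?_, ?_⟩
    · obtain ⟨z, hz, hm⟩ := T.pair_vis h33 hij (by omega) b1 b2 v12
      exact T.Cand_mem hij hz hm ha1 ha2 c1
    · have t23 : T.V2 1 u i j (h⁻¹ * v) ∨ T.Ptp (2 * R) 1 u (h⁻¹ * v) := by
        rcases v23 with h1 | h1
        · left
          have := (T.V2_left h⁻¹ h (h * u) hij v).2 h1
          simpa using this
        · right
          have := T.Ptp_left (2 * R) h⁻¹ h (h * u) v h1
          simpa using this
      have b2' : T.D 1 (h⁻¹ * v) ≤ 2 * R := by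
        have := T.D_left h⁻¹ h v
        rw [inv_mul_cancel] at this; omega
      have b3' : T.D u (h⁻¹ * v) ≤ 2 * R := by
        have := T.D_left h⁻¹ (h * u) v
        rw [inv_mul_cancel_left] at this; omega
      obtain ⟨z, hz, hm⟩ := T.pair_vis h33 hij D1u b2' b3' t23
      have q2 : h⁻¹ * a2 = T.prj (T.P i j) 1 (h⁻¹ * v) := by
        rw [ha2, ← T.prj_left (T.gP hij), inv_mul_cancel]
      have q3 : h⁻¹ * a3 = T.prj (T.P i j) u (h⁻¹ * v) := by
        rw [ha3, ← T.prj_left (T.gP hij), inv_mul_cancel_left]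
      have := T.Cand_mem (C := C) (c := (a1⁻¹ * a2)⁻¹ * c) hij hz hm q2 q3 (by
        have e : (h⁻¹ * a2)⁻¹ * (h⁻¹ * a3) = a2⁻¹ * a3 := by group
        rw [e]; exact c2)
      have e : h⁻¹ * (a1 * c) = h⁻¹ * a2 * ((a1⁻¹ * a2)⁻¹ * c) := by group
      rw [e]; exact this
    · obtain ⟨z, hz, hm⟩ := T.pair_vis h33 hij D13 b1 b3 v13
      exact T.Cand_mem hij hz hm ha1 ha3 c3

end Art

/-- **Theorem (Ciobanu–Holt–Rees).** An Artin group of large type whose defining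
Coxeter matrix satisfies the (3,3,m)-hypothesis has the rapid decay property with
respect to the word length on the standard generators. -/
theorem artin_largeType_33m_rapidDecay
    (n : ℕ) (hn : 2 ≤ n) (M : Fin n → Fin n → ℕ∞)
    (hsymm : ∀ i j, M i j = M j i)
    (hdiag : ∀ i, M i i = 1)
    (hlarge : ∀ i j, i ≠ j → 3 ≤ M i j)
    (h33m : ¬ ∃ i j k : Fin n, i ≠ j ∧ i ≠ k ∧ j ≠ k ∧
        M i j = 3 ∧ M i k = 3 ∧ M j k < ⊤) :
    RapidDecay (G := ArtinGroup n M) (ℓA n M) := by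
  obtain ⟨T, hM, hl⟩ := exists_art n M hlarge hsymm
  rw [← hl]
  refine T.rd ?_ ⟨0, by omega⟩ ⟨1, by omega⟩ (by simp)
  intro i j k h1 h2 h3 h4 h5
  rw [hM] at h4 h5 ⊢
  by_contra hc
  exact h33m ⟨i, j, k, h1, h2, h3, h4, h5, lt_top_iff_ne_top.2 hc⟩

end ArtinRD
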